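/- There is an absolute constant C > 0 such that, uniformly for all reals X, Y, Z, W with 2 ≤ Y ≤ Z ≤ W ≤ X/(2Z) and 2Z ≤ W ≤ Z², one has H(X,Y;Z,W) ≤ C·(X/log Y)·λ^{−δ}·(1 + log λ)^{−3/2}, where λ is defined by W = Z^{1+1/λ} (that is, λ = log Z / log(W/Z)) and δ := 1 − (1 + log log 2)/log 2 = 0.086071…. -/

import Mathlib

/-- `H(X,Y;Z,W) := #{n ≤ X : P⁻(n) > Y, ∃ d | n with Z < d ≤ W}`. -/
noncomputable def Hcount (X Y Z W : ℝ) : ℕ :=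
  Set.ncard {n : ℕ | 0 < n ∧ (n : ℝ) ≤ X ∧ (∀ p : ℕ, p.Prime → p ∣ n → Y < (p : ℝ)) ∧
    ∃ d : ℕ, d ∣ n ∧ Z < (d : ℝ) ∧ (d : ℝ) ≤ W}

namespace FordDivisor

open Finset Real

/-- Formal harmonic function of the compensated Poisson walk. -/
noncomputable def F (X : ℝ) : ℕ → ℝ
  | 0 => 1
  | K + 1 => X ^ (K + 1) / (K + 1).factorial - X ^ K / K.factorial

lemma exp_conv (X s : ℝ) (K : ℕ) :
    ∑ b ∈ range (K + 1), s ^ b / b.factorial * (X ^ (K - b) / (K - b).factorial) =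
      (X + s) ^ K / K.factorial := by
  rw [add_comm X s, add_pow, Finset.sum_div]
  refine Finset.sum_congr rfl fun b hb => ?_
  have hb : b ≤ K := Nat.lt_succ_iff.mp (mem_range.mp hb)
  have h := Nat.choose_mul_factorial_mul_factorial hb
  have h' : (K.choose b : ℝ) * b.factorial * (K - b).factorial = K.factorial := by
    exact_mod_cast h
  have h1 : (b.factorial : ℝ) ≠ 0 := by positivity
  have h2 : ((K - b).factorial : ℝ) ≠ 0 := by positivity
  have h3 : (K.factorial : ℝ) ≠ 0 := by positivity
  rw [← h']
  have h4 : (K.choose b : ℝ) ≠ 0 := by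
    intro h0; rw [h0] at h'; simp at h'; exact h3 h'.symm
  field_simp

lemma F_conv (X s : ℝ) (K : ℕ) :
    ∑ b ∈ range (K + 1), s ^ b / b.factorial * F X (K - b) = F (X + s) K := by
  cases K with
  | zero => simp [F]
  | succ K =>
    rw [Finset.sum_range_succ]
    have : ∑ b ∈ range (K + 1), s ^ b / b.factorial * F X (K + 1 - b) =
        ∑ b ∈ range (K + 1), s ^ b / b.factorial * (X ^ (K + 1 - b) / (K + 1 - b).factorial)
        - ∑ b ∈ range (K + 1), s ^ b / b.factorial * (X ^ (K - b) / (K - b).factorial) := by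
      rw [← Finset.sum_sub_distrib]
      refine Finset.sum_congr rfl fun b hb => ?_
      have hb : b ≤ K := Nat.lt_succ_iff.mp (mem_range.mp hb)
      obtain ⟨l, rfl⟩ := Nat.exists_eq_add_of_le hb
      have e1 : b + l + 1 - b = l + 1 := by omega
      have e2 : b + l - b = l := by omega
      rw [e1, e2]; simp [F]; ring
    rw [this, exp_conv]
    have h2 := exp_conv X s (K + 1)
    rw [Finset.sum_range_succ] at h2
    simp only [F, Nat.sub_self, pow_zero, Nat.factorial_zero, Nat.cast_one, div_one, mul_one] at h2 ⊢
    linarith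

lemma F_succ_eq (X : ℝ) (K : ℕ) :
    F X (K + 1) = (X - (K + 1)) * X ^ K / (K + 1).factorial := by
  simp only [F, Nat.factorial_succ, Nat.cast_mul, Nat.cast_add, Nat.cast_one]
  have : (K.factorial : ℝ) ≠ 0 := by positivity
  have : ((K : ℝ) + 1) ≠ 0 := by positivity
  field_simp
  ring

lemma F_nonneg {X : ℝ} {K : ℕ} (h : (K : ℝ) ≤ X) : 0 ≤ F X K := by
  cases K with
  | zero => simp [F]
  | succ K =>
    rw [F_succ_eq]
    push_cast at h
    have : 0 ≤ X := le_trans (by positivity) h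
    have : 0 ≤ X - (K + 1) := by linarith
    positivity

lemma F_mono {X X' : ℝ} {K : ℕ} (h : (K : ℝ) ≤ X) (h' : X ≤ X') : F X K ≤ F X' K := by
  cases K with
  | zero => simp [F]
  | succ K =>
    rw [F_succ_eq, F_succ_eq]
    push_cast at h
    have : 0 ≤ X := le_trans (by positivity) h
    have : 0 ≤ X - (K + 1) := by linarith
    have : 0 ≤ X' - (K + 1) := by linarith
    gcongr

/-- Weighted sum over lists of length `n` with entries below `B`; the `i`-th entry `b` has
weight `s i ^ b / b!`. -/
noncomputable def Ew (B : ℕ) (s : ℕ → ℝ) : ℕ → (List ℕ → ℝ) → ℝ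
  | 0, Φ => Φ []
  | n + 1, Φ => Ew B s n (fun c => ∑ b ∈ range B, s n ^ b / b.factorial * Φ (c ++ [b]))

lemma Ew_mono {B : ℕ} {s : ℕ → ℝ} (hs : ∀ i, 0 ≤ s i) {n : ℕ} :
    ∀ {Φ Ψ : List ℕ → ℝ}, (∀ c, c.length = n → Φ c ≤ Ψ c) → Ew B s n Φ ≤ Ew B s n Ψ := by
  induction n with
  | zero => intro Φ Ψ h; exact h [] rfl
  | succ n ih =>
    intro Φ Ψ h
    refine ih fun c hc => Finset.sum_le_sum fun b _ => ?_
    have := hs n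
    exact mul_le_mul_of_nonneg_left (h _ (by simp [hc])) (by positivity)

lemma Ew_congr {B : ℕ} {s : ℕ → ℝ} {n : ℕ} :
    ∀ {Φ Ψ : List ℕ → ℝ}, (∀ c, c.length = n → Φ c = Ψ c) → Ew B s n Φ = Ew B s n Ψ := by
  induction n with
  | zero => intro Φ Ψ h; exact h [] rfl
  | succ n ih =>
    intro Φ Ψ h
    refine ih fun c hc => Finset.sum_congr rfl fun b _ => ?_
    rw [h _ (by simp [hc])]

lemma Ew_mul {B : ℕ} {s : ℕ → ℝ} (a : ℝ) {n : ℕ} :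
    ∀ {Φ : List ℕ → ℝ}, Ew B s n (fun c => a * Φ c) = a * Ew B s n Φ := by
  induction n with
  | zero => intro Φ; rfl
  | succ n ih =>
    intro Φ
    simp only [Ew]
    rw [← ih]
    congr 1
    ext c
    rw [Finset.mul_sum]
    exact Finset.sum_congr rfl fun b _ => by ring

lemma Ew_sum {B : ℕ} {s : ℕ → ℝ} {ι : Type*} (t : Finset ι) {n : ℕ} :
    ∀ {Φ : ι → List ℕ → ℝ}, Ew B s n (fun c => ∑ x ∈ t, Φ x c) = ∑ x ∈ t, Ew B s n (Φ x) := by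
  induction n with
  | zero => intro Φ; rfl
  | succ n ih =>
    intro Φ
    simp only [Ew]
    rw [← ih]
    congr 1
    ext c
    rw [Finset.sum_comm]
    exact Finset.sum_congr rfl fun b _ => by rw [Finset.mul_sum]

lemma Ew_add {B : ℕ} {s : ℕ → ℝ} {n : ℕ} :
    ∀ {Φ Ψ : List ℕ → ℝ}, Ew B s n (fun c => Φ c + Ψ c) = Ew B s n Φ + Ew B s n Ψ := by
  induction n with
  | zero => intro Φ Ψ; rfl
  | succ n ih =>
    intro Φ Ψ
    simp only [Ew]
    rw [← ih]
    congr 1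
    ext c
    rw [← Finset.sum_add_distrib]
    exact Finset.sum_congr rfl fun b _ => by ring

lemma Ew_nonneg {B : ℕ} {s : ℕ → ℝ} (hs : ∀ i, 0 ≤ s i) {n : ℕ} {Φ : List ℕ → ℝ}
    (h : ∀ c, c.length = n → 0 ≤ Φ c) : 0 ≤ Ew B s n Φ := by
  have h0 : Ew B s n (fun _ => 0) = 0 := by
    have := Ew_mul (B := B) (s := s) 0 (n := n) (Φ := fun _ => 0)
    simpa using this
  rw [← h0]
  exact Ew_mono hs h

lemma Ew_append {B : ℕ} {s : ℕ → ℝ} (j : ℕ) {l : ℕ} :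
    ∀ {Φ : List ℕ → ℝ}, Ew B s (j + l) Φ =
      Ew B s j (fun c => Ew B (fun i => s (j + i)) l (fun d => Φ (c ++ d))) := by
  induction l with
  | zero => intro Φ; simp [Ew]
  | succ l ih =>
    intro Φ
    simp only [Ew, Nat.add_eq]
    rw [ih]
    simp [List.append_assoc]

/-- All prefix sums stay below the line of slope one and height `m`. -/
def Good (m : ℕ) (c : List ℕ) : Prop := ∀ i ≤ c.length, (c.take i).sum ≤ i + m

lemma Good.of_append {m : ℕ} {c d : List ℕ} (h : Good m (c ++ d)) : Good m c := by
  intro i hi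
  have := h i (by simp; omega)
  rwa [List.take_append_of_le_length hi] at this

lemma Good.sum_le {m : ℕ} {c : List ℕ} (h : Good m c) : c.sum ≤ c.length + m := by
  simpa using h c.length le_rfl

open Classical in
/-- Weight of the good lists with prescribed sum and insertion weight `Φ`. -/
noncomputable def goodInd (m k : ℕ) (c : List ℕ) : ℝ := if Good m c ∧ c.sum = k then 1 else 0

lemma goodInd_nonneg (m k : ℕ) (c : List ℕ) : 0 ≤ goodInd m k c := by
  unfold goodInd; split_ifs <;> norm_num

lemma goodInd_eq_zero {m k n : ℕ} {c : List ℕ} (hc : c.length = n) (hk : n + m < k) :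
    goodInd m k c = 0 := by
  unfold goodInd
  rw [if_neg]
  rintro ⟨h, rfl⟩
  have := h.sum_le
  omega

lemma goodInd_snoc_le {m k b : ℕ} {c : List ℕ} :
    goodInd m k (c ++ [b]) ≤ if b ≤ k then goodInd m (k - b) c else 0 := by
  by_cases h : Good m (c ++ [b]) ∧ (c ++ [b]).sum = k
  · have h2 : c.sum + b = k := by simpa using h.2
    have hb : b ≤ k := by omega
    rw [if_pos hb]
    unfold goodInd
    rw [if_pos h, if_pos ⟨h.1.of_append, by omega⟩]
  · unfold goodInd
    rw [if_neg h]
    split_ifs <;> norm_num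

lemma sum_range_ite_le {B k : ℕ} {f : ℕ → ℝ} (hf : ∀ b ≤ k, 0 ≤ f b) :
    ∑ b ∈ range B, (if b ≤ k then f b else 0) ≤ ∑ b ∈ range (k + 1), f b := by
  rw [← Finset.sum_filter]
  refine Finset.sum_le_sum_of_subset_of_nonneg ?_ ?_
  · intro b hb
    simp only [mem_filter, mem_range] at hb ⊢
    omega
  · intro b hb _
    exact hf b (by simpa [Nat.lt_succ_iff] using hb)

lemma Ew_goodInd_le {B : ℕ} {s : ℕ → ℝ} (hs : ∀ i, 1 ≤ s i) (m q : ℕ) (n : ℕ) :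
    ∀ k : ℕ, k ≤ n + m + 1 → Ew B s n (goodInd m k) * F (m + q + 1) q ≤
      F (∑ i ∈ range n, s i + (m + q + 1)) (k + q) := by
  have hs0 : ∀ i, 0 ≤ s i := fun i => by linarith [hs i]
  have hτ : ∀ n : ℕ, (n : ℝ) ≤ ∑ i ∈ range n, s i := fun n => by
    have := Finset.card_nsmul_le_sum (range n) s 1 (fun i _ => hs i)
    simpa using this
  have hF0 : 0 ≤ F (m + q + 1) q := F_nonneg (by have : (0:ℝ) ≤ m := by positivity
                                                 linarith)
  induction n with
  | zero =>
    intro k hk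
    simp only [Ew, goodInd]
    by_cases h : k = 0
    · subst h
      rw [if_pos]
      · simp
      · exact ⟨by intro i hi; simp, by simp⟩
    · rw [if_neg (by simp; intro _ h'; exact h h'.symm)]
      rw [zero_mul]
      apply F_nonneg
      push_cast
      have : (k : ℝ) ≤ 0 + m + 1 := by exact_mod_cast hk
      simp
      linarith
  | succ n ih =>
    intro k hk
    have hk' : (k : ℝ) ≤ n + 1 + m + 1 := by exact_mod_cast hk
    rcases Nat.lt_or_ge (n + 1 + m) k with h | h
    · have : Ew B s (n + 1) (goodInd m k) = 0 := by
        have : Ew B s (n + 1) (goodInd m k) = Ew B s (n + 1) (fun c => 0 * goodInd m k c) :=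
          Ew_congr fun c hc => by rw [goodInd_eq_zero hc h]; simp
        rw [this, Ew_mul, zero_mul]
      rw [this, zero_mul]
      apply F_nonneg
      have := hτ (n + 1)
      push_cast at *
      linarith
    · have h1 : Ew B s (n + 1) (goodInd m k) ≤
          ∑ b ∈ range B, (if b ≤ k then s n ^ b / b.factorial * Ew B s n (goodInd m (k - b))
            else 0) := by
        simp only [Ew]
        calc Ew B s n (fun c => ∑ b ∈ range B, s n ^ b / b.factorial * goodInd m k (c ++ [b]))
            ≤ Ew B s n (fun c => ∑ b ∈ range B, (s n ^ b / b.factorial * if b ≤ k then 1 else 0) *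
                goodInd m (k - b) c) := by
              refine Ew_mono hs0 fun c _ => Finset.sum_le_sum fun b _ => ?_
              have := hs0 n
              rw [mul_assoc]
              refine mul_le_mul_of_nonneg_left ?_ (by positivity)
              refine (goodInd_snoc_le).trans ?_
              split_ifs <;> simp
          _ = ∑ b ∈ range B, (s n ^ b / b.factorial * if b ≤ k then 1 else 0) *
                Ew B s n (goodInd m (k - b)) := by
              rw [Ew_sum]
              exact Finset.sum_congr rfl fun b _ => Ew_mul _
          _ = _ := Finset.sum_congr rfl fun b _ => by split_ifs <;> simp
      have h2 := h1.trans (sum_range_ite_le (fun b _ => by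
        have := hs0 n
        have := Ew_nonneg (B := B) hs0 (n := n) (fun c _ => goodInd_nonneg m (k - b) c)
        positivity))
      calc _ ≤ (∑ b ∈ range (k + 1), s n ^ b / b.factorial * Ew B s n (goodInd m (k - b))) *
              F (m + q + 1) q := mul_le_mul_of_nonneg_right h2 hF0
        _ = ∑ b ∈ range (k + 1), s n ^ b / b.factorial * (Ew B s n (goodInd m (k - b)) *
              F (m + q + 1) q) := by rw [Finset.sum_mul]; simp only [mul_assoc]
        _ ≤ ∑ b ∈ range (k + 1), s n ^ b / b.factorial *
              F (∑ i ∈ range n, s i + (m + q + 1)) (k + q - b) := by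
            refine Finset.sum_le_sum fun b hb => ?_
            have := hs0 n
            have hb : b ≤ k := Nat.lt_succ_iff.mp (mem_range.mp hb)
            have := ih (k - b) (by omega)
            rw [show k + q - b = k - b + q by omega]
            gcongr
        _ ≤ ∑ b ∈ range (k + q + 1), s n ^ b / b.factorial *
              F (∑ i ∈ range n, s i + (m + q + 1)) (k + q - b) := by
            refine Finset.sum_le_sum_of_subset_of_nonneg ?_ ?_
            · intro b hb; simp only [mem_range] at *; omega
            · intro b hb _
              have := hs0 n
              have hF : 0 ≤ F (∑ i ∈ range n, s i + (m + q + 1)) (k + q - b) := by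
                apply F_nonneg
                have h3 : ((k + q - b : ℕ) : ℝ) ≤ ((k + q : ℕ) : ℝ) := by
                  exact_mod_cast Nat.sub_le _ _
                have h4 := hτ n
                have h5 : (k : ℝ) ≤ n + 1 + m := by exact_mod_cast h
                push_cast at h3
                linarith
              positivity
        _ = _ := by
            rw [F_conv, Finset.sum_range_succ]
            congr 1
            ring

/-- Dyadically weighted sum of the entries of a list. -/
noncomputable def Qw (c : List ℕ) : ℝ := ∑ i ∈ range c.length, (c.getD i 0 : ℝ) * 2 ^ (i + 1)

lemma Qw_nonneg (c : List ℕ) : 0 ≤ Qw c := Finset.sum_nonneg fun i _ => by positivity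

lemma Qw_snoc (c : List ℕ) (b : ℕ) : Qw (c ++ [b]) = Qw c + b * 2 ^ (c.length + 1) := by
  unfold Qw
  rw [List.length_append, List.length_singleton, Finset.sum_range_succ]
  congr 1
  · refine Finset.sum_congr rfl fun i hi => ?_
    rw [List.getD_append _ _ _ _ (mem_range.mp hi)]
  · rw [List.getD_append_right _ _ _ _ le_rfl]
    simp

lemma Qw_eq_zero {c : List ℕ} (h : c.sum = 0) : Qw c = 0 := by
  unfold Qw
  refine Finset.sum_eq_zero fun i hi => ?_
  have hi := mem_range.mp hi
  rw [List.sum_eq_zero_iff] at h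
  rw [List.getD_eq_getElem _ _ hi, h _ (List.getElem_mem hi)]
  simp

lemma le_sum_range {s : ℕ → ℝ} (hs : ∀ i, 1 ≤ s i) (n : ℕ) : (n : ℝ) ≤ ∑ i ∈ range n, s i := by
  have := Finset.card_nsmul_le_sum (range n) s 1 (fun i _ => hs i)
  simpa using this

lemma F_partial_conv {X s : ℝ} (hs : 0 ≤ s) {k q : ℕ} (h : ((k + q : ℕ) : ℝ) ≤ X) :
    ∑ b ∈ range (k + 1), s ^ b / b.factorial * F X (k - b + q) ≤ F (X + s) (k + q) := by
  rw [← F_conv]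
  calc _ = ∑ b ∈ range (k + 1), s ^ b / b.factorial * F X (k + q - b) := by
        refine Finset.sum_congr rfl fun b hb => ?_
        have := mem_range.mp hb
        rw [show k + q - b = k - b + q by omega]
    _ ≤ _ := by
        refine Finset.sum_le_sum_of_subset_of_nonneg ?_ ?_
        · intro b hb; simp only [mem_range] at *; omega
        · intro b hb _
          have hF : 0 ≤ F X (k + q - b) := by
            apply F_nonneg
            have h3 : ((k + q - b : ℕ) : ℝ) ≤ ((k + q : ℕ) : ℝ) := by
              exact_mod_cast Nat.sub_le _ _
            linarith
          positivity

lemma Ew_goodInd_mul_Qw_le {B : ℕ} {s : ℕ → ℝ} {S : ℝ} (hs : ∀ i, 1 ≤ s i) (hS : ∀ i, s i ≤ S)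
    (m q : ℕ) (n : ℕ) :
    ∀ k : ℕ, k ≤ n + m + 1 → Ew B s n (fun c => goodInd m (k + 1) c * Qw c) * F (m + q + 1) q ≤
      S * 2 ^ (n + 2) * F (∑ i ∈ range n, s i + (m + q + 1)) (k + q) := by
  have hs0 : ∀ i, 0 ≤ s i := fun i => by linarith [hs i]
  have hS0 : 0 ≤ S := (hs0 0).trans (hS 0)
  have hτ := le_sum_range hs
  have hF0 : 0 ≤ F (m + q + 1) q := F_nonneg (by have : (0:ℝ) ≤ m := by positivity
                                                 linarith)
  induction n with
  | zero =>
    intro k hk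
    simp only [Ew]
    have : Qw [] = 0 := Qw_eq_zero (by simp)
    rw [this, mul_zero, zero_mul]
    have : 0 ≤ F (∑ i ∈ range 0, s i + (m + q + 1)) (k + q) := by
      apply F_nonneg
      push_cast
      have : (k : ℝ) ≤ 0 + m + 1 := by exact_mod_cast hk
      simp
      linarith
    positivity
  | succ n ih =>
    intro k hk
    have hk' : (k : ℝ) ≤ n + 1 + m + 1 := by exact_mod_cast hk
    rcases Nat.lt_or_ge (n + 1 + m) (k + 1) with h | h
    · have : Ew B s (n + 1) (fun c => goodInd m (k + 1) c * Qw c) = 0 := by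
        have : Ew B s (n + 1) (fun c => goodInd m (k + 1) c * Qw c) =
            Ew B s (n + 1) (fun c => 0 * goodInd m k c) :=
          Ew_congr fun c hc => by rw [goodInd_eq_zero hc h]; simp
        rw [this, Ew_mul, zero_mul]
      rw [this, zero_mul]
      have : 0 ≤ F (∑ i ∈ range (n + 1), s i + (m + q + 1)) (k + q) := by
        apply F_nonneg
        have := hτ (n + 1)
        push_cast at *
        linarith
      positivity
    · set X := ∑ i ∈ range n, s i + (m + q + 1 : ℝ) with hX
      have hkX : ((k + q : ℕ) : ℝ) ≤ X := by
        have h5 : (k : ℝ) + 1 ≤ n + 1 + m := by exact_mod_cast h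
        have := hτ n
        push_cast; linarith
      have hsn := hs0 n
      have h1 : Ew B s (n + 1) (fun c => goodInd m (k + 1) c * Qw c) ≤
          ∑ b ∈ range B, (if b ≤ k + 1 then s n ^ b / b.factorial *
            (Ew B s n (fun c => goodInd m (k + 1 - b) c * Qw c) +
              b * 2 ^ (n + 1) * Ew B s n (goodInd m (k + 1 - b))) else 0) := by
        simp only [Ew]
        calc Ew B s n (fun c => ∑ b ∈ range B, s n ^ b / b.factorial *
                (goodInd m (k + 1) (c ++ [b]) * Qw (c ++ [b])))
            ≤ Ew B s n (fun c => ∑ b ∈ range B, (s n ^ b / b.factorial * if b ≤ k + 1 then 1 else 0) *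
                (goodInd m (k + 1 - b) c * Qw c + b * 2 ^ (n + 1) * goodInd m (k + 1 - b) c)) := by
              refine Ew_mono hs0 fun c hc => Finset.sum_le_sum fun b _ => ?_
              rw [mul_assoc, Qw_snoc, hc]
              refine mul_le_mul_of_nonneg_left ?_ (by positivity)
              have hQ := Qw_nonneg c
              have : goodInd m (k + 1) (c ++ [b]) * (Qw c + b * 2 ^ (n + 1)) ≤
                (if b ≤ k + 1 then goodInd m (k + 1 - b) c else 0) * (Qw c + b * 2 ^ (n + 1)) :=
                mul_le_mul_of_nonneg_right goodInd_snoc_le (by positivity)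
              refine this.trans (le_of_eq ?_)
              split_ifs
              · ring
              · simp
          _ = ∑ b ∈ range B, (s n ^ b / b.factorial * if b ≤ k + 1 then 1 else 0) *
                (Ew B s n (fun c => goodInd m (k + 1 - b) c * Qw c) +
              b * 2 ^ (n + 1) * Ew B s n (goodInd m (k + 1 - b))) := by
              rw [Ew_sum]
              exact Finset.sum_congr rfl fun b _ => by rw [Ew_mul, Ew_add, Ew_mul]
          _ = _ := Finset.sum_congr rfl fun b _ => by split_ifs <;> simp
      have hA0 : ∀ k, 0 ≤ Ew B s n (goodInd m k) := fun k =>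
        Ew_nonneg hs0 (fun c _ => goodInd_nonneg m k c)
      have hJ0 : ∀ k, 0 ≤ Ew B s n (fun c => goodInd m k c * Qw c) := fun k =>
        Ew_nonneg hs0 (fun c _ => mul_nonneg (goodInd_nonneg m k c) (Qw_nonneg c))
      have h2 := h1.trans (sum_range_ite_le (fun b _ => by
        have := hA0 (k + 1 - b)
        have := hJ0 (k + 1 - b)
        positivity))
      have hJz : Ew B s n (fun c => goodInd m 0 c * Qw c) = 0 := by
        have : Ew B s n (fun c => goodInd m 0 c * Qw c) = Ew B s n (fun c => 0 * Qw c) := by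
          refine Ew_congr fun c _ => ?_
          unfold goodInd
          split_ifs with h
          · rw [Qw_eq_zero h.2]; simp
          · rfl
        rw [this, Ew_mul, zero_mul]
      have h3 : ∑ b ∈ range (k + 1 + 1), s n ^ b / b.factorial *
            (Ew B s n (fun c => goodInd m (k + 1 - b) c * Qw c) +
              b * 2 ^ (n + 1) * Ew B s n (goodInd m (k + 1 - b))) =
          ∑ b ∈ range (k + 1), s n ^ b / b.factorial *
            Ew B s n (fun c => goodInd m (k - b + 1) c * Qw c) +
          s n * 2 ^ (n + 1) * ∑ b ∈ range (k + 1), s n ^ b / b.factorial *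
            Ew B s n (goodInd m (k - b)) := by
        simp only [mul_add]
        rw [Finset.sum_add_distrib]
        congr 1
        · rw [Finset.sum_range_succ, Nat.sub_self, hJz, mul_zero, add_zero]
          refine Finset.sum_congr rfl fun b hb => ?_
          have := mem_range.mp hb
          rw [show k + 1 - b = k - b + 1 by omega]
        · rw [Finset.sum_range_succ']
          simp only [Nat.cast_zero, zero_mul, mul_zero, add_zero, Nat.add_sub_add_right]
          rw [Finset.mul_sum]
          refine Finset.sum_congr rfl fun b hb => ?_
          rw [Nat.factorial_succ]
          push_cast
          have : (b.factorial : ℝ) ≠ 0 := by positivity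
          have : ((b : ℝ) + 1) ≠ 0 := by positivity
          field_simp
          ring
      rw [h3] at h2
      have hXs : ∑ i ∈ range (n + 1), s i + (m + q + 1 : ℝ) = X + s n := by
        rw [Finset.sum_range_succ, hX]; ring
      have hconv := F_partial_conv hsn hkX
      have h4 : (∑ b ∈ range (k + 1), s n ^ b / b.factorial *
            Ew B s n (fun c => goodInd m (k - b + 1) c * Qw c)) * F (m + q + 1) q ≤
            S * 2 ^ (n + 2) * F (X + s n) (k + q) := by
        refine le_trans ?_ (mul_le_mul_of_nonneg_left hconv (by positivity))
        rw [Finset.sum_mul, Finset.mul_sum]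
        refine Finset.sum_le_sum fun b hb => ?_
        have hb := mem_range.mp hb
        have := mul_le_mul_of_nonneg_left (ih (k - b) (by omega))
          (show 0 ≤ s n ^ b / b.factorial by positivity)
        linarith
      have h5 : (∑ b ∈ range (k + 1), s n ^ b / b.factorial *
            Ew B s n (goodInd m (k - b))) * F (m + q + 1) q ≤ F (X + s n) (k + q) := by
        refine le_trans ?_ hconv
        rw [Finset.sum_mul]
        refine Finset.sum_le_sum fun b hb => ?_
        have hb := mem_range.mp hb
        have := mul_le_mul_of_nonneg_left (Ew_goodInd_le (B := B) hs m q n (k - b) (by omega))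
          (show 0 ≤ s n ^ b / b.factorial by positivity)
        linarith
      have hF1 : 0 ≤ F (X + s n) (k + q) := F_nonneg (by linarith)
      rw [hXs]
      have h6 := mul_le_mul_of_nonneg_left h5 (show 0 ≤ s n * 2 ^ (n + 1) by positivity)
      have h7 : s n * 2 ^ (n + 1) * F (X + s n) (k + q) ≤ S * 2 ^ (n + 1) * F (X + s n) (k + q) := by
        have := hS n
        gcongr
      have h8 := mul_le_mul_of_nonneg_right h2 hF0
      have h9 : 0 ≤ S * 2 ^ (n + 1) * F (X + s n) (k + q) := by positivity
      calc _ ≤ _ := h8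
        _ = (∑ b ∈ range (k + 1), s n ^ b / b.factorial *
            Ew B s n (fun c => goodInd m (k - b + 1) c * Qw c)) * F (m + q + 1) q +
            s n * 2 ^ (n + 1) * ((∑ b ∈ range (k + 1), s n ^ b / b.factorial *
            Ew B s n (goodInd m (k - b))) * F (m + q + 1) q) := by ring
        _ ≤ S * 2 ^ (n + 2) * F (X + s n) (k + q) + S * 2 ^ (n + 1) * F (X + s n) (k + q) := by
            linarith
        _ ≤ S * 2 ^ (n + 1 + 2) * F (X + s n) (k + q) := by
            have e1 : S * 2 ^ (n + 2) * F (X + s n) (k + q) =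
              2 * (S * 2 ^ (n + 1) * F (X + s n) (k + q)) := by ring
            have e2 : S * 2 ^ (n + 1 + 2) * F (X + s n) (k + q) =
              4 * (S * 2 ^ (n + 1) * F (X + s n) (k + q)) := by ring
            linarith

lemma pow_div_factorial_le_self {L K : ℕ} (h : K ≤ L) :
    (L : ℝ) ^ K / K.factorial ≤ (L : ℝ) ^ L / L.factorial := by
  have h1 := Nat.factorial_mul_pow_sub_le_factorial h
  rw [div_le_div_iff₀ (by positivity) (by positivity)]
  have h2 : L.factorial ≤ K.factorial * L ^ (L - K) := by
    obtain ⟨d, rfl⟩ := Nat.exists_eq_add_of_le h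
    rw [Nat.add_sub_cancel_left]
    clear h1 h
    have : ∀ d', d' ≤ d → (K + d').factorial ≤ K.factorial * (K + d) ^ d' := by
      intro d'
      induction d' with
      | zero => simp
      | succ e ih =>
        intro he
        rw [← Nat.add_assoc, Nat.factorial_succ, pow_succ]
        calc (K + e + 1) * (K + e).factorial ≤ (K + d) * (K.factorial * (K + d) ^ e) :=
              Nat.mul_le_mul (by omega) (ih (by omega))
          _ = _ := by ring
    exact this d le_rfl
  have h3 : (L.factorial : ℝ) ≤ K.factorial * (L : ℝ) ^ (L - K) := by exact_mod_cast h2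
  calc (L : ℝ) ^ K * L.factorial ≤ (L : ℝ) ^ K * (K.factorial * (L : ℝ) ^ (L - K)) := by gcongr
    _ = (L : ℝ) ^ (K + (L - K)) * K.factorial := by rw [pow_add]; ring
    _ = _ := by rw [Nat.add_sub_cancel' h]

lemma self_pow_div_factorial_le {L : ℕ} (h : 1 ≤ L) :
    (L : ℝ) ^ L / L.factorial ≤ exp L / √L := by
  have h1 := Stirling.le_factorial_stirling L
  have hL : (0 : ℝ) < L := by exact_mod_cast h
  have h2 : √(L : ℝ) ≤ √(2 * π * L) := by
    apply Real.sqrt_le_sqrt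
    have := Real.pi_gt_three
    nlinarith
  have h3 : √(L : ℝ) * (L / exp 1) ^ L ≤ L.factorial := le_trans (by gcongr) h1
  rw [div_pow, ← Real.exp_nat_mul, mul_one] at h3
  have hs : 0 < √(L : ℝ) := Real.sqrt_pos.mpr hL
  rw [div_le_div_iff₀ (by positivity) hs]
  have : √(L : ℝ) * (L ^ L / exp L) * exp L = √(L : ℝ) * L ^ L := by
    field_simp
  nlinarith [Real.exp_pos (L : ℝ)]

lemma F_le {L K : ℕ} (hL : 1 ≤ L) (h : K ≤ L) :
    F L K ≤ ((L : ℝ) - K) * exp L * (L : ℝ) ^ (-(3 / 2) : ℝ) := by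
  have hL0 : (0 : ℝ) < L := by exact_mod_cast hL
  have h1 : F L K = ((L : ℝ) - K) / L * ((L : ℝ) ^ K / K.factorial) := by
    cases K with
    | zero => simp [F]; field_simp
    | succ K =>
      rw [F_succ_eq]
      push_cast
      have : ((K + 1).factorial : ℝ) ≠ 0 := by positivity
      field_simp
      ring
  have h2 := (pow_div_factorial_le_self h).trans (self_pow_div_factorial_le hL)
  have h3 : (0 : ℝ) ≤ (L : ℝ) - K := by
    have : (K : ℝ) ≤ L := by exact_mod_cast h
    linarith
  rw [h1]
  calc _ ≤ ((L : ℝ) - K) / L * (exp L / √L) := by gcongr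
    _ = _ := by
      rw [show (-(3 / 2) : ℝ) = -(1 + 1 / 2) by norm_num, Real.rpow_neg hL0.le,
        Real.rpow_add hL0, Real.rpow_one, ← Real.sqrt_eq_rpow]
      field_simp

lemma factorial_mul_exp_le (M : ℕ) (hM : 1 ≤ M) :
    (M.factorial : ℝ) * exp M ≤ exp 1 * (M : ℝ) ^ (M + 1) := by
  induction M, hM using Nat.le_induction with
  | base => simp
  | succ M hM ih =>
    have hM0 : (0 : ℝ) < M := by exact_mod_cast hM
    have h1 : exp (1 / ((M : ℝ) + 1)) * M ≤ M + 1 := by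
      have h2 := Real.add_one_le_exp (-(1 / ((M : ℝ) + 1)))
      have h3 : (M : ℝ) / (M + 1) ≤ exp (-(1 / ((M : ℝ) + 1))) := by
        refine le_trans (le_of_eq ?_) h2
        field_simp; ring
      rw [Real.exp_neg, div_le_iff₀ (by positivity)] at h3
      have h4 := Real.exp_pos (1 / ((M : ℝ) + 1))
      calc _ ≤ exp (1 / ((M : ℝ) + 1)) * ((exp (1 / ((M : ℝ) + 1)))⁻¹ * (M + 1)) := by gcongr
        _ = _ := by field_simp
    have h5 : exp 1 * (M : ℝ) ^ (M + 1) ≤ (M + 1) ^ (M + 1) := by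
      have := pow_le_pow_left₀ (by positivity) h1 (M + 1)
      rw [mul_pow, ← Real.exp_nat_mul] at this
      rwa [show ((M + 1 : ℕ) : ℝ) * (1 / ((M : ℝ) + 1)) = 1 by push_cast; field_simp] at this
    rw [Nat.factorial_succ]
    push_cast
    rw [Real.exp_add]
    calc ((M : ℝ) + 1) * M.factorial * (exp M * exp 1) = (M + 1) * exp 1 * (M.factorial * exp M) := by
          ring
      _ ≤ (M + 1) * exp 1 * ((M + 1) ^ (M + 1)) := by
          gcongr
          exact ih.trans h5
      _ = _ := by ring

lemma F_ge (M : ℕ) : 2 ^ M * exp M / (2 * exp 1 * (M + 1)) ≤ F (M + M + 1) M := by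
  rcases Nat.eq_zero_or_pos M with rfl | hM
  · simp only [pow_zero, Nat.cast_zero, Real.exp_zero, F]
    rw [div_le_one (by positivity)]
    have := Real.add_one_le_exp 1
    linarith
  · obtain ⟨K, rfl⟩ : ∃ K, M = K + 1 := ⟨M - 1, by omega⟩
    have h := factorial_mul_exp_le (K + 1) hM
    rw [F_succ_eq]
    push_cast at *
    have hf : (0:ℝ) < (K + 1).factorial := by positivity
    rw [div_le_div_iff₀ (by positivity) hf]
    set f : ℝ := ((K + 1).factorial : ℝ)
    set x : ℝ := (K : ℝ) + 1 with hx
    have hx0 : 0 < x := by positivity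
    have e1 : x + x + 1 - x = x + 1 := by ring
    rw [e1]
    calc 2 ^ (K + 1) * exp x * f = 2 ^ (K + 1) * (f * exp x) := by ring
      _ ≤ 2 ^ (K + 1) * (exp 1 * x ^ (K + 1 + 1)) := by gcongr
      _ = (x * 2) * (2 * x) ^ K * exp 1 * x := by ring_nf
      _ ≤ ((x + 1) * 2) * (x + x + 1) ^ K * exp 1 * (x + 1) := by
          gcongr <;> linarith
      _ = _ := by ring

lemma Ew_mono_lt {B : ℕ} {s : ℕ → ℝ} (hs : ∀ i, 0 ≤ s i) {n : ℕ} :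
    ∀ {Φ Ψ : List ℕ → ℝ}, (∀ c, c.length = n → (∀ b ∈ c, b < B) → Φ c ≤ Ψ c) →
      Ew B s n Φ ≤ Ew B s n Ψ := by
  induction n with
  | zero => intro Φ Ψ h; exact h [] rfl (by simp)
  | succ n ih =>
    intro Φ Ψ h
    refine ih fun c hc hB => Finset.sum_le_sum fun b hb => ?_
    have := hs n
    refine mul_le_mul_of_nonneg_left (h _ (by simp [hc]) ?_) (by positivity)
    intro x hx
    simp only [List.mem_append, List.mem_singleton] at hx
    rcases hx with hx | rfl
    · exact hB x hx
    · exact mem_range.mp hb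

lemma Ew_split {B : ℕ} {s : ℕ → ℝ} {j n : ℕ} (hj : j ≤ n) (f g : List ℕ → ℝ) :
    Ew B s n (fun c => f (c.take j) * g (c.drop j)) =
      Ew B s j f * Ew B (fun i => s (j + i)) (n - j) g := by
  obtain ⟨l, rfl⟩ := Nat.exists_eq_add_of_le hj
  rw [Ew_append, Nat.add_sub_cancel_left, mul_comm, ← Ew_mul]
  refine Ew_congr fun c hc => ?_
  rw [mul_comm, ← Ew_mul]
  refine Ew_congr fun d _ => ?_
  rw [List.take_left' hc, List.drop_left' hc]

lemma exists_cut {n B : ℕ} {c : List ℕ} (hc : c.length = n) (hB : ∀ b ∈ c, b < B) :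
    ∃ j ≤ n, ∃ M ≤ n * B, ∃ k ≤ n - j, (c.take j).sum = j + M ∧ Good M (c.take j) ∧
      (c.drop j).sum = k ∧ Good 0 (c.drop j) := by
  obtain ⟨j, hj, hmax⟩ := Finset.exists_max_image (range (n + 1))
    (fun j => ((c.take j).sum : ℤ) - j) ⟨0, by simp⟩
  have hj : j ≤ n := Nat.lt_succ_iff.mp (mem_range.mp hj)
  have h0 := hmax 0 (by simp)
  simp only [List.take_zero, List.sum_nil, Nat.cast_zero, sub_zero] at h0
  have hsum : c.sum ≤ n * B := by
    have := List.sum_le_card_nsmul c B (fun b hb => (hB b hb).le)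
    simpa [hc] using this
  have hcs : (c.take j).sum + (c.drop j).sum = c.sum := by
    rw [← List.sum_append, List.take_append_drop]
  have hd : ∀ i ≤ n - j, ((c.drop j).take i).sum ≤ i := by
    intro i hi
    have h1 := hmax (j + i) (by simp; omega)
    beta_reduce at h1
    rw [List.take_add, List.sum_append] at h1
    rw [Nat.cast_add, Nat.cast_add] at h1
    omega
  refine ⟨j, hj, (c.take j).sum - j, by omega, (c.drop j).sum, ?_, by omega, ?_, rfl, ?_⟩
  · have h1 := hd (n - j) le_rfl
    rwa [List.take_of_length_le (by simp [hc])] at h1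
  · intro i hi
    have hi' : i ≤ j := by simp at hi; omega
    rw [List.take_take, min_eq_left hi']
    have h1 := hmax i (by simp; omega)
    beta_reduce at h1
    omega
  · intro i hi
    simpa using hd i (by simpa [hc] using hi)

/-- The decay weight of the ballot problem. -/
noncomputable def ww (j : ℕ) : ℝ := ((j : ℝ) + 1) ^ (-(3 / 2) : ℝ)

lemma ww_pos (j : ℕ) : 0 < ww j := Real.rpow_pos_of_pos (by positivity) _

lemma F_le_ww {X : ℝ} {L K j D : ℕ} (hX : (K : ℝ) ≤ X) (hL : X ≤ L) (hjL : j + 1 ≤ L)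
    (hD : L ≤ K + D) : F X K ≤ D * exp L * ww j := by
  have h1 : K ≤ L := by exact_mod_cast hX.trans hL
  have h2 := (F_mono hX hL).trans (F_le (by omega) h1)
  have h3 : (L : ℝ) ≤ K + D := by exact_mod_cast hD
  have h4 : (K : ℝ) ≤ L := by exact_mod_cast h1
  have h5 : (L : ℝ) ^ (-(3 / 2) : ℝ) ≤ ww j := by
    unfold ww
    apply Real.rpow_le_rpow_of_nonpos (by positivity) (by exact_mod_cast hjL) (by norm_num)
  refine h2.trans ?_
  have : (L : ℝ) - K ≤ D := by linarith
  have : (0 : ℝ) ≤ (L : ℝ) - K := by linarith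
  gcongr

lemma Ew_first_le {B D : ℕ} {s : ℕ → ℝ} (hs : ∀ i, 1 ≤ s i)
    (hS : ∀ j : ℕ, ∑ i ∈ range j, s i ≤ j + D) (j M : ℕ) :
    (log 2) ^ (j + M) * Ew B s j (fun c => goodInd M (j + M) c * (1 + Qw c)) ≤
      ((D + 2) * (4 * D + 5) * exp (D + 1) * (2 * exp 1)) * (2 * exp 1 * log 2) ^ j * ww j *
        ((M + 1) * (exp 1 * log 2 / 2) ^ M) := by
  have hτ := le_sum_range hs
  have hSi : ∀ i, s i ≤ D + 1 := fun i => by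
    have h1 := hS (i + 1)
    rw [Finset.sum_range_succ] at h1
    have h2 := hτ i
    push_cast at h1
    linarith
  have hw := ww_pos j
  set X := Ew B s j (fun c => goodInd M (j + M) c * (1 + Qw c)) with hX
  set G := F (M + M + 1) M with hG
  have hGe := F_ge M
  rw [← hG] at hGe
  have hX0 : 0 ≤ X := Ew_nonneg (fun i => by linarith [hs i]) fun c _ =>
    mul_nonneg (goodInd_nonneg _ _ _) (by linarith [Qw_nonneg c])
  have hsplit : X = Ew B s j (goodInd M (j + M)) +
      Ew B s j (fun c => goodInd M (j + M) c * Qw c) := by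
    rw [hX, ← Ew_add]
    exact Ew_congr fun c _ => by ring
  set L := j + D + 2 * M + 1 with hL
  set E := ((D : ℝ) + 2) * exp L * ww j with hE
  have hE0 : 0 ≤ E := by positivity
  have hXL : ∑ i ∈ range j, s i + (M + M + 1 : ℝ) ≤ L := by
    have := hS j
    rw [hL]; push_cast; linarith
  have h1 : Ew B s j (goodInd M (j + M)) * G ≤ E := by
    refine (Ew_goodInd_le hs M M j (j + M) (by omega)).trans ?_
    refine (F_le_ww (L := L) (j := j) (D := D + 2) ?_ hXL (by omega) (by omega)).trans ?_
    · have := hτ j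
      push_cast; linarith
    · rw [hE]; push_cast; rfl
  have h2 : Ew B s j (fun c => goodInd M (j + M) c * Qw c) * G ≤ (D + 1) * 2 ^ (j + 2) * E := by
    rcases Nat.eq_zero_or_pos (j + M) with h | h
    · have : Ew B s j (fun c => goodInd M (j + M) c * Qw c) = Ew B s j (fun c => 0 * Qw c) := by
        refine Ew_congr fun c _ => ?_
        unfold goodInd
        split_ifs with h'
        · rw [Qw_eq_zero (h'.2.trans h)]; simp
        · rfl
      rw [this, Ew_mul, zero_mul, zero_mul]
      positivity
    · obtain ⟨k, hk⟩ : ∃ k, j + M = k + 1 := ⟨j + M - 1, by omega⟩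
      rw [hk]
      refine (Ew_goodInd_mul_Qw_le hs hSi M M j k (by omega)).trans ?_
      refine mul_le_mul_of_nonneg_left ?_ (by positivity)
      refine (F_le_ww (L := L) (j := j) (D := D + 2) ?_ hXL (by omega) (by omega)).trans ?_
      · have := hτ j
        have hk' : (j : ℝ) + M = k + 1 := by exact_mod_cast hk
        push_cast; linarith
      · rw [hE]; push_cast; rfl
  have h3 : X * G ≤ (4 * D + 5) * 2 ^ j * E := by
    rw [hsplit, add_mul]
    refine (add_le_add h1 h2).trans ?_
    have : (1 : ℝ) ≤ 2 ^ j := one_le_pow₀ (by norm_num)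
    rw [pow_add]
    nlinarith [mul_nonneg hE0 (sub_nonneg.mpr this)]
  have h4 : X * (2 ^ M * exp M / (2 * exp 1 * (M + 1))) ≤ (4 * D + 5) * 2 ^ j * E :=
    (mul_le_mul_of_nonneg_left hGe hX0).trans h3
  rw [← mul_div_assoc, div_le_iff₀ (by positivity)] at h4
  have hl : 0 < log 2 := Real.log_pos (by norm_num)
  have hEe : exp (L : ℝ) = exp (D + 1) * exp 1 ^ j * exp 1 ^ M * exp M := by
    rw [← Real.exp_nat_mul, ← Real.exp_nat_mul, ← Real.exp_add, ← Real.exp_add, ← Real.exp_add]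
    congr 1
    rw [hL]; push_cast; ring
  rw [hE, hEe] at h4
  have hem := Real.exp_pos (M : ℝ)
  have h5 : X * 2 ^ M ≤ (4 * D + 5) * 2 ^ j * ((D + 2) * (exp (D + 1) * exp 1 ^ j * exp 1 ^ M) * ww j) *
      (2 * exp 1 * (M + 1)) := by
    refine le_of_mul_le_mul_right ?_ hem
    calc _ = X * (2 ^ M * exp M) := by ring
      _ ≤ _ := h4
      _ = _ := by ring
  have h6 : X ≤ (4 * D + 5) * 2 ^ j * ((D + 2) * (exp (D + 1) * exp 1 ^ j * exp 1 ^ M) * ww j) *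
      (2 * exp 1 * (M + 1)) / 2 ^ M := by
    rw [le_div_iff₀ (by positivity)]; exact h5
  calc _ ≤ (log 2) ^ (j + M) * ((4 * D + 5) * 2 ^ j * ((D + 2) * (exp (D + 1) * exp 1 ^ j * exp 1 ^ M) * ww j) *
      (2 * exp 1 * (M + 1)) / 2 ^ M) := by gcongr
    _ = _ := by
      rw [div_pow, mul_pow, mul_pow, mul_pow, pow_add]
      ring

lemma summable_lin_geom {D : ℝ} {r : ℝ} (h0 : 0 ≤ r) (h1 : r < 1) :
    Summable fun k : ℕ => ((k : ℝ) + D) * r ^ k := by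
  have h2 : Summable fun k : ℕ => (k : ℝ) ^ 1 * r ^ k :=
    summable_pow_mul_geometric_of_norm_lt_one 1 (by rwa [Real.norm_of_nonneg h0])
  have h3 := (summable_geometric_of_lt_one h0 h1).mul_left D
  refine (h2.add h3).congr fun k => ?_
  ring

lemma exists_Ew_second_le (D : ℕ) : ∃ C : ℝ, 0 < C ∧ ∀ (B l : ℕ) (s : ℕ → ℝ), (∀ i, 1 ≤ s i) →
    (∀ j : ℕ, ∑ i ∈ range j, s i ≤ j + D) →
    ∑ k ∈ range (l + 1), (2 * log 2) ^ k * Ew B s l (goodInd 0 k) ≤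
      C * (2 * exp 1 * log 2) ^ l * ww l := by
  have hl : 0.69 < log 2 := lt_trans (by norm_num) Real.log_two_gt_d9
  set ρ := (2 * log 2)⁻¹ with hρ
  have hρ0 : 0 < ρ := by positivity
  have hρ1 : ρ < 1 := inv_lt_one_of_one_lt₀ (by linarith)
  have hsum := summable_lin_geom (D := D + 1) hρ0.le hρ1
  set T := ∑' k : ℕ, ((k : ℝ) + (D + 1)) * ρ ^ k with hT
  have hT0 : 0 ≤ T := tsum_nonneg fun k => by positivity
  refine ⟨exp (D + 1) * (T + 1), by positivity, fun B l s hs hS => ?_⟩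
  have hτ := le_sum_range hs
  have hw := ww_pos l
  have h1 : ∀ k ∈ range (l + 1), (2 * log 2) ^ k * Ew B s l (goodInd 0 k) ≤
      (exp (D + 1) * (2 * exp 1 * log 2) ^ l * ww l) *
        ((((l - k : ℕ) : ℝ) + (D + 1)) * ρ ^ (l - k)) := by
    intro k hk
    have hk : k ≤ l := Nat.lt_succ_iff.mp (mem_range.mp hk)
    have h2 := Ew_goodInd_le (B := B) hs 0 0 l k (by omega)
    simp only [F, mul_one, Nat.cast_zero, add_zero, zero_add] at h2
    have h3 : F (∑ i ∈ range l, s i + 1) k ≤ ((l - k + (D + 1) : ℕ) : ℝ) * exp ((l + D + 1 : ℕ) : ℝ) * ww l := by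
      have hkl : (k : ℝ) ≤ l := by exact_mod_cast hk
      refine F_le_ww ?_ ?_ (by omega) (by omega)
      · have := hτ l
        linarith
      · have := hS l
        push_cast; linarith
    have hpow : (2 * log 2) ^ k = (2 * log 2) ^ l * ρ ^ (l - k) := by
      rw [hρ, inv_pow, ← div_eq_mul_inv, eq_div_iff (by positivity), ← pow_add, Nat.add_sub_cancel' hk]
    calc _ ≤ (2 * log 2) ^ k * (((l - k + (D + 1) : ℕ) : ℝ) * exp ((l + D + 1 : ℕ) : ℝ) * ww l) := by
          gcongr
          exact h2.trans h3
      _ = _ := by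
        rw [hpow, show ((l + D + 1 : ℕ) : ℝ) = (D + 1) + l * 1 by push_cast; ring, Real.exp_add,
          Real.exp_nat_mul]
        push_cast
        rw [show 2 * exp 1 * log 2 = 2 * log 2 * exp 1 by ring, mul_pow (2 * log 2)]
        ring
  refine (Finset.sum_le_sum h1).trans ?_
  rw [← Finset.mul_sum]
  have h4 := Finset.sum_range_reflect (fun k : ℕ => ((k : ℝ) + (D + 1)) * ρ ^ k) (l + 1)
  simp only [Nat.add_sub_cancel] at h4
  rw [h4]
  have h5 : ∑ k ∈ range (l + 1), ((k : ℝ) + (D + 1)) * ρ ^ k ≤ T :=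
    hsum.sum_le_tsum _ fun k _ => by positivity
  calc _ ≤ (exp (D + 1) * (2 * exp 1 * log 2) ^ l * ww l) * (T + 1) := by
        gcongr; linarith
    _ = _ := by ring

lemma exists_ww_conv : ∃ C : ℝ, 0 < C ∧ ∀ n : ℕ,
    ∑ j ∈ range (n + 1), ww j * ww (n - j) ≤ C * ww n := by
  have hsum : Summable ww := by
    have h := (Real.summable_nat_rpow (p := (-(3 / 2) : ℝ))).mpr (by norm_num)
    refine ((summable_nat_add_iff 1).mpr h).congr fun k => ?_
    unfold ww; push_cast; rfl
  set T := ∑' k, ww k with hT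
  have hT0 : 0 ≤ T := tsum_nonneg fun k => (ww_pos k).le
  refine ⟨(1 / 2 : ℝ) ^ (-(3 / 2) : ℝ) * (T + T + 1), by positivity, fun n => ?_⟩
  have h1 : ∀ j, n + 1 ≤ 2 * (j + 1) → ww j ≤ (1 / 2 : ℝ) ^ (-(3 / 2) : ℝ) * ww n := by
    intro j hj
    unfold ww
    rw [← Real.mul_rpow (by norm_num) (by positivity)]
    apply Real.rpow_le_rpow_of_nonpos (by positivity) _ (by norm_num)
    have : (n : ℝ) + 1 ≤ 2 * (j + 1) := by exact_mod_cast hj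
    linarith
  have h2 : ∀ j ∈ range (n + 1), ww j * ww (n - j) ≤
      (1 / 2 : ℝ) ^ (-(3 / 2) : ℝ) * ww n * (ww j + ww (n - j)) := by
    intro j hj
    have hj : j ≤ n := Nat.lt_succ_iff.mp (mem_range.mp hj)
    have p1 := ww_pos j
    have p2 := ww_pos (n - j)
    have p3 := ww_pos n
    rcases le_total (n + 1) (2 * (j + 1)) with h | h
    · have := mul_le_mul_of_nonneg_right (h1 j h) p2.le
      have : 0 ≤ (1 / 2 : ℝ) ^ (-(3 / 2) : ℝ) * ww n * ww j := by positivity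
      linarith
    · have := mul_le_mul_of_nonneg_right (h1 (n - j) (by omega)) p1.le
      have : 0 ≤ (1 / 2 : ℝ) ^ (-(3 / 2) : ℝ) * ww n * ww (n - j) := by positivity
      linarith
  refine (Finset.sum_le_sum h2).trans ?_
  rw [← Finset.mul_sum, Finset.sum_add_distrib]
  have h4 := Finset.sum_range_reflect ww (n + 1)
  simp only [Nat.add_sub_cancel] at h4
  rw [h4]
  have h5 : ∑ k ∈ range (n + 1), ww k ≤ T := hsum.sum_le_tsum _ fun k _ => (ww_pos k).le
  have := ww_pos n
  calc _ ≤ (1 / 2 : ℝ) ^ (-(3 / 2) : ℝ) * ww n * (T + T + 1) :=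
        mul_le_mul_of_nonneg_left (by linarith) (by positivity)
    _ = _ := by ring

lemma exists_Ew_core (D : ℕ) : ∃ C : ℝ, 0 < C ∧ ∀ (B n : ℕ) (s : ℕ → ℝ) (Φ : List ℕ → ℝ),
    (∀ i, 1 ≤ s i) → (∀ j : ℕ, ∑ i ∈ range j, s i ≤ j + D) →
    (∀ c : List ℕ, c.length = n → ∀ j ≤ n, Φ c ≤ 2 ^ (c.drop j).sum * (1 + Qw (c.take j))) →
    Ew B s n (fun c => (log 2) ^ c.sum * Φ c) ≤ C * (2 * exp 1 * log 2) ^ n * ww n := by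
  obtain ⟨C₂, hC₂, h₂⟩ := exists_Ew_second_le (2 * D)
  obtain ⟨C₃, hC₃, h₃⟩ := exists_ww_conv
  have hl : 0 < log 2 := Real.log_pos (by norm_num)
  set r := exp 1 * log 2 / 2 with hr
  have hr0 : 0 < r := by positivity
  have hr1 : r < 1 := by
    have := Real.log_two_lt_d9
    have := Real.exp_one_lt_d9
    rw [hr]
    nlinarith
  have hsum := summable_lin_geom (D := 1) hr0.le hr1
  set T := ∑' k : ℕ, ((k : ℝ) + 1) * r ^ k with hT
  have hT0 : 0 ≤ T := tsum_nonneg fun k => by positivity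
  set C₁ : ℝ := (D + 2) * (4 * D + 5) * exp (D + 1) * (2 * exp 1) with hC₁
  have hC₁0 : 0 < C₁ := by positivity
  refine ⟨C₁ * C₂ * C₃ * (T + 1), by positivity, fun B n s Φ hs hS hΦ => ?_⟩
  have hs0 : ∀ i, 0 ≤ s i := fun i => by linarith [hs i]
  set A := 2 * exp 1 * log 2 with hA
  have hA0 : 0 < A := by positivity
  have h1 : Ew B s n (fun c => (log 2) ^ c.sum * Φ c) ≤
      Ew B s n (fun c => ∑ j ∈ range (n + 1), ∑ M ∈ range (n * B + 1), ∑ k ∈ range (n - j + 1),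
        ((log 2) ^ (j + M) * (2 * log 2) ^ k) *
          ((goodInd M (j + M) (c.take j) * (1 + Qw (c.take j))) * goodInd 0 k (c.drop j))) := by
    refine Ew_mono_lt hs0 fun c hc hB => ?_
    obtain ⟨j, hj, M, hM, k, hk, e1, g1, e2, g2⟩ := exists_cut hc hB
    have hnn : ∀ j M k, 0 ≤ ((log 2) ^ (j + M) * (2 * log 2) ^ k) *
          ((goodInd M (j + M) (c.take j) * (1 + Qw (c.take j))) * goodInd 0 k (c.drop j)) := by
      intro j M k
      have := goodInd_nonneg M (j + M) (c.take j)
      have := goodInd_nonneg 0 k (c.drop j)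
      have := Qw_nonneg (c.take j)
      positivity
    have hcs : (c.take j).sum + (c.drop j).sum = c.sum := by
      rw [← List.sum_append, List.take_append_drop]
    calc (log 2) ^ c.sum * Φ c ≤ (log 2) ^ c.sum * (2 ^ (c.drop j).sum * (1 + Qw (c.take j))) := by
          gcongr
          exact hΦ c hc j hj
      _ = ((log 2) ^ (j + M) * (2 * log 2) ^ k) *
          ((goodInd M (j + M) (c.take j) * (1 + Qw (c.take j))) * goodInd 0 k (c.drop j)) := by
          unfold goodInd
          rw [if_pos ⟨g1, e1⟩, if_pos ⟨g2, e2⟩, ← hcs, e1, e2, mul_pow, pow_add _ (j + M)]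
          ring
      _ ≤ ∑ k ∈ range (n - j + 1), ((log 2) ^ (j + M) * (2 * log 2) ^ k) *
          ((goodInd M (j + M) (c.take j) * (1 + Qw (c.take j))) * goodInd 0 k (c.drop j)) :=
          Finset.single_le_sum (f := fun k => ((log 2) ^ (j + M) * (2 * log 2) ^ k) *
          ((goodInd M (j + M) (c.take j) * (1 + Qw (c.take j))) * goodInd 0 k (c.drop j)))
            (fun k _ => hnn j M k) (by simp; omega)
      _ ≤ ∑ M ∈ range (n * B + 1), ∑ k ∈ range (n - j + 1), ((log 2) ^ (j + M) * (2 * log 2) ^ k) *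
          ((goodInd M (j + M) (c.take j) * (1 + Qw (c.take j))) * goodInd 0 k (c.drop j)) :=
          Finset.single_le_sum (f := fun M => ∑ k ∈ range (n - j + 1), ((log 2) ^ (j + M) * (2 * log 2) ^ k) *
          ((goodInd M (j + M) (c.take j) * (1 + Qw (c.take j))) * goodInd 0 k (c.drop j)))
            (fun M _ => Finset.sum_nonneg fun k _ => hnn j M k) (by simp; omega)
      _ ≤ _ :=
          Finset.single_le_sum (f := fun j => ∑ M ∈ range (n * B + 1), ∑ k ∈ range (n - j + 1),
          ((log 2) ^ (j + M) * (2 * log 2) ^ k) *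
          ((goodInd M (j + M) (c.take j) * (1 + Qw (c.take j))) * goodInd 0 k (c.drop j)))
            (fun j _ => Finset.sum_nonneg fun M _ => Finset.sum_nonneg fun k _ => hnn j M k)
            (by simp; omega)
  refine h1.trans ?_
  rw [Ew_sum]
  have h4 : ∀ j ∈ range (n + 1), Ew B s n (fun c => ∑ M ∈ range (n * B + 1),
        ∑ k ∈ range (n - j + 1), ((log 2) ^ (j + M) * (2 * log 2) ^ k) *
          ((goodInd M (j + M) (c.take j) * (1 + Qw (c.take j))) * goodInd 0 k (c.drop j))) ≤
      C₁ * C₂ * (T + 1) * A ^ n * (ww j * ww (n - j)) := by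
    intro j hj
    have hj : j ≤ n := Nat.lt_succ_iff.mp (mem_range.mp hj)
    have hwj := ww_pos j
    have hwnj := ww_pos (n - j)
    have hV0 : 0 ≤ ∑ k ∈ range (n - j + 1), (2 * log 2) ^ k *
        Ew B (fun i => s (j + i)) (n - j) (goodInd 0 k) := Finset.sum_nonneg fun k _ =>
        mul_nonneg (by positivity) (Ew_nonneg (fun i => hs0 _) fun c _ => goodInd_nonneg _ _ _)
    have hV := h₂ B (n - j) (fun i => s (j + i)) (fun i => hs _) (fun l => by
      have h5 := hS (j + l)
      rw [Finset.sum_range_add] at h5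
      have := le_sum_range hs j
      push_cast at h5 ⊢
      have : (0 : ℝ) ≤ D := by positivity
      linarith)
    calc _ = ∑ M ∈ range (n * B + 1), ((log 2) ^ (j + M) *
          Ew B s j (fun c => goodInd M (j + M) c * (1 + Qw c))) *
          ∑ k ∈ range (n - j + 1), (2 * log 2) ^ k *
            Ew B (fun i => s (j + i)) (n - j) (goodInd 0 k) := by
          rw [Ew_sum]
          refine Finset.sum_congr rfl fun M _ => ?_
          rw [Ew_sum, Finset.mul_sum]
          refine Finset.sum_congr rfl fun k _ => ?_
          rw [Ew_mul, Ew_split hj (fun c => goodInd M (j + M) c * (1 + Qw c)) (goodInd 0 k)]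
          ring
      _ ≤ ∑ M ∈ range (n * B + 1), (C₁ * A ^ j * ww j * ((M + 1) * r ^ M)) *
          (C₂ * A ^ (n - j) * ww (n - j)) := by
          refine Finset.sum_le_sum fun M _ => ?_
          exact mul_le_mul (Ew_first_le hs hS j M) hV hV0 (by positivity)
      _ = (C₁ * A ^ j * ww j * (C₂ * A ^ (n - j) * ww (n - j))) *
          ∑ M ∈ range (n * B + 1), ((M : ℝ) + 1) * r ^ M := by
          rw [Finset.mul_sum]
          exact Finset.sum_congr rfl fun M _ => by ring
      _ ≤ (C₁ * A ^ j * ww j * (C₂ * A ^ (n - j) * ww (n - j))) * (T + 1) := by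
          have : ∑ M ∈ range (n * B + 1), ((M : ℝ) + 1) * r ^ M ≤ T :=
            hsum.sum_le_tsum _ fun k _ => by positivity
          gcongr; linarith
      _ = _ := by
          have : A ^ n = A ^ j * A ^ (n - j) := by rw [← pow_add, Nat.add_sub_cancel' hj]
          rw [this]; ring
  refine (Finset.sum_le_sum h4).trans ?_
  rw [← Finset.mul_sum]
  calc _ ≤ C₁ * C₂ * (T + 1) * A ^ n * (C₃ * ww n) := by
        gcongr; exact h₃ n
    _ = _ := by ring

/-- The summand `log p / p` of Mertens' first theorem. -/
noncomputable def lpc (k : ℕ) : ℝ := if k.Prime then log k / k else 0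

/-- Partial sums of `log p / p`. -/
noncomputable def Rm (t : ℝ) : ℝ := ∑ k ∈ Icc 0 ⌊t⌋₊, lpc k

lemma lpc_nonneg (k : ℕ) : 0 ≤ lpc k := by
  unfold lpc
  split_ifs with h
  · have : (1 : ℝ) ≤ k := by exact_mod_cast h.one_lt.le
    have := Real.log_nonneg this
    positivity
  · exact le_rfl

lemma Rm_mono {a b : ℝ} (h : a ≤ b) : Rm a ≤ Rm b := by
  refine Finset.sum_le_sum_of_subset_of_nonneg ?_ fun k _ _ => lpc_nonneg k
  exact Finset.Icc_subset_Icc_right (Nat.floor_le_floor h)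

lemma log_factorial_eq (N : ℕ) : log (N.factorial : ℝ) =
    ∑ p ∈ (Icc 0 N).filter Nat.Prime, (N.factorial.factorization p : ℝ) * log p := by
  rw [Real.log_nat_eq_sum_factorization, Finsupp.sum]
  refine Finset.sum_subset ?_ ?_
  · intro p hp
    rw [Nat.support_factorization] at hp
    have hp' := Nat.prime_of_mem_primeFactors hp
    have := (hp'.dvd_factorial).mp (Nat.dvd_of_mem_primeFactors hp)
    simp [hp', this]
  · intro p _ hp
    rw [Finsupp.notMem_support_iff] at hp
    simp [hp]

lemma Rm_eq (N : ℕ) : Rm N = ∑ p ∈ (Icc 0 N).filter Nat.Prime, log (p : ℝ) / p := by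
  unfold Rm lpc
  rw [Nat.floor_natCast, Finset.sum_filter]

lemma Rm_nat_le {N : ℕ} (hN : 1 ≤ N) : Rm N ≤ log N + log 4 := by
  have hN0 : (0 : ℝ) < N := by exact_mod_cast hN
  have h1 : log (N.factorial : ℝ) ≤ N * log N := by
    rw [← Real.log_pow]
    refine Real.log_le_log (by positivity) ?_
    exact_mod_cast Nat.factorial_le_pow N
  have h2 := Chebyshev.theta_le_log4_mul_x hN0.le
  have h3 : N * Rm N ≤ log (N.factorial : ℝ) + Chebyshev.theta N := by
    have : Chebyshev.theta N = ∑ p ∈ (Icc 0 N).filter Nat.Prime, log (p : ℝ) := by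
      rw [Chebyshev.theta_eq_sum_Icc, Nat.floor_natCast]
    rw [this, log_factorial_eq, Rm_eq, ← Finset.sum_add_distrib, Finset.mul_sum]
    refine Finset.sum_le_sum fun p hp => ?_
    have hp : p.Prime := (mem_filter.mp hp).2
    have hp0 : (0 : ℝ) < p := by exact_mod_cast hp.pos
    have hlp : 0 ≤ log (p : ℝ) := Real.log_natCast_nonneg p
    have h4 : N / p ≤ N.factorial.factorization p := by
      rw [Nat.factorization_factorial hp (Nat.lt_succ_self _)]
      rcases Nat.lt_or_ge N p with h | h
      · rw [Nat.div_eq_of_lt h]; exact Nat.zero_le _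
      · have : 1 ∈ Finset.Ico 1 (Nat.log p N).succ := by
          have := Nat.log_pos hp.one_lt h
          exact Finset.mem_Ico.mpr ⟨le_rfl, Nat.succ_lt_succ this⟩
        have h5 := Finset.single_le_sum (f := fun i => N / p ^ i) (fun i _ => Nat.zero_le _) this
        simpa using h5
    have h5 : (N : ℝ) / p ≤ N.factorial.factorization p + 1 := by
      have h6 : (N : ℝ) / p < ((N / p : ℕ) : ℝ) + 1 := by
        rw [div_lt_iff₀ hp0]
        exact_mod_cast Nat.lt_div_mul_add hp.pos |>.trans_eq (by ring)
      have h7 : ((N / p : ℕ) : ℝ) ≤ N.factorial.factorization p := by exact_mod_cast h4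
      linarith
    calc (N : ℝ) * (log p / p) = N / p * log p := by ring
      _ ≤ (N.factorial.factorization p + 1) * log p := by gcongr
      _ = _ := by ring
  have h4 : N * Rm N ≤ N * (log N + log 4) := by linarith
  exact le_of_mul_le_mul_left h4 hN0

lemma exists_Rm_nat_ge : ∃ C : ℝ, ∀ N : ℕ, 1 ≤ N → log N - C ≤ Rm N := by
  have hs : Summable fun n : ℕ => (4 : ℝ) * (n : ℝ) ^ (-(3 / 2) : ℝ) :=
    (Real.summable_nat_rpow.mpr (by norm_num)).mul_left 4
  refine ⟨1 + ∑' n : ℕ, (4 : ℝ) * (n : ℝ) ^ (-(3 / 2) : ℝ), fun N hN => ?_⟩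
  have hN0 : (0 : ℝ) < N := by exact_mod_cast hN
  have h1 : N * log N - N ≤ log (N.factorial : ℝ) := by
    have h2 := Real.pow_div_factorial_le_exp (N : ℝ) hN0.le N
    rw [div_le_iff₀ (by positivity)] at h2
    have h3 := Real.log_le_log (by positivity) h2
    rw [Real.log_pow, Real.log_mul (by positivity) (by positivity), Real.log_exp] at h3
    linarith
  have h2 : log (N.factorial : ℝ) ≤ N * (Rm N + ∑ p ∈ (Icc 0 N).filter Nat.Prime,
      (4 : ℝ) * (p : ℝ) ^ (-(3 / 2) : ℝ)) := by
    rw [log_factorial_eq, Rm_eq, ← Finset.sum_add_distrib, Finset.mul_sum]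
    refine Finset.sum_le_sum fun p hp => ?_
    have hp : p.Prime := (mem_filter.mp hp).2
    have hp0 : (0 : ℝ) < p := by exact_mod_cast hp.pos
    have hp2 : (2 : ℝ) ≤ p := by exact_mod_cast hp.two_le
    have hlp : 0 ≤ log (p : ℝ) := Real.log_natCast_nonneg p
    have h4 : (p - 1) * N.factorial.factorization p ≤ N := by
      rw [Nat.sub_one_mul_factorization_factorial hp]; exact Nat.sub_le _ _
    have h5 : ((p : ℝ) - 1) * N.factorial.factorization p ≤ N := by
      have : ((p - 1 : ℕ) : ℝ) = (p : ℝ) - 1 := by push_cast [hp.one_lt.le]; rfl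
      rw [← this]; exact_mod_cast h4
    have h6 : (N.factorial.factorization p : ℝ) ≤ N * (1 / p + 2 / p ^ 2) := by
      rw [mul_comm, ← le_div_iff₀ (by linarith)] at h5
      refine h5.trans ?_
      rw [div_eq_mul_one_div]
      gcongr
      rw [div_add_div _ _ (by positivity) (by positivity), div_le_div_iff₀ (by linarith) (by positivity)]
      nlinarith [mul_nonneg hp0.le (sub_nonneg.mpr hp2)]
    have h7 : log (p : ℝ) ≤ 2 * (p : ℝ) ^ (1 / 2 : ℝ) := by
      have := Real.log_le_rpow_div hp0.le (show (0 : ℝ) < 1 / 2 by norm_num)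
      linarith
    have h8 : (p : ℝ) ^ (-(3 / 2) : ℝ) = (p : ℝ) ^ (1 / 2 : ℝ) / p ^ 2 := by
      rw [show (-(3 / 2) : ℝ) = 1 / 2 - (2 : ℕ) by norm_num, Real.rpow_sub hp0, Real.rpow_natCast]
    calc (N.factorial.factorization p : ℝ) * log p ≤ N * (1 / p + 2 / p ^ 2) * log p := by gcongr
      _ = N * (log p / p + 2 / p ^ 2 * log p) := by ring
      _ ≤ N * (log p / p + 2 / p ^ 2 * (2 * (p : ℝ) ^ (1 / 2 : ℝ))) := by gcongr
      _ = _ := by rw [h8]; ring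
  have h3 : ∑ p ∈ (Icc 0 N).filter Nat.Prime, (4 : ℝ) * (p : ℝ) ^ (-(3 / 2) : ℝ) ≤
      ∑' n : ℕ, (4 : ℝ) * (n : ℝ) ^ (-(3 / 2) : ℝ) :=
    hs.sum_le_tsum _ fun n _ => by positivity
  have h4 : N * (log N - 1) ≤ N * (Rm N + ∑ p ∈ (Icc 0 N).filter Nat.Prime,
      (4 : ℝ) * (p : ℝ) ^ (-(3 / 2) : ℝ)) := by linarith
  have := le_of_mul_le_mul_left h4 hN0
  linarith

lemma exists_mertens_first : ∃ C : ℝ, 0 < C ∧ ∀ x : ℝ, 1 ≤ x → |Rm x - log x| ≤ C := by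
  obtain ⟨C, hC⟩ := exists_Rm_nat_ge
  refine ⟨|C| + log 4 + log 2, ?_, fun x hx => ?_⟩
  · have := Real.log_pos (show (1 : ℝ) < 4 by norm_num)
    have := Real.log_pos (show (1 : ℝ) < 2 by norm_num)
    positivity
  have hf : 1 ≤ ⌊x⌋₊ := Nat.one_le_floor_iff _ |>.mpr hx
  have hf0 : (1 : ℝ) ≤ ⌊x⌋₊ := by exact_mod_cast hf
  have hR : Rm x = Rm (⌊x⌋₊ : ℝ) := by unfold Rm; rw [Nat.floor_natCast]
  have h1 := Rm_nat_le hf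
  have h2 := hC _ hf
  have h3 : log (⌊x⌋₊ : ℝ) ≤ log x := Real.log_le_log (by positivity) (Nat.floor_le (by linarith))
  have h4 : log x ≤ log 2 + log (⌊x⌋₊ : ℝ) := by
    rw [← Real.log_mul (by norm_num) (by positivity)]
    refine Real.log_le_log (by linarith) ?_
    have := Nat.lt_floor_add_one x
    linarith
  have := le_abs_self C
  have := Real.log_nonneg (show (1 : ℝ) ≤ 4 by norm_num)
  have := Real.log_nonneg (show (1 : ℝ) ≤ 2 by norm_num)
  rw [hR, abs_le]
  constructor <;> linarith [abs_nonneg C]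

end FordDivisor

namespace FordDivisor

open Finset Real MeasureTheory

lemma hasDerivAt_inv_log {t : ℝ} (ht : 1 < t) :
    HasDerivAt (fun t : ℝ => (log t)⁻¹) (-(1 / (t * log t ^ 2))) t := by
  have hl := Real.log_pos ht
  have h := (Real.hasDerivAt_log (by linarith : t ≠ 0)).inv hl.ne'
  refine h.congr_deriv ?_
  field_simp

lemma hasDerivAt_log_log {t : ℝ} (C : ℝ) (ht : 1 < t) :
    HasDerivAt (fun t : ℝ => log (log t) - C * (log t)⁻¹)
      (1 / (t * log t ^ 2) * (log t + C)) t := by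
  have hl := Real.log_pos ht
  have h := ((Real.hasDerivAt_log (by linarith : t ≠ 0)).log hl.ne').sub
    ((hasDerivAt_inv_log ht).const_mul C)
  refine h.congr_deriv ?_
  have : t ≠ 0 := by linarith
  field_simp
  ring

lemma continuousOn_weight {x y : ℝ} (hx : 2 ≤ x) :
    ContinuousOn (fun t : ℝ => 1 / (t * log t ^ 2)) (Set.Icc x y) := by
  have h0 : ∀ t ∈ Set.Icc x y, t ≠ 0 := fun t ht => by
    have := ht.1; intro h; linarith
  refine ContinuousOn.div continuousOn_const (continuousOn_id.mul
    ((ContinuousOn.log continuousOn_id h0).pow 2)) fun t ht => ?_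
  have h1 : 0 < log t := Real.log_pos (by linarith [ht.1])
  have h2 : 0 < t := by linarith [ht.1]
  positivity

lemma integral_weight {x y : ℝ} (C : ℝ) (hx : 2 ≤ x) (hxy : x ≤ y) :
    ∫ t in x..y, 1 / (t * log t ^ 2) * (log t + C) =
      (log (log y) - C * (log y)⁻¹) - (log (log x) - C * (log x)⁻¹) := by
  refine intervalIntegral.integral_eq_sub_of_hasDerivAt (f := fun t : ℝ => log (log t) - C * (log t)⁻¹)
    (fun t ht => hasDerivAt_log_log C ?_) ?_
  · rw [Set.uIcc_of_le hxy] at ht; linarith [ht.1]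
  · apply ContinuousOn.intervalIntegrable
    rw [Set.uIcc_of_le hxy]
    refine (continuousOn_weight hx).mul ((ContinuousOn.log continuousOn_id fun t ht => ?_).add
      continuousOn_const)
    have := ht.1
    intro h; simp only [id] at h; linarith

lemma exists_mertens_second : ∃ C : ℝ, 0 < C ∧ ∀ x y : ℝ, 2 ≤ x → x ≤ y →
    |∑ p ∈ (Ioc ⌊x⌋₊ ⌊y⌋₊).filter Nat.Prime, (1 : ℝ) / p - log (log y / log x)| ≤ C / log x := by
  obtain ⟨C, hC, h1⟩ := exists_mertens_first
  refine ⟨2 * C, by positivity, fun x y hx hxy => ?_⟩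
  have hlx : 0 < log x := Real.log_pos (by linarith)
  have hlxy : log x ≤ log y := Real.log_le_log (by linarith) hxy
  have hly : 0 < log y := by linarith
  have hd : Set.EqOn (deriv fun t : ℝ => (log t)⁻¹) (fun t => -(1 / (t * log t ^ 2))) (Set.Icc x y) :=
    fun t ht => (hasDerivAt_inv_log (by linarith [ht.1])).deriv
  have h_int : IntegrableOn (deriv fun t : ℝ => (log t)⁻¹) (Set.Icc x y) := by
    refine IntegrableOn.congr_fun ?_ hd.symm measurableSet_Icc
    exact ((continuousOn_weight hx).neg).integrableOn_compact isCompact_Icc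
  have hA := sum_mul_eq_sub_sub_integral_mul lpc (f := fun t : ℝ => (log t)⁻¹) (by linarith : 0 ≤ x) hxy
    (fun t ht => (hasDerivAt_inv_log (by linarith [ht.1])).differentiableAt) h_int
  have hP : ∑ p ∈ (Ioc ⌊x⌋₊ ⌊y⌋₊).filter Nat.Prime, (1 : ℝ) / p =
      ∑ k ∈ Ioc ⌊x⌋₊ ⌊y⌋₊, (log (k : ℝ))⁻¹ * lpc k := by
    rw [Finset.sum_filter]
    refine Finset.sum_congr rfl fun k _ => ?_
    unfold lpc
    split_ifs with hk
    · have : 0 < log (k : ℝ) := Real.log_pos (by exact_mod_cast hk.one_lt)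
      field_simp
    · simp
  have hI : ∫ t in Set.Ioc x y, deriv (fun t : ℝ => (log t)⁻¹) t * ∑ k ∈ Icc 0 ⌊t⌋₊, lpc k =
      -∫ t in x..y, 1 / (t * log t ^ 2) * Rm t := by
    rw [intervalIntegral.integral_of_le hxy, ← integral_neg]
    refine setIntegral_congr_fun measurableSet_Ioc fun t ht => ?_
    simp only [Rm]
    rw [hd ⟨ht.1.le, ht.2⟩]
    ring
  have hw : ContinuousOn (fun t : ℝ => 1 / (t * log t ^ 2)) (Set.uIcc x y) := by
    rw [Set.uIcc_of_le hxy]; exact continuousOn_weight hx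
  have hRi : IntervalIntegrable (fun t => 1 / (t * log t ^ 2) * Rm t) volume x y :=
    (Monotone.intervalIntegrable fun a b h => Rm_mono h).continuousOn_mul hw
  have hLi : ∀ D : ℝ, IntervalIntegrable (fun t => 1 / (t * log t ^ 2) * (log t + D)) volume x y := by
    intro D
    apply ContinuousOn.intervalIntegrable
    refine hw.mul ((ContinuousOn.log continuousOn_id fun t ht => ?_).add continuousOn_const)
    rw [Set.uIcc_of_le hxy] at ht
    have := ht.1
    intro h; simp only [id] at h; linarith
  have hb : ∀ t ∈ Set.Icc x y, log t + -C ≤ Rm t ∧ Rm t ≤ log t + C := fun t ht => by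
    have := abs_le.mp (h1 t (by linarith [ht.1]))
    constructor <;> linarith [this.1, this.2]
  have hwpos : ∀ t ∈ Set.Icc x y, 0 ≤ 1 / (t * log t ^ 2) := fun t ht => by
    have : 0 < t := by linarith [ht.1]
    positivity
  have hU := intervalIntegral.integral_mono_on hxy hRi (hLi C) fun t ht =>
    mul_le_mul_of_nonneg_left (hb t ht).2 (hwpos t ht)
  have hL := intervalIntegral.integral_mono_on hxy (hLi (-C)) hRi fun t ht =>
    mul_le_mul_of_nonneg_left (hb t ht).1 (hwpos t ht)
  rw [integral_weight _ hx hxy] at hU hL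
  rw [hP, hA, hI, Real.log_div hly.ne' hlx.ne']
  have ex := hb x ⟨le_rfl, hxy⟩
  have ey := hb y ⟨hxy, le_rfl⟩
  change |(log y)⁻¹ * Rm y - (log x)⁻¹ * Rm x - -_ - _| ≤ _
  have ix : 0 < (log x)⁻¹ := by positivity
  have iy : 0 < (log y)⁻¹ := by positivity
  have a1 := mul_le_mul_of_nonneg_left ex.1 ix.le
  have a2 := mul_le_mul_of_nonneg_left ex.2 ix.le
  have a3 := mul_le_mul_of_nonneg_left ey.1 iy.le
  have a4 := mul_le_mul_of_nonneg_left ey.2 iy.le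
  rw [mul_add, inv_mul_cancel₀ hlx.ne'] at a1 a2
  rw [mul_add, inv_mul_cancel₀ hly.ne'] at a3 a4
  rw [abs_le, div_eq_mul_inv]
  constructor <;> linarith

/-- The primes in `(x, y]`. -/
noncomputable def pI (x y : ℝ) : Finset ℕ := (Ioc ⌊x⌋₊ ⌊y⌋₊).filter Nat.Prime

lemma mem_pI {x y : ℝ} (hx : 0 ≤ x) {p : ℕ} :
    p ∈ pI x y ↔ p.Prime ∧ x < p ∧ (p : ℝ) ≤ y := by
  unfold pI
  rw [mem_filter, mem_Ioc, Nat.floor_lt hx]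
  constructor
  · rintro ⟨⟨h1, h2⟩, h3⟩
    exact ⟨h3, h1, (Nat.le_floor_iff' h3.ne_zero).mp h2⟩
  · rintro ⟨h3, h1, h2⟩
    exact ⟨⟨h1, (Nat.le_floor_iff' h3.ne_zero).mpr h2⟩, h3⟩

/-- Positive integers all of whose prime factors lie in `(x, y]`. -/
def PB (x y : ℝ) (a : ℕ) : Prop := a ≠ 0 ∧ ∀ p : ℕ, p.Prime → p ∣ a → x < p ∧ (p : ℝ) ≤ y

lemma exists_prime_mass_le : ∃ C : ℝ, 0 < C ∧ ∀ x y κ : ℝ, 2 ≤ x → x ≤ y → 0 ≤ κ →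
    κ * log y ≤ 1 → ∑ p ∈ pI x y, (p : ℝ) ^ (κ - 1) ≤
      log (log y / log x) + C / log x + C * (κ * log y) := by
  obtain ⟨C₁, hC₁, h₁⟩ := exists_mertens_first
  obtain ⟨C₂, hC₂, h₂⟩ := exists_mertens_second
  have hl2 : 0 < log 2 := Real.log_pos (by norm_num)
  refine ⟨C₂ + exp 1 * (1 + C₁ / log 2), by positivity, fun x y κ hx hxy hκ hκy => ?_⟩
  have hlx : 0 < log x := Real.log_pos (by linarith)
  have hly2 : log 2 ≤ log y := Real.log_le_log (by norm_num) (by linarith)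
  have h1 : ∀ p ∈ pI x y, (p : ℝ) ^ (κ - 1) ≤ 1 / p + exp 1 * κ * lpc p := by
    intro p hp
    rw [mem_pI (by linarith)] at hp
    obtain ⟨hp, hxp, hpy⟩ := hp
    have hp0 : (0 : ℝ) < p := by exact_mod_cast hp.pos
    have hlp : 0 ≤ log (p : ℝ) := Real.log_natCast_nonneg p
    have hlpy : log (p : ℝ) ≤ log y := Real.log_le_log hp0 hpy
    have hu : κ * log p ≤ 1 := (mul_le_mul_of_nonneg_left hlpy hκ).trans hκy
    have hu0 : 0 ≤ κ * log p := by positivity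
    have he : exp (κ * log p) ≤ 1 + exp 1 * (κ * log p) := by
      have a1 := Real.add_one_le_exp (-(κ * log p))
      have a2 : exp (κ * log p) ≤ exp 1 := Real.exp_le_exp.mpr hu
      have a3 : exp (κ * log p) * exp (-(κ * log p)) = 1 := by
        rw [← Real.exp_add]; simp
      nlinarith [Real.exp_pos (κ * log p)]
    rw [Real.rpow_sub hp0, Real.rpow_one, Real.rpow_def_of_pos hp0, mul_comm (log (p : ℝ)) κ]
    unfold lpc
    rw [if_pos hp]
    calc exp (κ * log p) / p ≤ (1 + exp 1 * (κ * log p)) / p := by gcongr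
      _ = _ := by ring
  refine (Finset.sum_le_sum h1).trans ?_
  rw [Finset.sum_add_distrib, ← Finset.mul_sum]
  have h3 : ∑ p ∈ pI x y, (1 : ℝ) / p ≤ log (log y / log x) + C₂ / log x := by
    have := (abs_le.mp (h₂ x y hx hxy)).2
    unfold pI
    linarith
  have h4 : ∑ p ∈ pI x y, lpc p ≤ log y * (1 + C₁ / log 2) := by
    have a1 : ∑ p ∈ pI x y, lpc p ≤ Rm y := by
      refine Finset.sum_le_sum_of_subset_of_nonneg ?_ fun k _ _ => lpc_nonneg k
      intro p hp
      unfold pI at hp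
      rw [mem_filter, mem_Ioc] at hp
      exact mem_Icc.mpr ⟨Nat.zero_le _, hp.1.2⟩
    have a2 := (abs_le.mp (h₁ y (by linarith))).2
    have a3 : C₁ ≤ log y * (C₁ / log 2) := by
      rw [← mul_div_assoc, le_div_iff₀ hl2]
      nlinarith
    linarith
  have h5 : exp 1 * κ * ∑ p ∈ pI x y, lpc p ≤ exp 1 * κ * (log y * (1 + C₁ / log 2)) := by
    gcongr
  have e1 : (C₂ + exp 1 * (1 + C₁ / log 2)) / log x = C₂ / log x + exp 1 * (1 + C₁ / log 2) / log x :=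
    add_div _ _ _
  have e2 : 0 ≤ exp 1 * (1 + C₁ / log 2) / log x := by positivity
  have e3 : 0 ≤ C₂ * (κ * log y) := by
    have : 0 ≤ log y := by linarith
    positivity
  have e4 : (C₂ + exp 1 * (1 + C₁ / log 2)) * (κ * log y) =
    C₂ * (κ * log y) + exp 1 * κ * (log y * (1 + C₁ / log 2)) := by ring
  linarith

lemma sum_factored_le {κ : ℝ} (hκ : κ < 1) (P A : Finset ℕ)
    (hA : ∀ a ∈ A, a ≠ 0 ∧ ∀ p : ℕ, p.Prime → p ∣ a → p ∈ P) :
    ∑ a ∈ A, (a : ℝ) ^ (κ - 1) ≤ ∏ p ∈ P.filter Nat.Prime, (1 - (p : ℝ) ^ (κ - 1))⁻¹ := by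
  let f : ℕ →* ℝ :=
    { toFun := fun n => (n : ℝ) ^ (κ - 1)
      map_one' := by simp
      map_mul' := fun m n => by
        push_cast
        exact Real.mul_rpow (by positivity) (by positivity) }
  have hf : ∀ {p : ℕ}, p.Prime → ‖f p‖ < 1 := by
    intro p hp
    change ‖(p : ℝ) ^ (κ - 1)‖ < 1
    rw [Real.norm_of_nonneg (by positivity)]
    exact Real.rpow_lt_one_of_one_lt_of_neg (by exact_mod_cast hp.one_lt) (by linarith)
  have hs := (EulerProduct.summable_and_hasSum_factoredNumbers_prod_filter_prime_geometric hf P).2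
  have hA' : ∀ a ∈ A, a ∈ Nat.factoredNumbers P := fun a ha => by
    rw [Nat.mem_factoredNumbers']
    exact (hA a ha).2
  have h1 := sum_le_hasSum (A.subtype (· ∈ Nat.factoredNumbers P))
    (fun a _ => by change (0 : ℝ) ≤ ((a : ℕ) : ℝ) ^ (κ - 1); positivity) hs
  rw [Finset.sum_subtype_of_mem (fun a : ℕ => f a) hA'] at h1
  exact h1

lemma inv_one_sub_le_exp {u : ℝ} (h1 : u < 1) :
    (1 - u)⁻¹ ≤ exp (u + u ^ 2 / (1 - u)) := by
  have h2 : 0 < 1 - u := by linarith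
  have h3 := Real.add_one_le_exp (u + u ^ 2 / (1 - u))
  refine le_trans (le_of_eq ?_) h3
  field_simp
  ring

lemma exists_euler_le : ∃ C : ℝ, 0 < C ∧ ∀ (x y κ : ℝ) (A : Finset ℕ), 2 ≤ x → x ≤ y → 0 ≤ κ →
    κ ≤ 1 / 4 → κ * log y ≤ 1 → (∀ a ∈ A, PB x y a) →
    ∑ a ∈ A, (a : ℝ) ^ (κ - 1) ≤ C * (log y / log x) := by
  obtain ⟨C, hC, h⟩ := exists_prime_mass_le
  have hl2 : 0 < log 2 := Real.log_pos (by norm_num)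
  have hs : Summable fun n : ℕ => (4 : ℝ) * (n : ℝ) ^ (-(3 / 2) : ℝ) :=
    (Real.summable_nat_rpow.mpr (by norm_num)).mul_left 4
  set T := ∑' n : ℕ, (4 : ℝ) * (n : ℝ) ^ (-(3 / 2) : ℝ) with hT
  refine ⟨exp (C / log 2 + C + T), Real.exp_pos _, fun x y κ A hx hxy hκ hκ4 hκy hA => ?_⟩
  have hlx2 : log 2 ≤ log x := Real.log_le_log (by norm_num) hx
  have hlx : 0 < log x := by linarith
  have hly : 0 < log y := Real.log_pos (by linarith)
  refine (sum_factored_le (by linarith) (pI x y) A fun a ha => ⟨(hA a ha).1, fun p hp hpa => ?_⟩).trans ?_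
  · have := (hA a ha).2 p hp hpa
    exact (mem_pI (by linarith)).mpr ⟨hp, this⟩
  have hfil : (pI x y).filter Nat.Prime = pI x y := by
    unfold pI; rw [Finset.filter_filter]; simp
  rw [hfil]
  have h1 : ∀ p ∈ pI x y, (1 - (p : ℝ) ^ (κ - 1))⁻¹ ≤
      exp ((p : ℝ) ^ (κ - 1) + 4 * (p : ℝ) ^ (-(3 / 2) : ℝ)) ∧ 0 ≤ (1 - (p : ℝ) ^ (κ - 1))⁻¹ := by
    intro p hp
    rw [mem_pI (by linarith)] at hp
    obtain ⟨hp, hxp, hpy⟩ := hp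
    have hp0 : (0 : ℝ) < p := by exact_mod_cast hp.pos
    have hp2 : (2 : ℝ) ≤ p := by exact_mod_cast hp.two_le
    have hu1 : (p : ℝ) ^ (κ - 1) ≤ 3 / 4 := by
      calc (p : ℝ) ^ (κ - 1) ≤ (p : ℝ) ^ (-(1 / 2) : ℝ) :=
            Real.rpow_le_rpow_of_exponent_le (by linarith) (by linarith)
        _ ≤ (2 : ℝ) ^ (-(1 / 2) : ℝ) := Real.rpow_le_rpow_of_nonpos (by norm_num) hp2 (by norm_num)
        _ ≤ 3 / 4 := by
          rw [Real.rpow_neg (by norm_num), ← Real.sqrt_eq_rpow]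
          have : (4 / 3 : ℝ) ≤ √2 := Real.le_sqrt_of_sq_le (by norm_num)
          rw [inv_le_comm₀ (by positivity) (by norm_num)]
          linarith
    have hu0 : 0 ≤ (p : ℝ) ^ (κ - 1) := by positivity
    have hu2 : ((p : ℝ) ^ (κ - 1)) ^ 2 ≤ (p : ℝ) ^ (-(3 / 2) : ℝ) := by
      rw [← Real.rpow_natCast, ← Real.rpow_mul hp0.le]
      exact Real.rpow_le_rpow_of_exponent_le (by linarith) (by push_cast; linarith)
    refine ⟨(inv_one_sub_le_exp (by linarith)).trans (Real.exp_le_exp.mpr ?_),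
      inv_nonneg.mpr (by linarith)⟩
    have : ((p : ℝ) ^ (κ - 1)) ^ 2 / (1 - (p : ℝ) ^ (κ - 1)) ≤ 4 * (p : ℝ) ^ (-(3 / 2) : ℝ) := by
      rw [div_le_iff₀ (by linarith)]
      have : 0 ≤ (p : ℝ) ^ (-(3 / 2) : ℝ) := by positivity
      nlinarith
    linarith
  refine (Finset.prod_le_prod (fun p hp => (h1 p hp).2) fun p hp => (h1 p hp).1).trans ?_
  rw [← Real.exp_sum, Finset.sum_add_distrib]
  have h2 := h x y κ hx hxy hκ hκy
  have h3 : ∑ p ∈ pI x y, (4 : ℝ) * (p : ℝ) ^ (-(3 / 2) : ℝ) ≤ T :=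
    hs.sum_le_tsum _ fun n _ => by positivity
  have h4 : C / log x ≤ C / log 2 := by gcongr
  have h5 : C * (κ * log y) ≤ C * 1 := by gcongr
  calc _ ≤ exp ((C / log 2 + C + T) + log (log y / log x)) := Real.exp_le_exp.mpr (by linarith)
    _ = _ := by rw [Real.exp_add, Real.exp_log (by positivity)]

open Classical in
/-- The integers in `[1, x]` free of prime factors below `y`. -/
noncomputable def Sv (x y : ℝ) : Finset ℕ :=
  (Ioc 0 ⌊x⌋₊).filter fun n => ∀ p : ℕ, p.Prime → p ∣ n → y ≤ p

open Classical in
lemma mem_Sv {x y : ℝ} {n : ℕ} :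
    n ∈ Sv x y ↔ n ≠ 0 ∧ (n : ℝ) ≤ x ∧ ∀ p : ℕ, p.Prime → p ∣ n → y ≤ p := by
  unfold Sv
  rw [mem_filter, mem_Ioc]
  constructor
  · rintro ⟨⟨h1, h2⟩, h3⟩
    exact ⟨h1.ne', (Nat.le_floor_iff' h1.ne').mp h2, h3⟩
  · rintro ⟨h1, h2, h3⟩
    exact ⟨⟨Nat.pos_of_ne_zero h1, (Nat.le_floor_iff' h1).mpr h2⟩, h3⟩

open Classical in
lemma card_Sv_le {x y : ℝ} (hx : 0 ≤ x) : ((Sv x y).card : ℝ) ≤ x := by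
  have h1 : (Sv x y).card ≤ ⌊x⌋₊ := by
    refine (Finset.card_filter_le _ _).trans ?_
    simp
  exact (by exact_mod_cast h1 : ((Sv x y).card : ℝ) ≤ ⌊x⌋₊).trans (Nat.floor_le hx)

lemma sum_log_Sv_le {x y : ℝ} (hx : 0 ≤ x) :
    ∑ n ∈ Sv x y, log (n : ℝ) ≤ (log 4 + 4) * x * ∑ m ∈ Sv x y, (1 : ℝ) / m := by
  have h1 : ∑ n ∈ Sv x y, log (n : ℝ) =
      ∑ n ∈ Sv x y, ∑ m ∈ n.divisors, ArithmeticFunction.vonMangoldt (n / m) := by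
    refine Finset.sum_congr rfl fun n _ => ?_
    rw [Nat.sum_div_divisors, ArithmeticFunction.vonMangoldt_sum]
  have h2 : ∑ n ∈ Sv x y, ∑ m ∈ n.divisors, ArithmeticFunction.vonMangoldt (n / m) =
      ∑ m ∈ Sv x y, ∑ n ∈ (Sv x y).filter (m ∣ ·), ArithmeticFunction.vonMangoldt (n / m) := by
    refine Finset.sum_comm' fun n m => ?_
    rw [mem_filter, Nat.mem_divisors]
    constructor
    · rintro ⟨hn, hmn, hn0⟩
      refine ⟨⟨hn, hmn⟩, ?_⟩
      rw [mem_Sv] at hn ⊢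
      refine ⟨ne_zero_of_dvd_ne_zero hn0 hmn, ?_, fun p hp hpm => hn.2.2 p hp (hpm.trans hmn)⟩
      exact le_trans (by exact_mod_cast Nat.le_of_dvd (Nat.pos_of_ne_zero hn0) hmn) hn.2.1
    · rintro ⟨⟨hn, hmn⟩, hm⟩
      exact ⟨hn, hmn, (mem_Sv.mp hn).1⟩
  rw [h1, h2, Finset.mul_sum]
  refine Finset.sum_le_sum fun m hm => ?_
  have hm0 : 0 < m := Nat.pos_of_ne_zero (mem_Sv.mp hm).1
  have hmr : (0 : ℝ) < m := by exact_mod_cast hm0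
  have h3 : ∑ n ∈ (Sv x y).filter (m ∣ ·), ArithmeticFunction.vonMangoldt (n / m) ≤
      Chebyshev.psi (x / m) := by
    have hinj : Set.InjOn (fun n => n / m) ((Sv x y).filter (m ∣ ·) : Set ℕ) := by
      intro a ha b hb hab
      simp only [coe_filter, Set.mem_ofPred_eq] at ha hb
      have := congrArg (· * m) hab
      simpa only [Nat.div_mul_cancel ha.2, Nat.div_mul_cancel hb.2] using this
    rw [← Finset.sum_image (f := ArithmeticFunction.vonMangoldt) hinj]
    unfold Chebyshev.psi
    refine Finset.sum_le_sum_of_subset_of_nonneg ?_ fun _ _ _ =>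
      ArithmeticFunction.vonMangoldt_nonneg
    intro d hd
    rw [mem_image] at hd
    obtain ⟨n, hn, rfl⟩ := hd
    rw [mem_filter, mem_Sv] at hn
    obtain ⟨⟨hn0, hnx, _⟩, k, rfl⟩ := hn
    have hk : k ≠ 0 := by rintro rfl; simp at hn0
    rw [Nat.mul_div_cancel_left k hm0, mem_Ioc]
    refine ⟨Nat.pos_of_ne_zero hk, (Nat.le_floor_iff' hk).mpr ?_⟩
    rw [le_div_iff₀ hmr]
    push_cast at hnx
    linarith
  refine h3.trans ((Chebyshev.psi_le_const_mul_self (by positivity)).trans (le_of_eq ?_))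
  ring

lemma log_le_two_sqrt {x : ℝ} (hx : 0 < x) : log x ≤ 2 * √x := by
  have h := Real.log_le_sub_one_of_pos (Real.sqrt_pos.mpr hx)
  rw [Real.log_sqrt hx.le] at h
  linarith

lemma exists_sieve : ∃ C : ℝ, 0 < C ∧ ∀ x y : ℝ, 2 ≤ y → y ≤ x →
    ((Sv x y).card : ℝ) ≤ C * (x / log y) := by
  obtain ⟨C, hC, h⟩ := exists_euler_le
  have hl4 : 0 < log 4 := Real.log_pos (by norm_num)
  refine ⟨log 4 + (2 + 4 * (log 4 + 4) * C), by positivity, fun x y hy hyx => ?_⟩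
  have hx0 : 0 < x := by linarith
  have hly : 0 < log y := Real.log_pos (by linarith)
  have hlx : 0 < log x := Real.log_pos (by linarith)
  have hlyx : log y ≤ log x := Real.log_le_log (by linarith) hyx
  rcases le_or_gt y 4 with h4 | h4
  · have h1 : log y ≤ log 4 := Real.log_le_log (by linarith) h4
    calc ((Sv x y).card : ℝ) ≤ x := card_Sv_le hx0.le
      _ ≤ log 4 * (x / log y) := by
        rw [← mul_div_assoc, le_div_iff₀ hly]
        nlinarith
      _ ≤ _ := by
        gcongr
        have : 0 < (2 + 4 * (log 4 + 4) * C) := by positivity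
        linarith
  · have hy2 : log y ≤ 2 * log (y / 2) := by
      have : y ≤ (y / 2) ^ 2 := by nlinarith
      calc log y ≤ log ((y / 2) ^ 2) := Real.log_le_log (by linarith) this
        _ = _ := by rw [Real.log_pow]; norm_num
    have hE := h (y / 2) x 0 (Sv x y) (by linarith) (by linarith) le_rfl (by norm_num) (by simp)
      (fun a ha => by
        rw [mem_Sv] at ha
        refine ⟨ha.1, fun p hp hpa => ⟨by linarith [ha.2.2 p hp hpa], ?_⟩⟩
        exact le_trans (by exact_mod_cast Nat.le_of_dvd (Nat.pos_of_ne_zero ha.1) hpa) ha.2.1)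
    have h1 : ∑ m ∈ Sv x y, (1 : ℝ) / m ≤ C * (2 * (log x / log y)) := by
      refine le_trans (le_of_eq ?_) (hE.trans ?_)
      · refine Finset.sum_congr rfl fun m _ => ?_
        rw [zero_sub, Real.rpow_neg_one, one_div]
      · have : 0 < log (y / 2) := by linarith
        gcongr
        rw [← mul_div_assoc, div_le_div_iff₀ this hly]
        nlinarith
    have h2 := (sum_log_Sv_le (y := y) hx0.le).trans
      (mul_le_mul_of_nonneg_left h1 (show 0 ≤ (log 4 + 4) * x by positivity))
    have h3 : ∀ n ∈ Sv x y, (1 : ℝ) ≤ (if (n : ℝ) ≤ √x then 1 else 0) + 2 / log x * log n := by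
      intro n hn
      have hn1 : (1 : ℝ) ≤ n := by exact_mod_cast Nat.one_le_iff_ne_zero.mpr (mem_Sv.mp hn).1
      have hn0 := Real.log_nonneg hn1
      split_ifs with hnx
      · have : 0 ≤ 2 / log x * log n := by positivity
        linarith
      · push Not at hnx
        have := Real.log_le_log (Real.sqrt_pos.mpr hx0) hnx.le
        rw [Real.log_sqrt hx0.le] at this
        rw [zero_add, div_mul_eq_mul_div, le_div_iff₀ hlx]
        linarith
    have h4 : ((Sv x y).card : ℝ) ≤ √x + 2 / log x * ∑ n ∈ Sv x y, log (n : ℝ) := by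
      have a1 := Finset.sum_le_sum h3
      rw [Finset.sum_add_distrib, ← Finset.mul_sum] at a1
      simp only [Finset.sum_const, nsmul_eq_mul, mul_one] at a1
      refine a1.trans (add_le_add ?_ le_rfl)
      rw [← Finset.sum_filter]
      simp only [Finset.sum_const, nsmul_eq_mul, mul_one]
      refine le_trans ?_ (card_Sv_le (y := y) (Real.sqrt_nonneg x))
      norm_cast
      refine Finset.card_le_card fun n hn => ?_
      rw [mem_filter, mem_Sv] at hn
      exact mem_Sv.mpr ⟨hn.1.1, hn.2, hn.1.2.2⟩
    have h5 : √x ≤ 2 * (x / log y) := by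
      have a1 := log_le_two_sqrt hx0
      have a2 := Real.mul_self_sqrt hx0.le
      rw [← mul_div_assoc, le_div_iff₀ hly]
      nlinarith [Real.sqrt_nonneg x]
    calc ((Sv x y).card : ℝ) ≤ 2 * (x / log y) +
          2 / log x * ((log 4 + 4) * x * (C * (2 * (log x / log y)))) := by
          refine h4.trans (add_le_add h5 ?_)
          gcongr
      _ = (2 + 4 * (log 4 + 4) * C) * (x / log y) := by field_simp; ring
      _ ≤ _ := mul_le_mul_of_nonneg_right (by linarith) (by positivity)

lemma pow_add_linear_le {S w : ℝ} (hS : 0 ≤ S) (hw : 0 ≤ w) (b : ℕ) :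
    S ^ (b + 1) + (b + 1) * (S ^ b * w) ≤ (S + w) ^ (b + 1) := by
  induction b with
  | zero => simp
  | succ b ih =>
    have h := mul_le_mul_of_nonneg_right ih (add_nonneg hS hw)
    have h2 : 0 ≤ ((b : ℝ) + 1) * (S ^ b * w) * w := by positivity
    push_cast
    calc _ ≤ (S ^ (b + 1) + (b + 1) * (S ^ b * w)) * (S + w) := by
          ring_nf at h2 ⊢; linarith
      _ ≤ _ := h
      _ = _ := by ring

lemma sum_powersetCard_prod_le {ι : Type*} [DecidableEq ι] (w : ι → ℝ) (D : Finset ι)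
    (hw : ∀ p ∈ D, 0 ≤ w p) : ∀ b : ℕ,
    ∑ A ∈ D.powersetCard b, ∏ p ∈ A, w p ≤ (∑ p ∈ D, w p) ^ b / b.factorial := by
  induction D using Finset.induction_on with
  | empty =>
    intro b
    cases b with
    | zero => simp
    | succ b => rw [Finset.powersetCard_eq_empty.mpr (by simp)]; simp
  | insert p D hp ih =>
    intro b
    have ih := ih fun q hq => hw q (mem_insert_of_mem hq)
    have hwp := hw p (mem_insert_self _ _)
    have hS : 0 ≤ ∑ q ∈ D, w q := Finset.sum_nonneg fun q hq => hw q (mem_insert_of_mem hq)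
    cases b with
    | zero => simp
    | succ b =>
      rw [Finset.powersetCard_succ_insert hp, Finset.sum_union, Finset.sum_image,
        Finset.sum_insert hp]
      · have h1 : ∑ A ∈ D.powersetCard b, ∏ q ∈ insert p A, w q =
            w p * ∑ A ∈ D.powersetCard b, ∏ q ∈ A, w q := by
          rw [Finset.mul_sum]
          refine Finset.sum_congr rfl fun A hA => ?_
          rw [Finset.prod_insert fun h => hp ((mem_powersetCard.mp hA).1 h)]
        rw [h1]
        have h2 := ih (b + 1)
        have h3 := mul_le_mul_of_nonneg_left (ih b) hwp
        have h4 := pow_add_linear_le hS hwp b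
        refine (add_le_add h2 h3).trans ?_
        rw [Nat.factorial_succ]
        push_cast
        have hf : (0 : ℝ) < b.factorial := by positivity
        rw [le_div_iff₀ (by positivity)]
        refine le_trans (le_of_eq ?_) (h4.trans_eq (by ring))
        field_simp
      · intro A hA A' hA' h
        have hA := fun h => hp ((mem_powersetCard.mp hA).1 h)
        have hA' := fun h => hp ((mem_powersetCard.mp hA').1 h)
        have := congrArg (Finset.erase · p) h
        simpa only [Finset.erase_insert hA, Finset.erase_insert hA'] using this
      · rw [Finset.disjoint_left]
        intro A hA hA'
        rw [mem_image] at hA'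
        obtain ⟨A', _, rfl⟩ := hA'
        exact hp ((mem_powersetCard.mp hA).1 (mem_insert_self _ _))

lemma sum_powerset_card_le {ι : Type*} [DecidableEq ι] (w : ι → ℝ) (D : Finset ι)
    (hw : ∀ p ∈ D, 0 ≤ w p) {σ : ℝ} (hσ : ∑ p ∈ D, w p ≤ σ) {B : ℕ} (hB : D.card < B)
    (g : ℕ → ℝ) (hg : ∀ b, 0 ≤ g b) :
    ∑ A ∈ D.powerset, g A.card * ∏ p ∈ A, w p ≤ ∑ b ∈ range B, σ ^ b / b.factorial * g b := by
  have hS : 0 ≤ ∑ q ∈ D, w q := Finset.sum_nonneg hw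
  have hσ0 := hS.trans hσ
  rw [Finset.sum_powerset]
  calc _ = ∑ b ∈ range (D.card + 1), g b * ∑ A ∈ D.powersetCard b, ∏ p ∈ A, w p := by
        refine Finset.sum_congr rfl fun b _ => ?_
        rw [Finset.mul_sum]
        refine Finset.sum_congr rfl fun A hA => ?_
        rw [(mem_powersetCard.mp hA).2]
    _ ≤ ∑ b ∈ range (D.card + 1), σ ^ b / b.factorial * g b := by
        refine Finset.sum_le_sum fun b _ => ?_
        rw [mul_comm]
        refine mul_le_mul_of_nonneg_right ((sum_powersetCard_prod_le w D hw b).trans ?_) (hg b)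
        gcongr
    _ ≤ _ := by
        refine Finset.sum_le_sum_of_subset_of_nonneg (Finset.range_subset_range.mpr hB) fun b _ _ => ?_
        have := hg b
        positivity

lemma sum_powerset_union {ι : Type*} [DecidableEq ι] {U D : Finset ι} (h : Disjoint U D)
    (f : Finset ι → ℝ) :
    ∑ A ∈ (U ∪ D).powerset, f A = ∑ A₁ ∈ U.powerset, ∑ A₂ ∈ D.powerset, f (A₁ ∪ A₂) := by
  rw [← Finset.sum_product']
  symm
  refine Finset.sum_bij' (fun x _ => x.1 ∪ x.2) (fun A _ => (A ∩ U, A ∩ D)) ?_ ?_ ?_ ?_ ?_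
  · rintro ⟨A, A'⟩ hA
    rw [mem_product, mem_powerset, mem_powerset] at hA
    exact mem_powerset.mpr (Finset.union_subset_union hA.1 hA.2)
  · intro A _
    rw [mem_product, mem_powerset, mem_powerset]
    exact ⟨Finset.inter_subset_right, Finset.inter_subset_right⟩
  · rintro ⟨A, A'⟩ hA
    rw [mem_product, mem_powerset, mem_powerset] at hA
    obtain ⟨h1, h2⟩ := hA
    rw [Finset.disjoint_left] at h
    ext x <;> simp only [mem_inter, mem_union]
    · constructor
      · rintro ⟨h3 | h3, h4⟩
        · exact h3
        · exact absurd (h2 h3) (h h4)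
      · exact fun h3 => ⟨Or.inl h3, h1 h3⟩
    · constructor
      · rintro ⟨h3 | h3, h4⟩
        · exact absurd h4 (h (h1 h3))
        · exact h3
      · exact fun h3 => ⟨Or.inr h3, h2 h3⟩
  · intro A hA
    rw [mem_powerset] at hA
    simp only
    rw [← Finset.inter_union_distrib_left, Finset.inter_eq_left.mpr hA]
  · intro _ _; rfl

/-- The list of block sizes of `A`. -/
def cnt (D : ℕ → Finset ℕ) (A : Finset ℕ) (n : ℕ) : List ℕ :=
  (List.range n).map fun i => (A ∩ D i).card

lemma cnt_succ (D : ℕ → Finset ℕ) (A : Finset ℕ) (n : ℕ) :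
    cnt D A (n + 1) = cnt D A n ++ [(A ∩ D n).card] := by
  simp [cnt, List.range_succ]

lemma cnt_length (D : ℕ → Finset ℕ) (A : Finset ℕ) (n : ℕ) : (cnt D A n).length = n := by
  simp [cnt]

lemma cnt_take (D : ℕ → Finset ℕ) (A : Finset ℕ) {j n : ℕ} (h : j ≤ n) :
    (cnt D A n).take j = cnt D A j := by
  simp only [cnt, ← List.map_take, List.take_range, min_eq_left h]

/-- A chain of finite sets `U n` whose increments are the disjoint blocks `D n`. -/
structure Blocks (U D : ℕ → Finset ℕ) : Prop where
  zero : U 0 = ∅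
  succ : ∀ n, U (n + 1) = U n ∪ D n
  disj : ∀ n, Disjoint (U n) (D n)

lemma Blocks.mono {U D : ℕ → Finset ℕ} (h : Blocks U D) : Monotone U :=
  monotone_nat_of_le_succ fun n => by rw [h.succ n]; exact Finset.subset_union_left

lemma Blocks.sub {U D : ℕ → Finset ℕ} (h : Blocks U D) {i n : ℕ} (hi : i < n) : D i ⊆ U n := by
  have h1 : D i ⊆ U (i + 1) := by rw [h.succ]; exact Finset.subset_union_right
  exact h1.trans (h.mono hi)

lemma Blocks.card_inter {U D : ℕ → Finset ℕ} (h : Blocks U D) (A : Finset ℕ) (n : ℕ) :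
    (A ∩ U n).card = (cnt D A n).sum := by
  induction n with
  | zero => simp [h.zero, cnt]
  | succ n ih =>
    rw [h.succ, cnt_succ, Finset.inter_union_distrib_left, Finset.card_union_of_disjoint, ih]
    · simp
    · exact (h.disj n).mono Finset.inter_subset_right Finset.inter_subset_right

lemma Blocks.card_sdiff {U D : ℕ → Finset ℕ} (h : Blocks U D) {A : Finset ℕ} {n j : ℕ}
    (hA : A ⊆ U n) (hj : j ≤ n) : (A \ U j).card = ((cnt D A n).drop j).sum := by
  have h1 := h.card_inter A n
  have h2 := h.card_inter A j
  have h3 : ((cnt D A n).take j).sum + ((cnt D A n).drop j).sum = (cnt D A n).sum := by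
    rw [← List.sum_append, List.take_append_drop]
  rw [cnt_take _ _ hj] at h3
  rw [Finset.inter_eq_left.mpr hA] at h1
  have h4 := Finset.card_sdiff_add_card_inter A (U j)
  omega

lemma Blocks.sum_le_Qw {U D : ℕ → Finset ℕ} (h : Blocks U D) (A : Finset ℕ) (v : ℕ → ℝ)
    (hv : ∀ i, ∀ p ∈ D i, v p ≤ 2 ^ (i + 1)) (n : ℕ) :
    ∑ p ∈ A ∩ U n, v p ≤ Qw (cnt D A n) := by
  induction n with
  | zero => simp [h.zero, Qw, cnt]
  | succ n ih =>
    rw [h.succ, cnt_succ, Qw_snoc, cnt_length, Finset.inter_union_distrib_left, Finset.sum_union]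
    · refine add_le_add ih ?_
      have := Finset.sum_le_card_nsmul (A ∩ D n) v (2 ^ (n + 1)) fun p hp =>
        hv n p (mem_inter.mp hp).2
      simpa using this
    · exact (h.disj n).mono Finset.inter_subset_right Finset.inter_subset_right

lemma Blocks.sum_powerset_le {U D : ℕ → Finset ℕ} (h : Blocks U D) {w : ℕ → ℝ} (hw : ∀ p, 0 ≤ w p)
    {s : ℕ → ℝ} {r : ℝ} (hr : 0 ≤ r) (hs : ∀ i, 0 ≤ s i) (hD : ∀ i, ∑ p ∈ D i, w p ≤ r * s i) {B : ℕ} (n : ℕ) :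
    ∀ (_ : ∀ i < n, (D i).card < B) (Ψ : List ℕ → ℝ), (∀ c, 0 ≤ Ψ c) →
    ∑ A ∈ (U n).powerset, Ψ (cnt D A n) * ∏ p ∈ A, w p ≤ Ew B s n (fun c => r ^ c.sum * Ψ c) := by
  induction n with
  | zero => intro _ Ψ _; simp [h.zero, cnt, Ew]
  | succ n ih =>
    intro hB Ψ hΨ
    rw [h.succ, sum_powerset_union (h.disj n)]
    have h1 : ∀ A₁ ∈ (U n).powerset, ∑ A₂ ∈ (D n).powerset,
        Ψ (cnt D (A₁ ∪ A₂) (n + 1)) * ∏ p ∈ A₁ ∪ A₂, w p ≤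
        (∑ b ∈ range B, (r * s n) ^ b / b.factorial * Ψ (cnt D A₁ n ++ [b])) * ∏ p ∈ A₁, w p := by
      intro A₁ hA₁
      rw [mem_powerset] at hA₁
      have h2 : ∀ A₂ ∈ (D n).powerset, Ψ (cnt D (A₁ ∪ A₂) (n + 1)) * ∏ p ∈ A₁ ∪ A₂, w p =
          (Ψ (cnt D A₁ n ++ [A₂.card]) * ∏ p ∈ A₂, w p) * ∏ p ∈ A₁, w p := by
        intro A₂ hA₂
        rw [mem_powerset] at hA₂
        have hd : Disjoint A₁ A₂ := (h.disj n).mono hA₁ hA₂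
        have e1 : cnt D (A₁ ∪ A₂) n = cnt D A₁ n := by
          unfold cnt
          refine List.map_congr_left fun i hi => ?_
          have hi := List.mem_range.mp hi
          rw [Finset.union_inter_distrib_right]
          have : A₂ ∩ D i = ∅ := Finset.disjoint_iff_inter_eq_empty.mp
            (((h.disj n).mono (h.sub hi) hA₂).symm)
          rw [this, Finset.union_empty]
        have e2 : (A₁ ∪ A₂) ∩ D n = A₂ := by
          rw [Finset.union_inter_distrib_right]
          have : A₁ ∩ D n = ∅ := Finset.disjoint_iff_inter_eq_empty.mp ((h.disj n).mono_left hA₁)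
          rw [this, Finset.empty_union, Finset.inter_eq_left.mpr hA₂]
        rw [cnt_succ, e1, e2, Finset.prod_union hd]
        ring
      rw [Finset.sum_congr rfl h2, ← Finset.sum_mul]
      refine mul_le_mul_of_nonneg_right ?_ (Finset.prod_nonneg fun p _ => hw p)
      exact sum_powerset_card_le w (D n) (fun p _ => hw p) (hD n) (hB n (Nat.lt_succ_self n))
        (fun b => Ψ (cnt D A₁ n ++ [b])) fun b => hΨ _
    refine (Finset.sum_le_sum h1).trans ?_
    have h3 := ih (fun i hi => hB i (by omega))
      (fun c => ∑ b ∈ range B, (r * s n) ^ b / b.factorial * Ψ (c ++ [b])) (fun c =>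
        Finset.sum_nonneg fun b _ => by
          have := hΨ (c ++ [b]); have := hs n; positivity)
    refine h3.trans (le_of_eq ?_)
    simp only [Ew]
    refine Ew_congr fun c _ => ?_
    rw [Finset.mul_sum]
    refine Finset.sum_congr rfl fun b _ => ?_
    rw [List.sum_append, List.sum_singleton, pow_add, mul_pow]
    ring

/-- The logarithmic cells of width `η` that contain a divisor of `a`. -/
noncomputable def cells (η : ℝ) (a : ℕ) : Finset ℕ :=
  a.divisors.image fun e : ℕ => ⌊log (e : ℝ) / η⌋₊

/-- The number of logarithmic cells of width `η` that contain a divisor of `a`. -/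
noncomputable def Lc (η : ℝ) (a : ℕ) : ℝ := ((cells η a).card : ℝ)

lemma Lc_nonneg (η : ℝ) (a : ℕ) : 0 ≤ Lc η a := Nat.cast_nonneg _

lemma mem_cells {η : ℝ} {a k : ℕ} (ha : a ≠ 0) :
    k ∈ cells η a ↔ ∃ e : ℕ, e ∣ a ∧ ⌊log (e : ℝ) / η⌋₊ = k := by
  simp [cells, ha]

lemma Lc_mul_le {η : ℝ} (hη : 0 < η) {a b : ℕ} (ha : a ≠ 0) (hb : b ≠ 0) :
    Lc η (a * b) ≤ 2 * Lc η a * Lc η b := by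
  have h1 : cells η (a * b) ⊆
      ((cells η a ×ˢ cells η b) ×ˢ range 2).image fun u => u.1.1 + u.1.2 + u.2 := by
    intro k hk
    obtain ⟨e, he, rfl⟩ := (mem_cells (mul_ne_zero ha hb)).mp hk
    obtain ⟨e₁, e₂, h₁, h₂, rfl⟩ := exists_dvd_and_dvd_of_dvd_mul he
    have n1 : (e₁ : ℝ) ≠ 0 := by
      have : e₁ ≠ 0 := fun h => ha (by simpa [h] using h₁)
      exact_mod_cast this
    have n2 : (e₂ : ℝ) ≠ 0 := by
      have : e₂ ≠ 0 := fun h => hb (by simpa [h] using h₂)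
      exact_mod_cast this
    have p1 : 0 ≤ log e₁ / η := div_nonneg (log_natCast_nonneg _) hη.le
    have p2 : 0 ≤ log e₂ / η := div_nonneg (log_natCast_nonneg _) hη.le
    have e0 : log ((e₁ * e₂ : ℕ) : ℝ) / η = log e₁ / η + log e₂ / η := by
      push_cast; rw [log_mul n1 n2, add_div]
    rw [mem_image]
    set u := log e₁ / η
    set v := log e₂ / η
    have hu := Nat.floor_le p1
    have hv := Nat.floor_le p2
    have hu' := Nat.lt_floor_add_one u
    have hv' := Nat.lt_floor_add_one v
    have l1 : ⌊u⌋₊ + ⌊v⌋₊ ≤ ⌊u + v⌋₊ := Nat.le_floor (by push_cast; linarith)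
    have l2 : ⌊u + v⌋₊ < ⌊u⌋₊ + ⌊v⌋₊ + 2 := (Nat.floor_lt (by linarith)).mpr (by push_cast; linarith)
    refine ⟨((⌊u⌋₊, ⌊v⌋₊), ⌊u + v⌋₊ - (⌊u⌋₊ + ⌊v⌋₊)), ?_, ?_⟩
    · simp only [mem_product, mem_range]
      exact ⟨⟨(mem_cells ha).mpr ⟨e₁, h₁, rfl⟩, (mem_cells hb).mpr ⟨e₂, h₂, rfl⟩⟩, by omega⟩
    · simp only [e0]; omega
  have h2 := (card_le_card h1).trans card_image_le
  rw [card_product, card_product, card_range] at h2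
  have h3 : ((cells η (a * b)).card : ℝ) ≤ (cells η a).card * (cells η b).card * 2 := by
    exact_mod_cast h2
  unfold Lc; linarith

lemma Lc_le_card_divisors (η : ℝ) (a : ℕ) : Lc η a ≤ a.divisors.card := by
  unfold Lc; exact_mod_cast card_image_le

lemma Lc_le_of_dvd {η : ℝ} {a b : ℕ} (h : a ∣ b) (hb : b ≠ 0) : Lc η a ≤ Lc η b := by
  unfold Lc cells
  exact_mod_cast card_le_card (image_subset_image (Nat.divisors_subset_of_dvd hb h))

lemma Lc_le_log {η : ℝ} (hη : 0 < η) {a : ℕ} (ha : a ≠ 0) : Lc η a ≤ 1 + log a / η := by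
  have h1 : cells η a ⊆ range (⌊log a / η⌋₊ + 1) := by
    intro k hk
    obtain ⟨e, he, rfl⟩ := (mem_cells ha).mp hk
    rw [mem_range, Nat.lt_succ_iff]
    refine Nat.floor_mono (div_le_div_of_nonneg_right ?_ hη.le)
    have e0 : 0 < e := Nat.pos_of_dvd_of_pos he (Nat.pos_of_ne_zero ha)
    exact log_le_log (by exact_mod_cast e0) (by exact_mod_cast Nat.le_of_dvd (Nat.pos_of_ne_zero ha) he)
  have h2 := card_le_card h1
  rw [card_range] at h2
  have h3 : ((cells η a).card : ℝ) ≤ ⌊log a / η⌋₊ + 1 := by exact_mod_cast h2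
  have := Nat.floor_le (div_nonneg (log_natCast_nonneg a) hη.le)
  unfold Lc; linarith

lemma card_divisors_prod_le {A : Finset ℕ} (hA : ∀ p ∈ A, p.Prime) :
    (∏ p ∈ A, p).divisors.card ≤ 2 ^ A.card := by
  induction A using Finset.induction_on with
  | empty => simp
  | insert p A hp ih =>
    rw [prod_insert hp, card_insert_of_notMem hp, pow_succ]
    have hc : Nat.Coprime p (∏ p ∈ A, p) := Nat.Coprime.prod_right fun q hq =>
      (Nat.coprime_primes (hA p (mem_insert_self _ _)) (hA q (mem_insert_of_mem hq))).mpr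
        fun h => hp (h ▸ hq)
    rw [hc.card_divisors_mul, (hA p (mem_insert_self _ _)).divisors, card_pair (hA p (mem_insert_self _ _)).one_lt.ne]
    have := ih fun q hq => hA q (mem_insert_of_mem hq)
    omega

lemma Lc_prod_le {η : ℝ} {A : Finset ℕ} (hA : ∀ p ∈ A, p.Prime) :
    Lc η (∏ p ∈ A, p) ≤ 2 ^ A.card :=
  (Lc_le_card_divisors _ _).trans (by exact_mod_cast card_divisors_prod_le hA)

/-- Primes in `(e ^ η, t]` whose logarithm is at most `2 ^ k * η`. -/
noncomputable def dyU (η t : ℝ) (k : ℕ) : Finset ℕ :=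
  (pI (exp η) t).filter fun p => log (p : ℝ) ≤ 2 ^ k * η

/-- Primes in `(e ^ η, t]` whose logarithm lies in `(2 ^ k * η, 2 ^ (k + 1) * η]`. -/
noncomputable def dyD (η t : ℝ) (k : ℕ) : Finset ℕ :=
  (pI (exp η) t).filter fun p => 2 ^ k * η < log (p : ℝ) ∧ log (p : ℝ) ≤ 2 ^ (k + 1) * η

lemma dy_blocks {η : ℝ} (hη : 0 < η) (t : ℝ) : Blocks (dyU η t) (dyD η t) where
  zero := by
    refine filter_eq_empty_iff.mpr fun p hp => ?_
    have h := ((mem_pI (exp_pos η).le).mp hp).2.1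
    have h0 : (0 : ℝ) < p := (exp_pos η).trans h
    have := (lt_log_iff_exp_lt h0).mpr h
    rw [pow_zero, one_mul]; linarith
  succ n := by
    have h2 : (2 : ℝ) ^ n * η ≤ 2 ^ (n + 1) * η := by
      have : (0 : ℝ) < 2 ^ n * η := by positivity
      rw [pow_succ]; linarith
    ext p
    simp only [dyU, dyD, mem_union, mem_filter]
    constructor
    · rintro ⟨h, h'⟩
      rcases le_or_gt (log (p : ℝ)) (2 ^ n * η) with h1 | h1
      · exact Or.inl ⟨h, h1⟩
      · exact Or.inr ⟨h, h1, h'⟩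
    · rintro (⟨h, h'⟩ | ⟨h, _, h'⟩)
      · exact ⟨h, h'.trans h2⟩
      · exact ⟨h, h'⟩
  disj n := by
    rw [Finset.disjoint_left]
    intro p h1 h2
    simp only [dyU, dyD, mem_filter] at h1 h2
    linarith [h1.2, h2.2.1]

lemma dyU_eq {η t : ℝ} {n : ℕ} (h : log t ≤ 2 ^ n * η) :
    dyU η t n = pI (exp η) t := by
  refine filter_eq_self.mpr fun p hp => ?_
  have h1 := (mem_pI (exp_pos η).le).mp hp
  exact (log_le_log (by exact_mod_cast h1.1.pos) h1.2.2).trans h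

lemma dyD_eq_empty {η t : ℝ} {i : ℕ} (h : log t < 2 ^ i * η) : dyD η t i = ∅ := by
  refine filter_eq_empty_iff.mpr fun p hp hq => ?_
  have h1 := (mem_pI (exp_pos η).le).mp hp
  have := log_le_log (by exact_mod_cast h1.1.pos) h1.2.2
  linarith [hq.1]

lemma dyD_subset {η t : ℝ} (i : ℕ) :
    dyD η t i ⊆ pI (exp (2 ^ i * η)) (min (exp (2 ^ (i + 1) * η)) t) := by
  intro p hp
  have hp := mem_filter.mp hp
  have h1 := (mem_pI (exp_pos η).le).mp hp.1
  have h0 : (0 : ℝ) < p := by exact_mod_cast h1.1.pos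
  refine (mem_pI (exp_pos _).le).mpr ⟨h1.1, (lt_log_iff_exp_lt h0).mp hp.2.1, le_min ?_ h1.2.2⟩
  exact (log_le_iff_le_exp h0).mp hp.2.2

lemma sum_dyadic_le {η T : ℝ} (hη : 0 < η) (hT : 0 ≤ T) (j : ℕ) :
    ∑ i ∈ range j, (if 2 ^ i * η ≤ T then 2 ^ i * η else 0) ≤ 2 * T := by
  suffices h : ∑ i ∈ range j, (if 2 ^ i * η ≤ T then 2 ^ i * η else 0) ≤ 2 * T ∧
      ∑ i ∈ range j, (if 2 ^ i * η ≤ T then 2 ^ i * η else 0) ≤ 2 ^ j * η from h.1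
  induction j with
  | zero => simp; exact ⟨hT, hη.le⟩
  | succ j ih =>
    rw [sum_range_succ, pow_succ]
    have : (0 : ℝ) < 2 ^ j * η := by positivity
    split_ifs with h
    · constructor <;> linarith [ih.2]
    · constructor <;> linarith [ih.1, ih.2]

lemma sum_half_pow_le (j : ℕ) : ∑ i ∈ range j, ((1 : ℝ) / 2) ^ i ≤ 2 := by
  have : ∑ i ∈ range j, ((1 : ℝ) / 2) ^ i = 2 - 2 * (1 / 2) ^ j := by
    induction j with
    | zero => simp
    | succ j ih => rw [sum_range_succ, ih]; ring
  have h : (0 : ℝ) ≤ (1 / 2) ^ j := by positivity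
  linarith

lemma two_le_exp {η : ℝ} (hη : log 2 ≤ η) : 2 ≤ exp η := by
  have := exp_le_exp.mpr hη
  rwa [exp_log (by norm_num)] at this

lemma exists_dyD_mass : ∃ C : ℝ, 0 < C ∧ ∀ η t κ : ℝ, log 2 ≤ η → 1 ≤ t → 0 ≤ κ → κ * log t ≤ 1 →
    ∀ i, ∑ p ∈ dyD η t i, (p : ℝ) ^ (κ - 1) ≤ log 2 * (1 + C * ((1 / 2) ^ i +
      κ * (if 2 ^ i * η ≤ log t then 2 ^ i * η else 0))) := by
  obtain ⟨C, hC, hP⟩ := exists_prime_mass_le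
  have l2 : 0 < log 2 := log_pos (by norm_num)
  refine ⟨4 * C * (1 + (1 / log 2)) / log 2, by positivity, fun η t κ hη ht hκ hκt i => ?_⟩
  have hη0 : 0 < η := l2.trans_le hη
  split_ifs with h
  · have hx : 2 ≤ exp (2 ^ i * η) := by
      refine two_le_exp (hη.trans ?_)
      exact le_mul_of_one_le_left hη0.le (one_le_pow₀ (by norm_num))
    set x := exp (2 ^ i * η) with hxd
    set y := min (exp (2 ^ (i + 1) * η)) t with hyd
    have hpos : 0 < 2 ^ i * η := by positivity
    have hxy : x ≤ y := by
      refine le_min (exp_le_exp.mpr ?_) ?_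
      · rw [pow_succ]; linarith
      · exact (le_log_iff_exp_le (by linarith)).mp h
    have hy0 : 0 < y := by linarith
    have hy1 : log y ≤ log t := log_le_log hy0 (min_le_right _ _)
    have hy2 : log y ≤ 2 * (2 ^ i * η) := by
      have := log_le_log hy0 (min_le_left _ _)
      rw [log_exp] at this
      rw [pow_succ] at this; linarith
    have hlx : log x = 2 ^ i * η := log_exp _
    have hly : 0 < log y := log_pos (by linarith)
    have h1 := hP x y κ hx hxy hκ ((mul_le_mul_of_nonneg_left hy1 hκ).trans hκt)
    have h2 : log (log y / log x) ≤ log 2 := by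
      refine log_le_log (by rw [hlx]; positivity) ?_
      rw [hlx, div_le_iff₀ hpos]; exact hy2
    have h3 : C / log x ≤ C / log 2 * (1 / 2) ^ i := by
      rw [hlx, one_div, inv_pow, ← div_eq_mul_inv, div_div]
      refine div_le_div_of_nonneg_left hC.le (by positivity) ?_
      rw [mul_comm]; exact mul_le_mul_of_nonneg_left hη (by positivity)
    have h4 : C * (κ * log y) ≤ C * (κ * (2 * (2 ^ i * η))) := by gcongr
    have h5 := sum_le_sum_of_subset_of_nonneg (f := fun p : ℕ => (p : ℝ) ^ (κ - 1))
      (dyD_subset (η := η) (t := t) i) (fun p _ _ => by positivity)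
    have h6 : log 2 * (1 + 4 * C * (1 + (1 / log 2)) / log 2 * ((1 / 2) ^ i + κ * (2 ^ i * η))) =
        log 2 + 4 * C * (1 + 1 / log 2) * ((1 / 2) ^ i + κ * (2 ^ i * η)) := by
      field_simp
    rw [h6]
    have a1 : 0 ≤ C * (1 / 2 : ℝ) ^ i := by positivity
    have a2 : 0 ≤ C * (κ * (2 ^ i * η)) := by positivity
    have a3 : 0 ≤ C / log 2 * (1 / 2 : ℝ) ^ i := by positivity
    have a4 : 0 ≤ C / log 2 * (κ * (2 ^ i * η)) := by positivity
    have h7 : 4 * C * (1 + 1 / log 2) * ((1 / 2) ^ i + κ * (2 ^ i * η)) =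
        4 * (C * (1 / 2 : ℝ) ^ i) + 4 * (C * (κ * (2 ^ i * η))) +
        4 * (C / log 2 * (1 / 2 : ℝ) ^ i) + 4 * (C / log 2 * (κ * (2 ^ i * η))) := by ring
    rw [h7]
    have h8 : C * (κ * (2 * (2 ^ i * η))) = 2 * (C * (κ * (2 ^ i * η))) := by ring
    linarith
  · rw [dyD_eq_empty (not_le.mp h), sum_empty]; positivity

lemma exists_Lc_subset_sum : ∃ C : ℝ, 0 < C ∧ ∀ (η t κ : ℝ) (n : ℕ), log 2 ≤ η → 1 ≤ t →
    log t ≤ 2 ^ n * η → 0 ≤ κ → κ * log t ≤ 1 →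
    ∑ A ∈ (pI (exp η) t).powerset, Lc η (∏ p ∈ A, p) * ∏ p ∈ A, (p : ℝ) ^ (κ - 1) ≤
      C * (2 * exp 1 * log 2) ^ n * ww n := by
  obtain ⟨C₁, hC₁, hm⟩ := exists_dyD_mass
  have l2 : 0 < log 2 := log_pos (by norm_num)
  obtain ⟨C, hC, hE⟩ := exists_Ew_core ⌈C₁ * 4⌉₊
  refine ⟨2 * C, by positivity, fun η t κ n hη ht hn hκ hκt => ?_⟩
  have hη0 : 0 < η := l2.trans_le hη
  have hlt : 0 ≤ log t := log_nonneg ht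
  have hbl := dy_blocks hη0 t
  set s : ℕ → ℝ := fun i => 1 + C₁ * ((1 / 2) ^ i +
      κ * (if 2 ^ i * η ≤ log t then 2 ^ i * η else 0)) with hs
  have hs1 : ∀ i, 1 ≤ s i := by
    intro i
    have : (0 : ℝ) ≤ if 2 ^ i * η ≤ log t then 2 ^ i * η else 0 := by split_ifs <;> positivity
    have : 0 ≤ C₁ * ((1 / 2) ^ i + κ * (if 2 ^ i * η ≤ log t then 2 ^ i * η else 0)) := by positivity
    simp only [hs]; linarith
  have hs2 : ∀ j : ℕ, ∑ i ∈ range j, s i ≤ j + (⌈C₁ * 4⌉₊ : ℕ) := by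
    intro j
    have e : ∑ i ∈ range j, s i = j + C₁ * (∑ i ∈ range j, ((1 : ℝ) / 2) ^ i +
        κ * ∑ i ∈ range j, (if 2 ^ i * η ≤ log t then 2 ^ i * η else 0)) := by
      simp only [hs, sum_add_distrib, mul_sum, sum_const, card_range, nsmul_eq_mul, mul_one, mul_add]
    have h1 := sum_dyadic_le hη0 hlt j
    have h2 := mul_le_mul_of_nonneg_left h1 hκ
    have h3 : C₁ * (∑ i ∈ range j, ((1 : ℝ) / 2) ^ i +
        κ * ∑ i ∈ range j, (if 2 ^ i * η ≤ log t then 2 ^ i * η else 0)) ≤ C₁ * 4 :=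
      mul_le_mul_of_nonneg_left (by linarith [sum_half_pow_le j]) hC₁.le
    rw [e]; linarith [Nat.le_ceil (C₁ * 4)]
  have hne : (range (n + 1)).Nonempty := nonempty_range_add_one
  set Φ : List ℕ → ℝ := fun c => (range (n + 1)).inf' hne
    fun j => (2 : ℝ) ^ (c.drop j).sum * (1 + Qw (c.take j)) with hΦ
  have hΦ0 : ∀ c, 0 ≤ Φ c := fun c => le_inf' _ _ fun j _ => by
    have := Qw_nonneg (c.take j); positivity
  have hΦ1 : ∀ c : List ℕ, c.length = n → ∀ j ≤ n,
      Φ c ≤ 2 ^ (c.drop j).sum * (1 + Qw (c.take j)) := fun c _ j hj =>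
    inf'_le (fun j => (2 : ℝ) ^ (c.drop j).sum * (1 + Qw (c.take j))) (mem_range.mpr (by omega))
  have hL : ∀ A ∈ (dyU η t n).powerset, Lc η (∏ p ∈ A, p) ≤ 2 * Φ (cnt (dyD η t) A n) := by
    intro A hA
    rw [mem_powerset] at hA
    have hpr : ∀ p ∈ A, p.Prime := fun p hp =>
      ((mem_pI (exp_pos η).le).mp (mem_filter.mp (hA hp)).1).1
    rw [hΦ]
    have h2 : Lc η (∏ p ∈ A, p) / 2 ≤ (range (n + 1)).inf' hne fun j =>
        (2 : ℝ) ^ ((cnt (dyD η t) A n).drop j).sum * (1 + Qw ((cnt (dyD η t) A n).take j)) := by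
      refine le_inf' _ _ fun j hj => ?_
      have hj : j ≤ n := by have := mem_range.mp hj; omega
      have hpA : (∏ p ∈ A ∩ dyU η t j, p) * ∏ p ∈ A \ dyU η t j, p = ∏ p ∈ A, p :=
        prod_inter_mul_prod_sdiff A _ _
      have n1 : ∏ p ∈ A ∩ dyU η t j, p ≠ 0 :=
        prod_ne_zero_iff.mpr fun p hp => (hpr p (mem_inter.mp hp).1).ne_zero
      have n2 : ∏ p ∈ A \ dyU η t j, p ≠ 0 :=
        prod_ne_zero_iff.mpr fun p hp => (hpr p (mem_sdiff.mp hp).1).ne_zero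
      have h3 := Lc_mul_le hη0 n1 n2
      rw [hpA] at h3
      have h4 := Lc_prod_le (η := η) (A := A \ dyU η t j) fun p hp => hpr p (mem_sdiff.mp hp).1
      rw [hbl.card_sdiff hA hj] at h4
      have h5 := Lc_le_log hη0 n1
      have h6 : log ((∏ p ∈ A ∩ dyU η t j, p : ℕ) : ℝ) / η ≤ Qw ((cnt (dyD η t) A n).take j) := by
        rw [cnt_take _ _ hj]
        have h7 := hbl.sum_le_Qw A (fun p => log (p : ℝ) / η) (fun i p hp => by
          have := (mem_filter.mp hp).2.2
          rwa [div_le_iff₀ hη0]) j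
        refine le_trans (le_of_eq ?_) h7
        push_cast
        rw [log_prod fun p hp => by
          exact_mod_cast (hpr p (mem_inter.mp hp).1).ne_zero, sum_div]
      have h8 := mul_le_mul (h5.trans (add_le_add_right h6 1)) h4 (Lc_nonneg _ _)
        (by have := Qw_nonneg ((cnt (dyD η t) A n).take j); positivity)
      linarith
    linarith
  have h1 := hbl.sum_powerset_le (w := fun p => (p : ℝ) ^ (κ - 1)) (fun p => by positivity)
    l2.le (fun i => zero_le_one.trans (hs1 i)) (hm η t κ hη ht hκ hκt) n
    (B := (pI (exp η) t).card + 1)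
    (fun i _ => Nat.lt_succ_of_le (card_le_card (filter_subset _ _))) Φ hΦ0
  have h2 := h1.trans (hE _ n s Φ hs1 hs2 hΦ1)
  rw [← dyU_eq hn]
  have h3 : ∑ A ∈ (dyU η t n).powerset, Lc η (∏ p ∈ A, p) * ∏ p ∈ A, (p : ℝ) ^ (κ - 1) ≤
      ∑ A ∈ (dyU η t n).powerset, 2 * (Φ (cnt (dyD η t) A n) * ∏ p ∈ A, (p : ℝ) ^ (κ - 1)) := by
    refine sum_le_sum fun A hA => ?_
    rw [← mul_assoc]
    exact mul_le_mul_of_nonneg_right (hL A hA) (prod_nonneg fun p _ => by positivity)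
  rw [← mul_sum] at h3
  linarith

lemma exists_Lc_sq_sum : ∃ K : ℝ, 0 < K ∧ ∀ (η κ : ℝ) (M : ℕ), log 2 ≤ η → κ ≤ 1 / 4 →
    ∑ m ∈ Icc 1 M, Lc η (m ^ 2) * ((m ^ 2 : ℕ) : ℝ) ^ (κ - 1) ≤ K := by
  have l2 : 0 < log 2 := log_pos (by norm_num)
  have hsum : Summable fun m : ℕ => (m : ℝ) ^ (-(5 / 4) : ℝ) :=
    Real.summable_nat_rpow.mpr (by norm_num)
  refine ⟨(1 + 8 / log 2) * (1 + ∑' m : ℕ, (m : ℝ) ^ (-(5 / 4) : ℝ)), ?_, fun η κ M hη hκ => ?_⟩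
  · have : 0 ≤ ∑' m : ℕ, (m : ℝ) ^ (-(5 / 4) : ℝ) := tsum_nonneg fun m => by positivity
    positivity
  have hη0 : 0 < η := l2.trans_le hη
  have h1 : ∀ m ∈ Icc 1 M, Lc η (m ^ 2) * ((m ^ 2 : ℕ) : ℝ) ^ (κ - 1) ≤
      (1 + 8 / log 2) * (m : ℝ) ^ (-(5 / 4) : ℝ) := by
    intro m hm
    have hm1 : 1 ≤ m := (mem_Icc.mp hm).1
    have hm0 : (1 : ℝ) ≤ m := by exact_mod_cast hm1
    have hmp : (0 : ℝ) < m := by linarith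
    have hb : log (m : ℝ) ≤ (m : ℝ) ^ (1 / 4 : ℝ) / (1 / 4) :=
      log_le_rpow_div hmp.le (by norm_num)
    have hq : (1 : ℝ) ≤ (m : ℝ) ^ (1 / 4 : ℝ) := one_le_rpow hm0 (by norm_num)
    have hl : Lc η (m ^ 2) ≤ (1 + 8 / log 2) * (m : ℝ) ^ (1 / 4 : ℝ) := by
      have h := Lc_le_log hη0 (a := m ^ 2) (by positivity)
      have h' : log ((m ^ 2 : ℕ) : ℝ) / η ≤ 8 * (m : ℝ) ^ (1 / 4 : ℝ) / log 2 := by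
        push_cast
        rw [log_pow]
        refine div_le_div₀ (by positivity) ?_ l2 hη
        push_cast; linarith
      have e : (1 + 8 / log 2) * (m : ℝ) ^ (1 / 4 : ℝ) =
        (m : ℝ) ^ (1 / 4 : ℝ) + 8 * (m : ℝ) ^ (1 / 4 : ℝ) / log 2 := by ring
      linarith
    have hw : ((m ^ 2 : ℕ) : ℝ) ^ (κ - 1) ≤ (m : ℝ) ^ (-(3 / 2) : ℝ) := by
      push_cast
      rw [← rpow_natCast, ← rpow_mul hmp.le]
      exact rpow_le_rpow_of_exponent_le hm0 (by push_cast; linarith)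
    calc Lc η (m ^ 2) * ((m ^ 2 : ℕ) : ℝ) ^ (κ - 1) ≤
        ((1 + 8 / log 2) * (m : ℝ) ^ (1 / 4 : ℝ)) * (m : ℝ) ^ (-(3 / 2) : ℝ) := by
          gcongr
      _ = _ := by rw [mul_assoc, ← rpow_add hmp]; norm_num
  refine (sum_le_sum h1).trans ?_
  rw [← mul_sum]
  have := hsum.sum_le_tsum (Icc 1 M) fun m _ => by positivity
  exact mul_le_mul_of_nonneg_left (by linarith) (by positivity)

/-- The square root of the largest square divisor of `a`. -/
noncomputable def sqPart (a : ℕ) : ℕ := (Nat.sq_mul_squarefree a).choose_spec.choose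

/-- The squarefree cofactor of the largest square divisor of `a`. -/
noncomputable def sfPart (a : ℕ) : ℕ := (Nat.sq_mul_squarefree a).choose

lemma sqPart_sq_mul_sfPart (a : ℕ) : sqPart a ^ 2 * sfPart a = a ∧ Squarefree (sfPart a) :=
  (Nat.sq_mul_squarefree a).choose_spec.choose_spec

lemma exists_Lc_sum_le : ∃ C : ℝ, 0 < C ∧ ∀ (η t κ : ℝ) (n : ℕ) (A : Finset ℕ),
    log 2 ≤ η → 1 ≤ t → log t ≤ 2 ^ n * η → 0 ≤ κ → κ ≤ 1 / 4 → κ * log t ≤ 1 →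
    (∀ a ∈ A, PB (exp η) t a) →
    ∑ a ∈ A, Lc η a * (a : ℝ) ^ (κ - 1) ≤ C * (2 * exp 1 * log 2) ^ n * ww n := by
  obtain ⟨K, hK, hsq⟩ := exists_Lc_sq_sum
  obtain ⟨C, hC, hsf⟩ := exists_Lc_subset_sum
  have l2 : 0 < log 2 := log_pos (by norm_num)
  refine ⟨2 * K * C, by positivity, fun η t κ n A hη ht hn hκ hκ4 hκt hA => ?_⟩
  have hη0 : 0 < η := l2.trans_le hη
  have hprod : ∀ a, ∏ p ∈ (sfPart a).primeFactors, p = sfPart a := fun a =>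
    Nat.prod_primeFactors_of_squarefree (sqPart_sq_mul_sfPart a).2
  set f : ℕ → ℕ × Finset ℕ := fun a => (sqPart a, (sfPart a).primeFactors) with hf
  have hinj : Set.InjOn f A := by
    intro a _ b _ hab
    simp only [hf, Prod.mk.injEq] at hab
    rw [← (sqPart_sq_mul_sfPart a).1, ← (sqPart_sq_mul_sfPart b).1, ← hprod a, ← hprod b, hab.1, hab.2]
  set F : ℕ × Finset ℕ → ℝ := fun u => 2 * ((Lc η (u.1 ^ 2) * ((u.1 ^ 2 : ℕ) : ℝ) ^ (κ - 1)) *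
    (Lc η (∏ p ∈ u.2, p) * ∏ p ∈ u.2, (p : ℝ) ^ (κ - 1))) with hF
  have hF0 : ∀ u, 0 ≤ F u := fun u => by
    have := Lc_nonneg η (u.1 ^ 2); have := Lc_nonneg η (∏ p ∈ u.2, p)
    have : 0 ≤ ∏ p ∈ u.2, (p : ℝ) ^ (κ - 1) := prod_nonneg fun p _ => by positivity
    positivity
  have h1 : ∀ a ∈ A, Lc η a * (a : ℝ) ^ (κ - 1) ≤ F (f a) := by
    intro a ha
    obtain ⟨e, hs⟩ := sqPart_sq_mul_sfPart a
    have ha0 := (hA a ha).1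
    have n1 : sqPart a ^ 2 ≠ 0 := fun h => ha0 (by rw [← e, h, zero_mul])
    have n2 : sfPart a ≠ 0 := fun h => ha0 (by rw [← e, h, mul_zero])
    have h := Lc_mul_le hη0 n1 n2
    have hw : (a : ℝ) ^ (κ - 1) = ((sqPart a ^ 2 : ℕ) : ℝ) ^ (κ - 1) *
        ∏ p ∈ (sfPart a).primeFactors, (p : ℝ) ^ (κ - 1) := by
      conv_lhs => rw [← e]
      rw [Nat.cast_mul, mul_rpow (by positivity) (by positivity)]
      congr 1
      rw [finsetProd_rpow _ _ fun p _ => by positivity, ← Nat.cast_prod, hprod]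
    have hw0 : 0 ≤ (a : ℝ) ^ (κ - 1) := by positivity
    rw [e] at h
    calc Lc η a * (a : ℝ) ^ (κ - 1) ≤ (2 * Lc η (sqPart a ^ 2) * Lc η (sfPart a)) * (a : ℝ) ^ (κ - 1) :=
          mul_le_mul_of_nonneg_right h hw0
      _ = _ := by simp only [hF, hf]; rw [hw, hprod]; ring
  have hmap : A.image f ⊆ Icc 1 (A.sup id) ×ˢ (pI (exp η) t).powerset := by
    intro u hu
    obtain ⟨a, ha, rfl⟩ := mem_image.mp hu
    obtain ⟨e, hs⟩ := sqPart_sq_mul_sfPart a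
    have ha0 := (hA a ha).1
    have n1 : sqPart a ≠ 0 := fun h => ha0 (by rw [← e, h]; simp)
    simp only [hf, mem_product, mem_Icc, mem_powerset]
    refine ⟨⟨Nat.one_le_iff_ne_zero.mpr n1, ?_⟩, fun p hp => ?_⟩
    · have h2 : sqPart a ∣ a := by
        conv_rhs => rw [← e]
        exact (dvd_pow_self _ two_ne_zero).mul_right _
      exact (Nat.le_of_dvd (Nat.pos_of_ne_zero ha0) h2).trans (le_sup (f := id) ha)
    · have hp' := Nat.mem_primeFactors.mp hp
      have h2 : p ∣ a := by
        rw [← e]; exact hp'.2.1.mul_left _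
      exact (mem_pI (exp_pos η).le).mpr ⟨hp'.1, (hA a ha).2 p hp'.1 h2⟩
  calc ∑ a ∈ A, Lc η a * (a : ℝ) ^ (κ - 1) ≤ ∑ a ∈ A, F (f a) := sum_le_sum h1
    _ = ∑ u ∈ A.image f, F u := (sum_image hinj).symm
    _ ≤ ∑ u ∈ Icc 1 (A.sup id) ×ˢ (pI (exp η) t).powerset, F u :=
        sum_le_sum_of_subset_of_nonneg hmap fun u _ _ => hF0 u
    _ = 2 * ((∑ m ∈ Icc 1 (A.sup id), Lc η (m ^ 2) * ((m ^ 2 : ℕ) : ℝ) ^ (κ - 1)) *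
        ∑ P ∈ (pI (exp η) t).powerset, Lc η (∏ p ∈ P, p) * ∏ p ∈ P, (p : ℝ) ^ (κ - 1)) := by
        rw [sum_mul_sum, sum_product, mul_sum]
        refine sum_congr rfl fun m _ => ?_
        rw [mul_sum]
    _ ≤ 2 * (K * (C * (2 * exp 1 * log 2) ^ n * ww n)) := by
        have hp : 0 ≤ ∑ P ∈ (pI (exp η) t).powerset, Lc η (∏ p ∈ P, p) * ∏ p ∈ P, (p : ℝ) ^ (κ - 1) :=
          sum_nonneg fun P _ => mul_nonneg (Lc_nonneg _ _) (prod_nonneg fun p _ => by positivity)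
        have := mul_le_mul (hsq η κ (A.sup id) hη hκ4) (hsf η t κ n hη ht hn hκ hκt) hp hK.le
        linarith
    _ = _ := by ring

lemma exists_split (P : ℕ → Prop) {a : ℕ} (ha : a ≠ 0) : ∃ b c, b * c = a ∧
    (∀ p : ℕ, p.Prime → p ∣ b → P p) ∧ (∀ p : ℕ, p.Prime → p ∣ c → ¬ P p) := by
  induction a using induction_on_primes with
  | zero => exact absurd rfl ha
  | one => exact ⟨1, 1, rfl, fun p hp h => absurd (Nat.dvd_one.mp h) hp.ne_one,
      fun p hp h => absurd (Nat.dvd_one.mp h) hp.ne_one⟩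
  | prime_mul p a hp ih =>
    obtain ⟨b, c, e, hb, hc⟩ := ih (right_ne_zero_of_mul ha)
    by_cases h : P p
    · refine ⟨p * b, c, by rw [mul_assoc, e], fun q hq hd => ?_, hc⟩
      rcases (Nat.Prime.dvd_mul hq).mp hd with h1 | h1
      · rwa [(Nat.prime_dvd_prime_iff_eq hq hp).mp h1]
      · exact hb q hq h1
    · refine ⟨b, p * c, by rw [mul_left_comm, e], hb, fun q hq hd => ?_⟩
      rcases (Nat.Prime.dvd_mul hq).mp hd with h1 | h1
      · rwa [(Nat.prime_dvd_prime_iff_eq hq hp).mp h1]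
      · exact hc q hq h1

lemma exists_Lc_sum_low : ∃ C : ℝ, 0 < C ∧ ∀ (η Y t κ : ℝ) (n : ℕ) (A : Finset ℕ),
    log 2 ≤ η → 2 ≤ Y → Y ≤ t → Y ≤ exp η → log t ≤ 2 ^ n * η → 0 ≤ κ → κ ≤ 1 / 8 →
    κ * log t ≤ 1 / 2 → (∀ a ∈ A, PB Y t a) →
    ∑ a ∈ A, Lc η a * (a : ℝ) ^ (κ - 1) ≤ C * (η / log Y) * (2 * exp 1 * log 2) ^ n * ww n := by
  obtain ⟨C₁, hC₁, hG⟩ := exists_Lc_sum_le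
  obtain ⟨C₂, hC₂, hE⟩ := exists_euler_le
  have l2 : 0 < log 2 := log_pos (by norm_num)
  refine ⟨24 * C₂ * C₁, by positivity, fun η Y t κ n A hη hY hYt hYE hn hκ hκ8 hκt hA => ?_⟩
  have hη0 : 0 < η := l2.trans_le hη
  have hlY : 0 < log Y := log_pos (by linarith)
  choose! f g hfg hf hg using fun a (ha : a ∈ A) => exists_split (fun p => (p : ℝ) ≤ exp η) (hA a ha).1
  set κ' := κ + 1 / (12 * η) with hκ'
  have hinj : Set.InjOn (fun a => (f a, g a)) A := by
    intro a ha b hb hab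
    simp only [Prod.mk.injEq] at hab
    rw [← hfg a ha, ← hfg b hb, hab.1, hab.2]
  have hf0 : ∀ a ∈ A, f a ≠ 0 := fun a ha h => (hA a ha).1 (by rw [← hfg a ha, h, zero_mul])
  have hg0 : ∀ a ∈ A, g a ≠ 0 := fun a ha h => (hA a ha).1 (by rw [← hfg a ha, h, mul_zero])
  have h1 : ∀ a ∈ A, Lc η a * (a : ℝ) ^ (κ - 1) ≤
      24 * ((f a : ℝ) ^ (κ' - 1) * (Lc η (g a) * (g a : ℝ) ^ (κ - 1))) := by
    intro a ha
    have hfp : (0 : ℝ) < f a := by exact_mod_cast Nat.pos_of_ne_zero (hf0 a ha)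
    have h2 := Lc_mul_le hη0 (hf0 a ha) (hg0 a ha)
    have h3 := Lc_le_log hη0 (hf0 a ha)
    have h4 : 1 + log (f a) / η ≤ 12 * (f a : ℝ) ^ (1 / (12 * η)) := by
      have e : (f a : ℝ) ^ (1 / (12 * η)) = exp (log (f a) / η / 12) := by
        rw [rpow_def_of_pos hfp]; congr 1; field_simp
      rw [e]
      have := add_one_le_exp (log (f a) / η / 12)
      linarith
    have h5 : Lc η a ≤ 24 * (f a : ℝ) ^ (1 / (12 * η)) * Lc η (g a) := by
      rw [hfg a ha] at h2
      have := mul_le_mul_of_nonneg_right (h3.trans h4) (Lc_nonneg η (g a))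
      linarith
    have e : (a : ℝ) ^ (κ - 1) = (f a : ℝ) ^ (κ - 1) * (g a : ℝ) ^ (κ - 1) := by
      rw [← mul_rpow (by positivity) (by positivity), ← Nat.cast_mul, hfg a ha]
    have e2 : (f a : ℝ) ^ (κ' - 1) = (f a : ℝ) ^ (1 / (12 * η)) * (f a : ℝ) ^ (κ - 1) := by
      rw [← rpow_add hfp]; congr 1; rw [hκ']; ring
    have hw0 : 0 ≤ (a : ℝ) ^ (κ - 1) := by positivity
    refine (mul_le_mul_of_nonneg_right h5 hw0).trans (le_of_eq ?_)
    rw [e, e2]; ring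
  set t' := min (exp η) t with ht'
  have hYt' : Y ≤ t' := le_min hYE hYt
  have ht'0 : 0 < t' := by linarith
  have hl1 : log t' ≤ η := by
    have := log_le_log ht'0 (min_le_left (exp η) t)
    rwa [log_exp] at this
  have hl2 : log t' ≤ log t := log_le_log ht'0 (min_le_right _ _)
  have hη1 : 1 / (12 * η) ≤ 1 / 8 := by
    refine one_div_le_one_div_of_le (by norm_num) ?_
    have := log_two_gt_d9
    linarith
  have hη2 : 1 / (12 * η) * log t' ≤ 1 / 2 := by
    calc 1 / (12 * η) * log t' ≤ 1 / (12 * η) * η := by gcongr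
      _ = 1 / 12 := by field_simp
      _ ≤ 1 / 2 := by norm_num
  have hκ'0 : 0 ≤ κ' := by positivity
  have hFsum := hE Y t' κ' (A.image f) hY hYt' hκ'0 (by linarith)
    (by
      rw [hκ', add_mul]
      have := mul_le_mul_of_nonneg_left hl2 hκ
      linarith)
    (by
      intro b hb
      obtain ⟨a, ha, rfl⟩ := mem_image.mp hb
      refine ⟨hf0 a ha, fun p hp hd => ?_⟩
      have hpa := (hA a ha).2 p hp (by rw [← hfg a ha]; exact hd.mul_right _)
      exact ⟨hpa.1, le_min (hf a ha p hp hd) hpa.2⟩)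
  have hGsum := hG η t κ n (A.image g) hη (by linarith) hn hκ (by linarith) (by linarith)
    (by
      intro b hb
      obtain ⟨a, ha, rfl⟩ := mem_image.mp hb
      refine ⟨hg0 a ha, fun p hp hd => ?_⟩
      have hpa := (hA a ha).2 p hp (by rw [← hfg a ha]; exact hd.mul_left _)
      exact ⟨not_le.mp (hg a ha p hp hd), hpa.2⟩)
  have hFsum' : ∑ b ∈ A.image f, (b : ℝ) ^ (κ' - 1) ≤ C₂ * (η / log Y) :=
    hFsum.trans (by gcongr)
  have hG0 : 0 ≤ ∑ c ∈ A.image g, Lc η c * (c : ℝ) ^ (κ - 1) :=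
    sum_nonneg fun c _ => mul_nonneg (Lc_nonneg _ _) (by positivity)
  calc ∑ a ∈ A, Lc η a * (a : ℝ) ^ (κ - 1)
      ≤ ∑ a ∈ A, 24 * ((f a : ℝ) ^ (κ' - 1) * (Lc η (g a) * (g a : ℝ) ^ (κ - 1))) := sum_le_sum h1
    _ = ∑ u ∈ A.image (fun a => (f a, g a)),
        24 * ((u.1 : ℝ) ^ (κ' - 1) * (Lc η u.2 * (u.2 : ℝ) ^ (κ - 1))) := by rw [sum_image hinj]
    _ ≤ ∑ u ∈ A.image f ×ˢ A.image g,
        24 * ((u.1 : ℝ) ^ (κ' - 1) * (Lc η u.2 * (u.2 : ℝ) ^ (κ - 1))) := by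
        refine sum_le_sum_of_subset_of_nonneg ?_ fun u _ _ => ?_
        · intro u hu
          obtain ⟨a, ha, rfl⟩ := mem_image.mp hu
          exact mem_product.mpr ⟨mem_image_of_mem _ ha, mem_image_of_mem _ ha⟩
        · have := Lc_nonneg η u.2; positivity
    _ = 24 * ((∑ b ∈ A.image f, (b : ℝ) ^ (κ' - 1)) *
        ∑ c ∈ A.image g, Lc η c * (c : ℝ) ^ (κ - 1)) := by
        rw [sum_mul_sum, sum_product, mul_sum]
        refine sum_congr rfl fun m _ => ?_
        rw [mul_sum]
    _ ≤ 24 * (C₂ * (η / log Y) * (C₁ * (2 * exp 1 * log 2) ^ n * ww n)) := by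
        have := mul_le_mul hFsum' hGsum hG0 (by positivity)
        linarith
    _ = _ := by ring

lemma exists_prod_lower : ∃ c : ℝ, 0 < c ∧ ∀ x y κ : ℝ, 2 ≤ x → x ≤ y → 0 ≤ κ →
    c * (log y / log x) ≤ ∑ B ∈ (pI x y).powerset, ∏ p ∈ B, (p : ℝ) ^ (κ - 1) := by
  obtain ⟨C, hC, hM⟩ := exists_mertens_second
  have l2 : 0 < log 2 := log_pos (by norm_num)
  set K := ∑' n : ℕ, 1 / (n : ℝ) ^ 2 with hK
  refine ⟨exp (-(C / log 2 + K)), exp_pos _, fun x y κ hx hxy hκ => ?_⟩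
  have hlx : log 2 ≤ log x := log_le_log (by norm_num) hx
  have hly : log 2 ≤ log y := log_le_log (by norm_num) (hx.trans hxy)
  have hsum : Summable fun n : ℕ => 1 / (n : ℝ) ^ 2 := Real.summable_one_div_nat_pow.mpr (by norm_num)
  have h1 := (abs_le.mp (hM x y hx hxy)).1
  have h2 := hsum.sum_le_tsum (pI x y) fun n _ => by positivity
  have h3 : C / log x ≤ C / log 2 := by gcongr
  rw [← prod_one_add]
  have h4 : ∏ p ∈ pI x y, exp (1 / (p : ℝ) - 1 / (p : ℝ) ^ 2) ≤
      ∏ p ∈ pI x y, (1 + (p : ℝ) ^ (κ - 1)) := by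
    refine prod_le_prod (fun p _ => (exp_pos _).le) fun p hp => ?_
    have hp := (mem_pI (by linarith)).mp hp
    have hp1 : (1 : ℝ) ≤ p := by exact_mod_cast hp.1.one_lt.le
    have e1 : 1 / (p : ℝ) ≤ (p : ℝ) ^ (κ - 1) := by
      rw [one_div, ← rpow_neg_one]
      exact rpow_le_rpow_of_exponent_le hp1 (by linarith)
    have e2 : exp (1 / (p : ℝ) - 1 / (p : ℝ) ^ 2) ≤ 1 + 1 / (p : ℝ) := by
      set u := 1 / (p : ℝ) with hu
      have hu0 : 0 < u := by positivity
      have hu2 : 1 / (p : ℝ) ^ 2 = u ^ 2 := by rw [hu]; ring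
      have := one_sub_inv_le_log_of_pos (show 0 < 1 + u by linarith)
      have h5 : u - u ^ 2 ≤ 1 - (1 + u)⁻¹ := by
        have e3 : 1 - (1 + u)⁻¹ = u / (1 + u) := by field_simp; ring
        rw [e3, le_div_iff₀ (by linarith)]
        nlinarith [pow_pos hu0 3]
      rw [hu2, ← le_log_iff_exp_le (by linarith)]
      linarith
    linarith
  refine le_trans ?_ h4
  rw [← exp_sum]
  have h5 : 0 < log y / log x := div_pos (by linarith) (by linarith)
  conv_lhs => rw [← exp_log h5, ← exp_add]
  refine exp_le_exp.mpr ?_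
  rw [sum_sub_distrib]
  unfold pI at h2 ⊢
  linarith

lemma exists_Lc_sum_high : ∃ C : ℝ, 0 < C ∧ ∀ (η Y t κ : ℝ) (n : ℕ) (A : Finset ℕ),
    log 2 ≤ η → Y ≤ t → exp η ≤ Y → log t ≤ 2 ^ n * η → 0 ≤ κ → κ ≤ 1 / 8 →
    κ * log t ≤ 1 / 2 → (∀ a ∈ A, PB Y t a) →
    ∑ a ∈ A, Lc η a * (a : ℝ) ^ (κ - 1) ≤ C * (η / log Y) * (2 * exp 1 * log 2) ^ n * ww n := by
  obtain ⟨C₁, hC₁, hG⟩ := exists_Lc_sum_le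
  obtain ⟨c, hc, hE⟩ := exists_prod_lower
  have l2 : 0 < log 2 := log_pos (by norm_num)
  refine ⟨C₁ / c, by positivity, fun η Y t κ n A hη hYt hEY hn hκ hκ8 hκt hA => ?_⟩
  have hη0 : 0 < η := l2.trans_le hη
  have hE2 := two_le_exp hη
  have hlY : 0 < log Y := log_pos (by linarith)
  set Q := (pI (exp η) Y).powerset with hQ
  have hBp : ∀ B ∈ Q, ∀ p ∈ B, p.Prime ∧ exp η < p ∧ (p : ℝ) ≤ Y := fun B hB p hp =>
    (mem_pI (by linarith)).mp (mem_powerset.mp hB hp)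
  have hdvd : ∀ B ∈ Q, ∀ q : ℕ, q.Prime → q ∣ ∏ p ∈ B, p → q ∈ B := by
    intro B hB q hq hd
    obtain ⟨p, hp, hqp⟩ := (Prime.dvd_finsetProd_iff hq.prime _).mp hd
    rwa [(Nat.prime_dvd_prime_iff_eq hq (hBp B hB p hp).1).mp hqp]
  have hB0 : ∀ B ∈ Q, ∏ p ∈ B, p ≠ 0 := fun B hB =>
    prod_ne_zero_iff.mpr fun p hp => (hBp B hB p hp).1.ne_zero
  have hmem : ∀ a ∈ A, ∀ B ∈ Q, ∀ q, q ∈ B ↔ q.Prime ∧ q ∣ a * ∏ p ∈ B, p ∧ (q : ℝ) ≤ Y := by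
    intro a ha B hB q
    constructor
    · intro h
      exact ⟨(hBp B hB q h).1, (dvd_prod_of_mem _ h).mul_left _, (hBp B hB q h).2.2⟩
    · rintro ⟨hq, hd, hqY⟩
      rcases (Nat.Prime.dvd_mul hq).mp hd with h | h
      · linarith [((hA a ha).2 q hq h).1]
      · exact hdvd B hB q hq h
  have hinj : Set.InjOn (fun u : ℕ × Finset ℕ => u.1 * ∏ p ∈ u.2, p) (A ×ˢ Q : Finset _) := by
    rintro ⟨a, B⟩ h1 ⟨a', B'⟩ h2 h
    obtain ⟨ha, hB⟩ := mem_product.mp (mem_coe.mp h1)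
    obtain ⟨ha', hB'⟩ := mem_product.mp (mem_coe.mp h2)
    dsimp only at h ha hB ha' hB'
    have e : B = B' := by
      ext q
      rw [hmem a ha B hB, hmem a' ha' B' hB', h]
    subst e
    have := Nat.eq_of_mul_eq_mul_right (Nat.pos_of_ne_zero (hB0 B hB)) h
    rw [this]
  have h1 := hG η t κ n ((A ×ˢ Q).image fun u => u.1 * ∏ p ∈ u.2, p) hη (by linarith) hn hκ
    (by linarith) (by linarith) (by
      intro b hb
      obtain ⟨⟨a, B⟩, hu, rfl⟩ := mem_image.mp hb
      obtain ⟨ha, hB⟩ := mem_product.mp hu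
      refine ⟨mul_ne_zero (hA a ha).1 (hB0 B hB), fun q hq hd => ?_⟩
      rcases (Nat.Prime.dvd_mul hq).mp hd with h | h
      · have := (hA a ha).2 q hq h; exact ⟨by linarith, this.2⟩
      · have := hBp B hB q (hdvd B hB q hq h); exact ⟨this.2.1, this.2.2.trans hYt⟩)
  rw [sum_image hinj, sum_product] at h1
  have h2 : (∑ a ∈ A, Lc η a * (a : ℝ) ^ (κ - 1)) * ∑ B ∈ Q, ∏ p ∈ B, (p : ℝ) ^ (κ - 1) ≤
      ∑ a ∈ A, ∑ B ∈ Q, Lc η (a * ∏ p ∈ B, p) * ((a * ∏ p ∈ B, p : ℕ) : ℝ) ^ (κ - 1) := by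
    rw [sum_mul_sum]
    refine sum_le_sum fun a ha => sum_le_sum fun B hB => ?_
    rw [Nat.cast_mul, mul_rpow (by positivity) (by positivity), Nat.cast_prod,
      ← finsetProd_rpow _ _ fun p _ => by positivity, mul_assoc]
    exact mul_le_mul_of_nonneg_right (Lc_le_of_dvd (dvd_mul_right _ _)
      (mul_ne_zero (hA a ha).1 (hB0 B hB))) (mul_nonneg (by positivity)
        (prod_nonneg fun p _ => by positivity))
  have h3 := hE (exp η) Y κ hE2 hEY hκ
  rw [log_exp] at h3
  set S := ∑ a ∈ A, Lc η a * (a : ℝ) ^ (κ - 1) with hS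
  have hS0 : 0 ≤ S := sum_nonneg fun c _ => mul_nonneg (Lc_nonneg _ _) (by positivity)
  have h4 := (mul_le_mul_of_nonneg_left h3 hS0).trans (h2.trans h1)
  have e : C₁ / c * (η / log Y) * (2 * exp 1 * log 2) ^ n * ww n =
      (C₁ * (2 * exp 1 * log 2) ^ n * ww n) / (c * (log Y / η)) := by field_simp
  rw [e, le_div_iff₀ (by positivity)]
  exact h4

/-- The weighted sum of `Lc η a` over integers with all prime factors in `(Y, t]`. -/
lemma exists_Lc_sum : ∃ C : ℝ, 0 < C ∧ ∀ (η Y t κ : ℝ) (n : ℕ) (A : Finset ℕ),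
    log 2 ≤ η → 2 ≤ Y → Y ≤ t → log t ≤ 2 ^ n * η → 0 ≤ κ → κ ≤ 1 / 8 →
    κ * log t ≤ 1 / 2 → (∀ a ∈ A, PB Y t a) →
    ∑ a ∈ A, Lc η a * (a : ℝ) ^ (κ - 1) ≤ C * (η / log Y) * (2 * exp 1 * log 2) ^ n * ww n := by
  obtain ⟨C₁, hC₁, h1⟩ := exists_Lc_sum_low
  obtain ⟨C₂, hC₂, h2⟩ := exists_Lc_sum_high
  have l2 : 0 < log 2 := log_pos (by norm_num)
  refine ⟨C₁ + C₂, by positivity, fun η Y t κ n A hη hY hYt hn hκ hκ8 hκt hA => ?_⟩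
  have hη0 : 0 < η := l2.trans_le hη
  have hlY : 0 < log Y := log_pos (by linarith)
  have hw := ww_pos n
  have e : (C₁ + C₂) * (η / log Y) * (2 * exp 1 * log 2) ^ n * ww n =
      C₁ * (η / log Y) * (2 * exp 1 * log 2) ^ n * ww n +
      C₂ * (η / log Y) * (2 * exp 1 * log 2) ^ n * ww n := by ring
  have p1 : 0 ≤ C₁ * (η / log Y) * (2 * exp 1 * log 2) ^ n * ww n := by positivity
  have p2 : 0 ≤ C₂ * (η / log Y) * (2 * exp 1 * log 2) ^ n * ww n := by positivity
  rw [e]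
  rcases le_total Y (exp η) with h | h
  · have := h1 η Y t κ n A hη hY hYt h hn hκ hκ8 hκt hA; linarith
  · have := h2 η Y t κ n A hη hYt h hn hκ hκ8 hκt hA; linarith

lemma exists_level {V l : ℝ} (hV : 0 < V) (hl : 0 < l) (h : l ≤ 2 * V) :
    ∃ j : ℕ, V / 2 ^ j < l ∧ l ≤ 2 * V / 2 ^ j := by
  have hex : ∃ j : ℕ, V / 2 ^ j < l := by
    obtain ⟨j, hj⟩ := pow_unbounded_of_one_lt (V / l) (one_lt_two (α := ℝ))
    refine ⟨j, ?_⟩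
    rw [div_lt_iff₀ hl] at hj
    rw [div_lt_iff₀ (by positivity)]
    linarith
  classical
  refine ⟨Nat.find hex, Nat.find_spec hex, ?_⟩
  rcases hj : Nat.find hex with _ | j
  · simpa using h
  · have := Nat.find_min hex (m := j) (by omega)
    rw [not_lt] at this
    refine this.trans (le_of_eq ?_)
    rw [pow_succ]; field_simp

lemma four_pow_mul_exp_le (j : ℕ) :
    (4 : ℝ) ^ j * exp (-(2 ^ j / 64)) ≤ 6 * 64 ^ 3 * (1 / 2) ^ j := by
  have hx : (0 : ℝ) < 2 ^ j := by positivity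
  have h := Real.pow_div_factorial_le_exp ((2 : ℝ) ^ j / 64) (by positivity) 3
  have e : ((2 : ℝ) ^ j / 64) ^ 3 / (Nat.factorial 3 : ℕ) = (2 ^ j) ^ 3 / (6 * 64 ^ 3) := by
    norm_num [Nat.factorial]; ring
  rw [e, div_le_iff₀ (by positivity)] at h
  rw [exp_neg, ← div_eq_mul_inv, div_le_iff₀ (exp_pos _)]
  have e4 : (4 : ℝ) ^ j = (2 ^ j) ^ 2 := by rw [← pow_mul, mul_comm, pow_mul]; norm_num
  have eh : ((1 : ℝ) / 2) ^ j = 1 / 2 ^ j := by rw [div_pow, one_pow]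
  rw [e4, eh]
  have : 6 * 64 ^ 3 * (1 / (2 : ℝ) ^ j) * exp (2 ^ j / 64) =
    (exp (2 ^ j / 64) * (6 * 64 ^ 3)) / 2 ^ j := by ring
  rw [this, le_div_iff₀ hx]
  linarith

lemma exists_weighted_sum : ∃ C : ℝ, 0 < C ∧ ∀ (η Y V : ℝ) (n : ℕ) (A : Finset ℕ) (y₀ : ℕ → ℝ),
    log 2 ≤ η → 2 ≤ Y → 0 < V → 2 * V ≤ 2 ^ n * η →
    (∀ a ∈ A, Y ≤ y₀ a ∧ log (y₀ a) ≤ 2 * V ∧ V ≤ log a + log (y₀ a) ∧ PB Y (y₀ a) a) →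
    ∑ a ∈ A, Lc η a / (a * log (y₀ a) ^ 2) ≤
      C * (η / (V ^ 2 * log Y)) * (2 * exp 1 * log 2) ^ n * ww n := by
  obtain ⟨C, hC, hG⟩ := exists_Lc_sum
  have l2 : 0 < log 2 := log_pos (by norm_num)
  have l2' := log_two_gt_d9
  refine ⟨exp (1 / 32) * C * (6 * 64 ^ 3 * 2), by positivity, fun η Y V n A y₀ hη hY hV hn hA => ?_⟩
  have hη0 : 0 < η := l2.trans_le hη
  have hlY : log 2 ≤ log Y := log_le_log (by norm_num) hY
  have hw := ww_pos n
  have hly : ∀ a ∈ A, log Y ≤ log (y₀ a) := fun a ha => log_le_log (by linarith) (hA a ha).1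
  choose! J hJ1 hJ2 using fun a (ha : a ∈ A) =>
    exists_level hV (l2.trans_le (hlY.trans (hly a ha))) (hA a ha).2.1
  set M := A.sup J + 1 with hM
  have hmaps : ∀ a ∈ A, J a ∈ range M := fun a ha => mem_range.mpr (Nat.lt_succ_of_le (le_sup ha))
  set G := C * (η / log Y) * (2 * exp 1 * log 2) ^ n * ww n with hGd
  have hG0 : 0 ≤ G := by
    have : 0 < log Y := by linarith
    positivity
  have hlev : ∀ j ∈ range M, ∑ a ∈ A.filter (fun a => J a = j), Lc η a / (a * log (y₀ a) ^ 2) ≤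
      exp (1 / 32) / V ^ 2 * G * (6 * 64 ^ 3) * (1 / 2) ^ j := by
    intro j _
    rcases (A.filter fun a => J a = j).eq_empty_or_nonempty with he | ⟨a₀, hf₀⟩
    · rw [he, sum_empty]; positivity
    obtain ⟨ha₀, rfl⟩ := mem_filter.mp hf₀
    set j := J a₀ with hj
    set T := 2 * V / 2 ^ j with hT
    have hT0 : 0 < T := by positivity
    have hTY : log Y ≤ T := (hly a₀ ha₀).trans (hJ2 a₀ ha₀)
    have hYT : Y ≤ exp T := (log_le_iff_le_exp (by linarith)).mp hTY
    set κ := 1 / (16 * T) with hκ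
    have hκ0 : 0 < κ := by positivity
    have hκT : κ * T = 1 / 16 := by rw [hκ]; field_simp
    have hκ8 : κ ≤ 1 / 8 := by
      refine one_div_le_one_div_of_le (by norm_num) ?_
      linarith
    have hκV : κ * V = 2 ^ j / 32 := by rw [hκ, hT]; field_simp; norm_num
    have hsum := hG η Y (exp T) κ n (A.filter fun a => J a = j) hη hY hYT (by
        rw [log_exp]
        refine (div_le_self (by positivity) (one_le_pow₀ (by norm_num))).trans hn)
      hκ0.le hκ8 (by rw [log_exp, hκT]; norm_num) (by
        intro a ha
        obtain ⟨ha, hja⟩ := mem_filter.mp ha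
        obtain ⟨h1, h2, h3, h4⟩ := hA a ha
        refine ⟨h4.1, fun p hp hd => ⟨(h4.2 p hp hd).1, (h4.2 p hp hd).2.trans ?_⟩⟩
        refine (log_le_iff_le_exp (by linarith)).mp ?_
        rw [hT, ← hja]; exact hJ2 a ha)
    have hterm : ∀ a ∈ A.filter (fun a => J a = j), Lc η a / (a * log (y₀ a) ^ 2) ≤
        (exp (1 / 32) / V ^ 2 * (4 ^ j * exp (-(2 ^ j / 64)))) * (Lc η a * (a : ℝ) ^ (κ - 1)) := by
      intro a ha
      obtain ⟨ha, hja⟩ := mem_filter.mp ha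
      obtain ⟨h1, h2, h3, h4⟩ := hA a ha
      have ha0 : (0 : ℝ) < a := by exact_mod_cast Nat.pos_of_ne_zero h4.1
      have hla : 0 ≤ log (a : ℝ) := log_natCast_nonneg a
      have k1 := hJ1 a ha
      have k2 := hJ2 a ha
      rw [hja] at k1 k2
      have hs : (V / 2 ^ j) ^ 2 ≤ log (y₀ a) ^ 2 := pow_le_pow_left₀ (by positivity) k1.le 2
      have hinv : 1 / log (y₀ a) ^ 2 ≤ 4 ^ j / V ^ 2 := by
        have e4 : (4 : ℝ) ^ j / V ^ 2 = 1 / (V / 2 ^ j) ^ 2 := by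
          have e4 : (4 : ℝ) ^ j = (2 ^ j) ^ 2 := by rw [← pow_mul, mul_comm, pow_mul]; norm_num
          rw [e4]; field_simp
        rw [e4]
        exact one_div_le_one_div_of_le (by positivity) hs
      have hgain : 1 ≤ exp (1 / 32) * exp (-(2 ^ j / 64)) * (a : ℝ) ^ κ := by
        rw [rpow_def_of_pos ha0, ← exp_add, ← exp_add, one_le_exp_iff]
        rcases lt_or_ge j 2 with hj2 | hj2
        · have : (2 : ℝ) ^ j ≤ 2 ^ 1 := pow_le_pow_right₀ (by norm_num) (by omega)
          have : 0 ≤ log (a : ℝ) * κ := by positivity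
          linarith
        · have : T ≤ V / 2 := by
            rw [hT, div_le_div_iff₀ (by positivity) (by norm_num)]
            have : (2 : ℝ) ^ 2 ≤ 2 ^ j := pow_le_pow_right₀ (by norm_num) hj2
            nlinarith
          have h5 : κ * (V / 2) ≤ κ * log (a : ℝ) :=
            mul_le_mul_of_nonneg_left (by linarith) hκ0.le
          linarith
      have hinva : 1 / (a : ℝ) ≤ exp (1 / 32) * exp (-(2 ^ j / 64)) * (a : ℝ) ^ (κ - 1) := by
        rw [rpow_sub_one ha0.ne', ← mul_div_assoc]
        exact div_le_div_of_nonneg_right hgain ha0.le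
      have hL := Lc_nonneg η a
      calc Lc η a / (a * log (y₀ a) ^ 2) = Lc η a * ((1 / (a : ℝ)) * (1 / log (y₀ a) ^ 2)) := by
            rw [one_div_mul_one_div, mul_one_div]
        _ ≤ Lc η a * ((exp (1 / 32) * exp (-(2 ^ j / 64)) * (a : ℝ) ^ (κ - 1)) * (4 ^ j / V ^ 2)) := by
            gcongr
        _ = _ := by ring
    refine (sum_le_sum hterm).trans ?_
    rw [← mul_sum]
    calc _ ≤ (exp (1 / 32) / V ^ 2 * (6 * 64 ^ 3 * (1 / 2) ^ j)) * G := by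
          refine mul_le_mul (mul_le_mul_of_nonneg_left (four_pow_mul_exp_le j) (by positivity)) hsum
            (sum_nonneg fun a _ => mul_nonneg (Lc_nonneg _ _) (by positivity)) (by positivity)
      _ = _ := by ring
  rw [← sum_fiberwise_of_maps_to hmaps]
  refine (sum_le_sum hlev).trans ?_
  rw [← mul_sum]
  calc _ ≤ exp (1 / 32) / V ^ 2 * G * (6 * 64 ^ 3) * 2 :=
        mul_le_mul_of_nonneg_left (sum_half_pow_le M) (by positivity)
    _ = _ := by rw [hGd]; field_simp

/-- The exponent `δ = 1 - (1 + log log 2) / log 2`. -/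
noncomputable def dlt : ℝ := 1 - (1 + log (log 2)) / log 2

lemma dlt_nonneg : 0 ≤ dlt := by
  have l2 : 0 < log 2 := log_pos (by norm_num)
  have := log_le_sub_one_of_pos l2
  unfold dlt
  rw [sub_nonneg, div_le_one l2]; linarith

lemma dlt_le_half : dlt ≤ 1 / 2 := by
  have l2 : 0 < log 2 := log_pos (by norm_num)
  have h1 := one_sub_inv_le_log_of_pos l2
  have h2 := log_two_gt_d9
  have h3 := log_two_lt_d9
  have h4 : (log 2)⁻¹ ≤ 1.45 := by
    rw [inv_le_comm₀ l2 (by norm_num)]; norm_num; linarith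
  have : 1 / 2 ≤ (1 + log (log 2)) / log 2 := by
    rw [le_div_iff₀ l2]; linarith
  unfold dlt; linarith

/-- The target decay `l ^ (-δ) * (1 + log l) ^ (-3/2)`. -/
noncomputable def dec (l : ℝ) : ℝ := l ^ (-dlt) * (1 + log l) ^ (-(3 / 2) : ℝ)

lemma dec_pos {l : ℝ} (hl : 1 ≤ l) : 0 < dec l := by
  have := log_nonneg hl
  unfold dec; positivity

lemma exists_level_bound : ∃ C : ℝ, 0 < C ∧ ∀ m : ℝ, 1 ≤ m → ∃ n : ℕ, 2 * m ≤ 2 ^ n ∧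
    (2 * exp 1 * log 2) ^ n * ww n ≤ C * m ^ 2 * dec m := by
  have l2 : 0 < log 2 := log_pos (by norm_num)
  set R := 2 * exp 1 * log 2 with hR
  have hR0 : 0 < R := by positivity
  have hR1 : 1 ≤ R := by
    have := add_one_le_exp (1 : ℝ)
    have := log_two_gt_d9
    rw [hR]; nlinarith
  refine ⟨R ^ (2 : ℝ), by positivity, fun m hm => ?_⟩
  have hm0 : 0 < m := by linarith
  have hlm := log_nonneg hm
  set v := log m / log 2 with hv
  have hv0 : 0 ≤ v := by positivity
  have hvl : log m ≤ v := by
    rw [hv, le_div_iff₀ l2]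
    have := log_two_lt_d9
    nlinarith
  refine ⟨⌈v⌉₊ + 1, ?_, ?_⟩
  · have : m ≤ 2 ^ ⌈v⌉₊ := by
      have h1 : m = (2 : ℝ) ^ v := by
        rw [rpow_def_of_pos (by norm_num), hv, mul_div_cancel₀ _ l2.ne', exp_log hm0]
      calc m = (2 : ℝ) ^ v := h1
        _ ≤ (2 : ℝ) ^ ((⌈v⌉₊ : ℕ) : ℝ) := rpow_le_rpow_of_exponent_le (by norm_num) (Nat.le_ceil v)
        _ = _ := rpow_natCast _ _
    rw [pow_succ]; linarith
  · have h1 : R ^ (⌈v⌉₊ + 1) ≤ R ^ (2 : ℝ) * (m ^ 2 * m ^ (-dlt)) := by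
      have e : (m ^ 2 * m ^ (-dlt)) = R ^ v := by
        rw [← rpow_natCast, ← rpow_add hm0, rpow_def_of_pos hm0, rpow_def_of_pos hR0]
        congr 1
        rw [hR, log_mul (by positivity) l2.ne', log_mul (by norm_num) (exp_pos _).ne', log_exp, hv, dlt]
        field_simp
        push_cast; ring
      rw [e, ← rpow_add hR0, ← rpow_natCast]
      refine rpow_le_rpow_of_exponent_le hR1 ?_
      have := Nat.ceil_lt_add_one hv0
      push_cast; linarith
    have h2 : ww (⌈v⌉₊ + 1) ≤ (1 + log m) ^ (-(3 / 2) : ℝ) := by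
      unfold ww
      refine rpow_le_rpow_of_nonpos (by linarith) ?_ (by norm_num)
      have := Nat.le_ceil v
      push_cast; linarith
    calc _ ≤ (R ^ (2 : ℝ) * (m ^ 2 * m ^ (-dlt))) * (1 + log m) ^ (-(3 / 2) : ℝ) :=
          mul_le_mul h1 h2 (ww_pos _).le (by positivity)
      _ = _ := by unfold dec; ring

lemma dec_half_le {l m : ℝ} (hl : 2 ≤ l) (hm : l / 2 ≤ m) :
    dec m ≤ 2 * 4 ^ (3 / 2 : ℝ) * dec l := by
  have l2 : 0 < log 2 := log_pos (by norm_num)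
  have hm1 : 1 ≤ m := by linarith
  have hl0 : 0 < l := by linarith
  have h1 : m ^ (-dlt) ≤ 2 * l ^ (-dlt) := by
    calc m ^ (-dlt) ≤ (l / 2) ^ (-dlt) :=
          rpow_le_rpow_of_nonpos (by linarith) hm (by linarith [dlt_nonneg])
      _ = 2 ^ dlt * l ^ (-dlt) := by
          rw [div_rpow hl0.le (by norm_num), rpow_neg (by norm_num : (0:ℝ) ≤ 2), div_inv_eq_mul,
            mul_comm]
      _ ≤ 2 * l ^ (-dlt) := by
          have : (2 : ℝ) ^ dlt ≤ 2 ^ (1 : ℝ) :=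
            rpow_le_rpow_of_exponent_le (by norm_num) (by linarith [dlt_le_half])
          rw [rpow_one] at this
          gcongr
  have h2 : (1 + log m) ^ (-(3 / 2) : ℝ) ≤ 4 ^ (3 / 2 : ℝ) * (1 + log l) ^ (-(3 / 2) : ℝ) := by
    have hll : 0 ≤ log l := log_nonneg (by linarith)
    have h3 : (1 + log l) / 4 ≤ 1 + log m := by
      have h4 := log_le_log (by linarith) hm
      rw [log_div hl0.ne' (by norm_num)] at h4
      have := log_two_lt_d9
      linarith
    calc (1 + log m) ^ (-(3 / 2) : ℝ) ≤ ((1 + log l) / 4) ^ (-(3 / 2) : ℝ) :=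
          rpow_le_rpow_of_nonpos (by linarith) h3 (by norm_num)
      _ = _ := by
          rw [div_rpow (by linarith) (by norm_num), rpow_neg (by norm_num : (0:ℝ) ≤ 4), div_inv_eq_mul,
            mul_comm]
  unfold dec
  calc _ ≤ (2 * l ^ (-dlt)) * (4 ^ (3 / 2 : ℝ) * (1 + log l) ^ (-(3 / 2) : ℝ)) := by
        have : 0 ≤ 1 + log m := by linarith [log_nonneg hm1]
        gcongr
    _ = _ := by ring

lemma inv_le_dec {l : ℝ} (hl : 1 ≤ l) : 1 / l ≤ 4 ^ (3 / 2 : ℝ) * dec l := by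
  have hl0 : 0 < l := by linarith
  have hll := log_nonneg hl
  have h1 : log l ≤ l ^ (1 / 3 : ℝ) / (1 / 3) := log_le_rpow_div hl0.le (by norm_num)
  have h2 : (1 : ℝ) ≤ l ^ (1 / 3 : ℝ) := one_le_rpow hl (by norm_num)
  have h3 : (4 * l ^ (1 / 3 : ℝ)) ^ (-(3 / 2) : ℝ) ≤ (1 + log l) ^ (-(3 / 2) : ℝ) :=
    rpow_le_rpow_of_nonpos (by linarith) (by linarith) (by norm_num)
  rw [mul_rpow (by norm_num) (by positivity), ← rpow_mul hl0.le,
    rpow_neg (by norm_num : (0:ℝ) ≤ 4)] at h3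
  have h4 : l ^ (-(1 / 2) : ℝ) ≤ l ^ (-dlt) :=
    rpow_le_rpow_of_exponent_le hl (by linarith [dlt_le_half])
  have h5 : 1 / l = l ^ (-(1 / 2) : ℝ) * l ^ (1 / 3 * -(3 / 2) : ℝ) := by
    rw [← rpow_add hl0, one_div, ← rpow_neg_one]; norm_num
  have h6 : l ^ (1 / 3 * -(3 / 2) : ℝ) ≤ 4 ^ (3 / 2 : ℝ) * (1 + log l) ^ (-(3 / 2) : ℝ) := by
    rw [inv_mul_le_iff₀ (by positivity)] at h3; exact h3
  rw [h5]
  unfold dec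
  calc _ ≤ l ^ (-dlt) * (4 ^ (3 / 2 : ℝ) * (1 + log l) ^ (-(3 / 2) : ℝ)) := by gcongr
    _ = _ := by ring

lemma exists_sum_lpc_window : ∃ C : ℝ, 0 < C ∧ ∀ (α β : ℝ) (P : Finset ℕ), 0 ≤ β →
    (∀ p ∈ P, α < log p ∧ log p ≤ α + β) → ∑ p ∈ P, lpc p ≤ β + C := by
  obtain ⟨C, hC, hM⟩ := exists_mertens_first
  refine ⟨2 * C, by positivity, fun α β P hβ hP => ?_⟩
  set g := max α 0 with hg
  have hg0 : 0 ≤ g := le_max_right _ _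
  have h1 := (abs_le.mp (hM (exp g) (one_le_exp hg0))).1
  have h2 := (abs_le.mp (hM (exp (g + β)) (one_le_exp (by linarith)))).2
  rw [log_exp] at h1 h2
  suffices h : ∑ p ∈ P, lpc p ≤ Rm (exp (g + β)) - Rm (exp g) by linarith
  have hsplit : Rm (exp (g + β)) - Rm (exp g) = ∑ k ∈ Ioc ⌊exp g⌋₊ ⌊exp (g + β)⌋₊, lpc k := by
    have hle : ⌊exp g⌋₊ ≤ ⌊exp (g + β)⌋₊ := Nat.floor_mono (exp_le_exp.mpr (by linarith))
    have hu : Icc 0 ⌊exp (g + β)⌋₊ = Icc 0 ⌊exp g⌋₊ ∪ Ioc ⌊exp g⌋₊ ⌊exp (g + β)⌋₊ := by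
      ext k; simp only [mem_Icc, mem_union, mem_Ioc]; omega
    have hd : Disjoint (Icc 0 ⌊exp g⌋₊) (Ioc ⌊exp g⌋₊ ⌊exp (g + β)⌋₊) := by
      rw [Finset.disjoint_left]; intro k; simp only [mem_Icc, mem_Ioc]; omega
    unfold Rm
    rw [hu, sum_union hd]; ring
  rw [hsplit]
  have h3 : ∑ p ∈ P, lpc p = ∑ p ∈ P.filter Nat.Prime, lpc p := by
    rw [sum_filter]
    refine sum_congr rfl fun p _ => ?_
    unfold lpc; split_ifs <;> rfl
  rw [h3]
  refine sum_le_sum_of_subset_of_nonneg (fun p hp => ?_) fun k _ _ => lpc_nonneg k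
  obtain ⟨hpP, hp⟩ := mem_filter.mp hp
  obtain ⟨h4, h5⟩ := hP p hpP
  have hp0 : (0 : ℝ) < p := by exact_mod_cast hp.pos
  have hlp : 0 < log (p : ℝ) := log_pos (by exact_mod_cast hp.one_lt)
  rw [mem_Ioc]
  constructor
  · rw [Nat.floor_lt (exp_pos _).le, ← lt_log_iff_exp_lt hp0]
    exact max_lt h4 hlp
  · refine Nat.le_floor ?_
    rw [← log_le_iff_le_exp hp0]
    linarith [le_max_left α 0]

/-- The pairs `(a, p)` for which `p` completes some divisor of `a` to one whose logarithm lies in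
`[V, V + 2 * η]`. -/
def Admissible (η Y V : ℝ) (a p : ℕ) : Prop :=
  p.Prime ∧ Y < p ∧ PB Y p a ∧
    ∃ e : ℕ, e ∣ a ∧ V ≤ log p + log e ∧ log p + log e ≤ V + 2 * η

lemma exists_sum_lpc_admissible : ∃ C : ℝ, 0 < C ∧ ∀ (η Y V : ℝ) (a : ℕ) (P : Finset ℕ),
    log 2 ≤ η → (∀ p ∈ P, Admissible η Y V a p) → ∑ p ∈ P, lpc p ≤ C * η * Lc η a := by
  obtain ⟨C, hC, hW⟩ := exists_sum_lpc_window
  have l2 : 0 < log 2 := log_pos (by norm_num)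
  refine ⟨3 + C / log 2, by positivity, fun η Y V a P hη hP => ?_⟩
  classical
  have hη0 : 0 < η := l2.trans_le hη
  set w : ℕ → ℕ → Prop := fun k p => V - (k + 1) * η < log p ∧ log p ≤ V - (k + 1) * η + 3 * η with hw
  have h1 : ∀ p ∈ P, lpc p ≤ ∑ k ∈ cells η a, if w k p then lpc p else 0 := by
    intro p hp
    obtain ⟨hpp, _, hPB, e, he, h2, h3⟩ := hP p hp
    have hk : ⌊log (e : ℝ) / η⌋₊ ∈ cells η a := (mem_cells hPB.1).mpr ⟨e, he, rfl⟩
    set k := ⌊log (e : ℝ) / η⌋₊ with hkd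
    have f1 := Nat.floor_le (div_nonneg (log_natCast_nonneg e) hη0.le)
    have f2 := Nat.lt_floor_add_one (log (e : ℝ) / η)
    rw [← hkd] at f1 f2
    rw [le_div_iff₀ hη0] at f1
    rw [div_lt_iff₀ hη0] at f2
    have hwk : w k p := ⟨by linarith, by linarith⟩
    calc lpc p = if w k p then lpc p else 0 := by rw [if_pos hwk]
      _ ≤ _ := single_le_sum (f := fun k => if w k p then lpc p else 0)
          (fun i _ => by split_ifs; exacts [lpc_nonneg p, le_rfl]) hk
  refine (sum_le_sum h1).trans ?_
  rw [sum_comm]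
  have h2 : ∀ k ∈ cells η a, ∑ p ∈ P, (if w k p then lpc p else 0) ≤ (3 + C / log 2) * η := by
    intro k _
    rw [← sum_filter]
    have h3 := hW (V - (k + 1) * η) (3 * η) (P.filter (w k)) (by linarith)
      fun p hp => (mem_filter.mp hp).2
    have h4 : C ≤ C / log 2 * η := by
      rw [div_mul_eq_mul_div, le_div_iff₀ l2]
      exact mul_le_mul_of_nonneg_left hη hC.le
    linarith
  have h3 := sum_le_card_nsmul _ _ _ h2
  rw [nsmul_eq_mul] at h3
  unfold Lc; linarith

/-- `n` factors as `a * p * b` with `p` separating the primes of `a` and `b`, and `p` completing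
a divisor of `a`. -/
def Splits3 (η Y V : ℝ) (n : ℕ) : Prop :=
  ∃ a p b : ℕ, n = a * p * b ∧ Admissible η Y V a p ∧ b ≠ 0 ∧ b ≠ 1 ∧
    ∀ q : ℕ, q.Prime → q ∣ b → p ≤ q

lemma exists_count_splits : ∃ C : ℝ, 0 < C ∧ ∀ (η Y V x : ℝ) (T : Finset ℕ),
    log 2 ≤ η → 2 ≤ Y → 2 * η ≤ V → 0 ≤ x → (∀ n ∈ T, (n : ℝ) ≤ x ∧ Splits3 η Y V n) →
    (T.card : ℝ) ≤ C * (x / log Y) * dec (V / η) := by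
  obtain ⟨C₁, hC₁, hS⟩ := exists_sieve
  obtain ⟨C₂, hC₂, hP⟩ := exists_sum_lpc_admissible
  obtain ⟨C₃, hC₃, hW⟩ := exists_weighted_sum
  obtain ⟨C₄, hC₄, hL⟩ := exists_level_bound
  have l2 : 0 < log 2 := log_pos (by norm_num)
  refine ⟨C₁ * C₂ * C₃ * C₄, by positivity, fun η Y V x T hη hY hV hx hT => ?_⟩
  classical
  have hη0 : 0 < η := l2.trans_le hη
  have hV0 : 0 < V := by linarith
  have hlY : 0 < log Y := log_pos (by linarith)
  set P : ℕ → Finset ℕ := fun a => (range (⌊x⌋₊ + 1)).filter (Admissible η Y V a) with hPd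
  set A : Finset ℕ := (range (⌊x⌋₊ + 1)).filter fun a => (P a).Nonempty with hAd
  set S : ℕ → ℕ → Finset ℕ := fun a p => (Sv (x / (a * p)) p).filter (· ≠ 1) with hSd
  have hPa : ∀ a, ∀ p ∈ P a, Admissible η Y V a p := fun a p hp => (mem_filter.mp hp).2
  have hcov : T ⊆ A.biUnion fun a => (P a).biUnion fun p => (S a p).image fun b => a * p * b := by
    intro n hn
    obtain ⟨hnx, a, p, b, rfl, had, hb0, hb1, hb⟩ := hT n hn
    have ha0 := had.2.2.1.1
    have hp0 := had.1.ne_zero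
    have hap : (0 : ℝ) < a * p := by
      have := Nat.pos_of_ne_zero ha0; have := had.1.pos; positivity
    have hle : ∀ m, m ∣ a * p * b → m ∈ range (⌊x⌋₊ + 1) := by
      intro m hm
      rw [mem_range, Nat.lt_succ_iff]
      refine (Nat.le_of_dvd ?_ hm).trans (Nat.le_floor hnx)
      exact Nat.pos_of_ne_zero (mul_ne_zero (mul_ne_zero ha0 hp0) hb0)
    have hp : p ∈ P a := mem_filter.mpr ⟨hle p ⟨a * b, by ring⟩, had⟩
    refine mem_biUnion.mpr ⟨a, mem_filter.mpr ⟨hle a ⟨p * b, by ring⟩, p, hp⟩,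
      mem_biUnion.mpr ⟨p, hp, mem_image_of_mem _ (mem_filter.mpr ⟨mem_Sv.mpr ⟨hb0, ?_, ?_⟩, hb1⟩)⟩⟩
    · rw [le_div_iff₀ hap]
      push_cast at hnx; linarith
    · intro q hq hd; exact_mod_cast hb q hq hd
  have hScard : ∀ a, ∀ p ∈ P a, ((S a p).card : ℝ) ≤ C₁ * (x / a) * (lpc p / log p ^ 2) := by
    intro a p hp
    have had := hPa a p hp
    have hp1 : (2 : ℝ) ≤ p := by exact_mod_cast had.1.two_le
    have hlp : 0 < log (p : ℝ) := log_pos (by linarith)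
    have e : C₁ * (x / a) * (lpc p / log p ^ 2) = C₁ * (x / (a * p) / log p) := by
      have ha0 : (a : ℝ) ≠ 0 := by exact_mod_cast had.2.2.1.1
      unfold lpc
      rw [if_pos had.1]
      field_simp
    rw [e]
    rcases le_or_gt (p : ℝ) (x / (a * p)) with h | h
    · refine le_trans ?_ (hS _ _ hp1 h)
      exact Nat.cast_le.mpr (card_filter_le _ _)
    · have : S a p = ∅ := by
        refine filter_eq_empty_iff.mpr fun b hb hb1 => ?_
        obtain ⟨hb0, hbx, hbp⟩ := mem_Sv.mp hb
        obtain ⟨q, hq, hd⟩ := Nat.exists_prime_and_dvd hb1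
        have h1 := hbp q hq hd
        have h2 : (q : ℝ) ≤ b := by exact_mod_cast Nat.le_of_dvd (Nat.pos_of_ne_zero hb0) hd
        linarith
      rw [this, card_empty, Nat.cast_zero]
      positivity
  have hmin : ∀ a ∈ A, ∃ m ∈ P a, ∀ p ∈ P a, m ≤ p := fun a ha =>
    exists_min_image (P a) id (mem_filter.mp ha).2
  choose! y hy1 hy2 using hmin
  have h1 : (T.card : ℝ) ≤ ∑ a ∈ A, ∑ p ∈ P a, ((S a p).card : ℝ) := by
    have h2 : T.card ≤ ∑ a ∈ A, ∑ p ∈ P a, (S a p).card :=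
      (card_le_card hcov).trans (card_biUnion_le.trans (sum_le_sum fun a _ =>
        card_biUnion_le.trans (sum_le_sum fun p _ => card_image_le)))
    exact_mod_cast h2
  have h2 : ∀ a ∈ A, ∑ p ∈ P a, ((S a p).card : ℝ) ≤
      C₁ * x * (C₂ * η) * (Lc η a / (a * log (y a) ^ 2)) := by
    intro a ha
    have hyp := (hPa a (y a) (hy1 a ha)).1
    have hy0 : (2 : ℝ) ≤ y a := by exact_mod_cast hyp.two_le
    have hly : 0 < log (y a : ℝ) := log_pos (by linarith)
    have ha0 : (0 : ℝ) < a := by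
      exact_mod_cast Nat.pos_of_ne_zero (hPa a (y a) (hy1 a ha)).2.2.1.1
    have h3 : ∀ p ∈ P a, ((S a p).card : ℝ) ≤ C₁ * (x / a) * (1 / log (y a) ^ 2) * lpc p := by
      intro p hp
      refine (hScard a p hp).trans ?_
      have hle : log (y a : ℝ) ≤ log p := log_le_log (by linarith) (by exact_mod_cast hy2 a ha p hp)
      have h4 : lpc p / log p ^ 2 ≤ lpc p / log (y a) ^ 2 :=
        div_le_div_of_nonneg_left (lpc_nonneg p) (by positivity) (pow_le_pow_left₀ hly.le hle 2)
      calc C₁ * (x / a) * (lpc p / log p ^ 2) ≤ C₁ * (x / a) * (lpc p / log (y a) ^ 2) := by gcongr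
        _ = _ := by ring
    refine (sum_le_sum h3).trans ?_
    rw [← mul_sum]
    calc _ ≤ C₁ * (x / a) * (1 / log (y a) ^ 2) * (C₂ * η * Lc η a) :=
          mul_le_mul_of_nonneg_left (hP η Y V a (P a) hη (hPa a)) (by positivity)
      _ = _ := by field_simp
  have h3 := h1.trans (sum_le_sum h2)
  rw [← mul_sum] at h3
  have hm : 1 ≤ V / η := by rw [le_div_iff₀ hη0]; linarith
  obtain ⟨n, hn1, hn2⟩ := hL (V / η) hm
  have h4 := hW η Y V n A (fun a => (y a : ℝ)) hη hY hV0 (by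
      rw [← mul_div_assoc, div_le_iff₀ hη0] at hn1; exact hn1) (by
      intro a ha
      obtain ⟨hpp, hYp, hPB, e, he, h5, h6⟩ := hPa a (y a) (hy1 a ha)
      have he0 : 0 ≤ log (e : ℝ) := log_natCast_nonneg e
      have hea : log (e : ℝ) ≤ log a :=
        log_le_log (by exact_mod_cast Nat.pos_of_dvd_of_pos he (Nat.pos_of_ne_zero hPB.1))
          (by exact_mod_cast Nat.le_of_dvd (Nat.pos_of_ne_zero hPB.1) he)
      exact ⟨hYp.le, by linarith, by linarith, hPB⟩)
  have h5 : C₃ * (η / (V ^ 2 * log Y)) * (2 * exp 1 * log 2) ^ n * ww n ≤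
      C₃ * (η / (V ^ 2 * log Y)) * (C₄ * (V / η) ^ 2 * dec (V / η)) := by
    rw [mul_assoc (C₃ * (η / (V ^ 2 * log Y)))]
    exact mul_le_mul_of_nonneg_left hn2 (by positivity)
  calc (T.card : ℝ) ≤ _ := h3
    _ ≤ C₁ * x * (C₂ * η) * (C₃ * (η / (V ^ 2 * log Y)) * (C₄ * (V / η) ^ 2 * dec (V / η))) :=
        mul_le_mul_of_nonneg_left (h4.trans h5) (by positivity)
    _ = _ := by field_simp

lemma exists_max_prime {d : ℕ} (hd0 : d ≠ 0) (hd1 : d ≠ 1) :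
    ∃ p : ℕ, p.Prime ∧ p ∣ d ∧ ∀ q : ℕ, q.Prime → q ∣ d → q ≤ p := by
  obtain ⟨q, hq, hqd⟩ := Nat.exists_prime_and_dvd hd1
  obtain ⟨p, hp, hmax⟩ := exists_max_image d.primeFactors id
    ⟨q, Nat.mem_primeFactors.mpr ⟨hq, hqd, hd0⟩⟩
  obtain ⟨h1, h2, _⟩ := Nat.mem_primeFactors.mp hp
  exact ⟨p, h1, h2, fun r hr hrd => hmax r (Nat.mem_primeFactors.mpr ⟨hr, hrd, hd0⟩)⟩

lemma splits3_of_le {η Y V : ℝ} {d d' p q : ℕ} (hd0 : d ≠ 0) (hd'0 : d' ≠ 0)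
    (hY : ∀ r : ℕ, r.Prime → r ∣ d * d' → Y < r) (hp : p.Prime) (hpd : p ∣ d)
    (hpmax : ∀ r : ℕ, r.Prime → r ∣ d → r ≤ p) (hq : q.Prime) (hqd : q ∣ d')
    (hqmax : ∀ r : ℕ, r.Prime → r ∣ d' → r ≤ q) (hpq : p ≤ q)
    (h1 : V ≤ log d) (h2 : log d ≤ V + 2 * η) : Splits3 η Y V (d * d') := by
  obtain ⟨e, rfl⟩ := hpd
  have he0 : e ≠ 0 := right_ne_zero_of_mul hd0
  have hlog : log ((p * e : ℕ) : ℝ) = log p + log e := by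
    rw [Nat.cast_mul, log_mul (by exact_mod_cast hp.ne_zero) (by exact_mod_cast he0)]
  rw [hlog] at h1 h2
  have key : ∀ a₁ b : ℕ, a₁ * b = d' → (∀ r : ℕ, r.Prime → r ∣ a₁ → r ≤ p) → b ≠ 1 →
      (∀ r : ℕ, r.Prime → r ∣ b → p ≤ r) → Splits3 η Y V (p * e * d') := by
    intro a₁ b hab ha hb1 hb
    have ha0 : a₁ ≠ 0 := left_ne_zero_of_mul (hab ▸ hd'0)
    have hb0 : b ≠ 0 := right_ne_zero_of_mul (hab ▸ hd'0)
    refine ⟨e * a₁, p, b, by rw [← hab]; ring, ⟨hp, hY p hp ((dvd_mul_right _ _).mul_right _),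
      ⟨mul_ne_zero he0 ha0, fun r hr hd => ⟨hY r hr ?_, ?_⟩⟩, e, dvd_mul_right _ _, h1, h2⟩, hb0, hb1, hb⟩
    · exact hd.trans ⟨p * b, by rw [← hab]; ring⟩
    · rcases (Nat.Prime.dvd_mul hr).mp hd with h | h
      · exact_mod_cast hpmax r hr (h.mul_left _)
      · exact_mod_cast ha r hr h
  rcases hpq.eq_or_lt with rfl | hlt
  · obtain ⟨c, rfl⟩ := hqd
    refine key c p (mul_comm _ _) (fun r hr hd => hqmax r hr (hd.mul_left _)) hp.ne_one ?_
    intro r hr hd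
    exact ((Nat.prime_dvd_prime_iff_eq hr hp).mp hd).ge
  · obtain ⟨a₁, b, hab, ha, hb⟩ := exists_split (fun r => r ≤ p) hd'0
    refine key a₁ b hab ha ?_ fun r hr hd => (not_le.mp (hb r hr hd)).le
    rintro rfl
    rw [mul_one] at hab
    exact absurd (ha q hq (hab ▸ hqd)) (not_le.mpr hlt)

lemma splits3_or {η Y V V' : ℝ} {d d' : ℕ} (hd0 : d ≠ 0) (hd'0 : d' ≠ 0) (hd1 : d ≠ 1) (hd'1 : d' ≠ 1)
    (hY : ∀ r : ℕ, r.Prime → r ∣ d * d' → Y < r) (h1 : V ≤ log d) (h2 : log d ≤ V + 2 * η)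
    (h3 : V' ≤ log d') (h4 : log d' ≤ V' + 2 * η) :
    Splits3 η Y V (d * d') ∨ Splits3 η Y V' (d * d') := by
  obtain ⟨p, hp, hpd, hpmax⟩ := exists_max_prime hd0 hd1
  obtain ⟨q, hq, hqd, hqmax⟩ := exists_max_prime hd'0 hd'1
  rcases le_total p q with h | h
  · exact Or.inl (splits3_of_le hd0 hd'0 hY hp hpd hpmax hq hqd hqmax h h1 h2)
  · right
    rw [mul_comm]
    exact splits3_of_le hd'0 hd0 (by rwa [mul_comm]) hq hqd hqmax hp hpd hpmax h h3 h4

lemma splits3_of_divisor {X Y Z W x : ℝ} {n : ℕ} (hZ : 2 ≤ Z) (hZW : 2 * Z ≤ W)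
    (hlam : 100 ≤ log Z / log (W / Z)) (hX : 2 * Z * W ≤ X) (hx : X / (log Z / log (W / Z)) ≤ x)
    (hn0 : n ≠ 0) (hnx : x / 2 < n) (hnx' : (n : ℝ) ≤ x) (hY : ∀ p : ℕ, p.Prime → p ∣ n → Y < p)
    (hd : ∃ d : ℕ, d ∣ n ∧ Z < d ∧ (d : ℝ) ≤ W) :
    log Z / log (W / Z) * log (W / Z) / 2 ≤ log (x / (2 * W)) ∧
    (Splits3 (log (W / Z)) Y (log Z) n ∨ Splits3 (log (W / Z)) Y (log (x / (2 * W))) n) := by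
  have l2 := log_two_gt_d9
  have hZ0 : 0 < Z := by linarith
  have hW0 : 0 < W := by linarith
  have hη : log 2 ≤ log (W / Z) := log_le_log (by norm_num) (by rwa [le_div_iff₀ hZ0])
  set η := log (W / Z) with hηd
  set lam := log Z / η with hlamd
  have hη0 : 0 < η := by linarith
  have hlam0 : 0 < lam := by linarith
  have hlZ : lam * η = log Z := by rw [hlamd]; field_simp
  have hlW : log W = log Z + η := by rw [hηd, log_div hW0.ne' hZ0.ne']; ring
  have hloglam : log lam ≤ lam * η / 2 := by
    have h1 := log_le_two_sqrt hlam0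
    have h2 : 10 ≤ √lam := by
      rw [show (10 : ℝ) = √100 by rw [show (100 : ℝ) = 10 ^ 2 by norm_num]; simp]
      exact sqrt_le_sqrt hlam
    have h3 := mul_self_sqrt hlam0.le
    nlinarith
  have hx0 : 0 < x := by
    have : 0 < X := lt_of_lt_of_le (by positivity) hX
    exact lt_of_lt_of_le (by positivity) hx
  have hV' : lam * η / 2 ≤ log (x / (2 * W)) := by
    have h1 : Z / lam ≤ x / (2 * W) := by
      rw [div_le_div_iff₀ hlam0 (by positivity)]
      rw [div_le_iff₀ hlam0] at hx
      linarith
    have h2 := log_le_log (by positivity) h1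
    rw [log_div hZ0.ne' hlam0.ne'] at h2
    linarith
  refine ⟨hV', ?_⟩
  obtain ⟨d, ⟨d', rfl⟩, hdZ, hdW⟩ := hd
  have hd0 : d ≠ 0 := left_ne_zero_of_mul hn0
  have hd'0 : d' ≠ 0 := right_ne_zero_of_mul hn0
  have hdr : (0 : ℝ) < d := by linarith
  have hd'r : (0 : ℝ) < d' := by exact_mod_cast Nat.pos_of_ne_zero hd'0
  push_cast at hnx hnx'
  have e1 : x / (2 * W) ≤ d' := by
    rw [div_le_iff₀ (by positivity)]
    nlinarith
  have e2 : (d' : ℝ) ≤ x / Z := by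
    rw [le_div_iff₀ hZ0]
    nlinarith
  have f1 := log_le_log (by positivity) e1
  have f2 := log_le_log hd'r e2
  have f3 : log (x / Z) = log (x / (2 * W)) + log 2 + η := by
    rw [log_div hx0.ne' hZ0.ne', log_div hx0.ne' (by positivity), log_mul (by norm_num) hW0.ne', hlW]
    ring
  have g1 := log_le_log hZ0 hdZ.le
  have g2 := log_le_log hdr hdW
  refine splits3_or hd0 hd'0 ?_ ?_ hY g1 (by linarith) f1 (by linarith)
  · rintro rfl
    push_cast at hdZ; linarith
  · rintro rfl
    rw [Nat.cast_one, log_one] at f1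
    nlinarith

lemma exists_dyadic_count : ∃ C : ℝ, 0 < C ∧ ∀ (X Y Z W x : ℝ) (T : Finset ℕ), 2 ≤ Y → 2 ≤ Z →
    2 * Z ≤ W → 100 ≤ log Z / log (W / Z) → 2 * Z * W ≤ X → X / (log Z / log (W / Z)) ≤ x →
    (∀ n ∈ T, n ≠ 0 ∧ x / 2 < n ∧ (n : ℝ) ≤ x ∧ (∀ p : ℕ, p.Prime → p ∣ n → Y < p) ∧
      ∃ d : ℕ, d ∣ n ∧ Z < d ∧ (d : ℝ) ≤ W) →
    (T.card : ℝ) ≤ C * (x / log Y) * dec (log Z / log (W / Z)) := by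
  obtain ⟨C, hC, hS⟩ := exists_count_splits
  refine ⟨C * (1 + 2 * 4 ^ (3 / 2 : ℝ)), by positivity,
    fun X Y Z W x T hY hZ hZW hlam hX hx hT => ?_⟩
  have l2 := log_two_gt_d9
  have hZ0 : 0 < Z := by linarith
  have hW0 : 0 < W := by linarith
  have hη : log 2 ≤ log (W / Z) := log_le_log (by norm_num) (by rwa [le_div_iff₀ hZ0])
  have hX0 : 0 < X := lt_of_lt_of_le (by positivity) hX
  have hlY : 0 < log Y := log_pos (by linarith)
  have hη0 : 0 < log (W / Z) := by linarith
  have hlam0 : 0 < log Z / log (W / Z) := by linarith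
  have hx0 : 0 < x := lt_of_lt_of_le (by positivity) hx
  have hdec := dec_pos (show 1 ≤ log Z / log (W / Z) by linarith)
  rcases T.eq_empty_or_nonempty with he | ⟨n₀, hn₀⟩
  · rw [he, card_empty, Nat.cast_zero]; positivity
  have hspl := fun n hn => splits3_of_divisor hZ hZW hlam hX hx (hT n hn).1 (hT n hn).2.1
    (hT n hn).2.2.1 (hT n hn).2.2.2.1 (hT n hn).2.2.2.2
  have hV' := (hspl n₀ hn₀).1
  have hlZ : log Z / log (W / Z) * log (W / Z) = log Z := by field_simp
  set η := log (W / Z) with hηd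
  set lam := log Z / η with hlamd
  classical
  have hcov : T ⊆ T.filter (Splits3 η Y (log Z)) ∪ T.filter (Splits3 η Y (log (x / (2 * W)))) := by
    rw [← filter_or]
    exact fun n hn => mem_filter.mpr ⟨hn, (hspl n hn).2⟩
  have h1 := hS η Y (log Z) x (T.filter (Splits3 η Y (log Z))) hη hY (by nlinarith) hx0.le
    fun n hn => ⟨(hT n (mem_filter.mp hn).1).2.2.1, (mem_filter.mp hn).2⟩
  have h2 := hS η Y (log (x / (2 * W))) x (T.filter (Splits3 η Y (log (x / (2 * W))))) hη hY
    (by nlinarith) hx0.le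
    fun n hn => ⟨(hT n (mem_filter.mp hn).1).2.2.1, (mem_filter.mp hn).2⟩
  have h3 : (T.card : ℝ) ≤ (T.filter (Splits3 η Y (log Z))).card +
      (T.filter (Splits3 η Y (log (x / (2 * W))))).card := by
    exact_mod_cast (card_le_card hcov).trans (card_union_le _ _)
  have h4 : dec (log (x / (2 * W)) / η) ≤ 2 * 4 ^ (3 / 2 : ℝ) * dec lam := by
    refine dec_half_le (by linarith) ?_
    rw [le_div_iff₀ hη0]; linarith
  have h5 : C * (x / log Y) * dec (log (x / (2 * W)) / η) ≤
      C * (x / log Y) * (2 * 4 ^ (3 / 2 : ℝ) * dec lam) :=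
    mul_le_mul_of_nonneg_left h4 (by positivity)
  have h6 : C * (1 + 2 * 4 ^ (3 / 2 : ℝ)) * (x / log Y) * dec lam =
    C * (x / log Y) * dec lam + C * (x / log Y) * (2 * 4 ^ (3 / 2 : ℝ) * dec lam) := by ring
  rw [h6]
  linarith

lemma dyadic_location {X : ℝ} {u : ℝ} (hu : u ≤ X) (I : ℕ) :
    u ≤ X / 2 ^ I ∨ ∃ i < I, X / 2 ^ i / 2 < u ∧ u ≤ X / 2 ^ i := by
  induction I with
  | zero => left; simpa using hu
  | succ I ih =>
    rcases ih with h | ⟨i, hi, h⟩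
    · rcases le_or_gt u (X / 2 ^ (I + 1)) with h' | h'
      · exact Or.inl h'
      · refine Or.inr ⟨I, Nat.lt_succ_self I, ?_, h⟩
        rwa [div_div, ← pow_succ]
    · exact Or.inr ⟨i, by omega, h⟩

lemma exists_finset_count : ∃ C : ℝ, 0 < C ∧ ∀ (X Y Z W : ℝ) (T : Finset ℕ), 2 ≤ Y → Y ≤ Z →
    2 * Z ≤ W → W ≤ Z ^ 2 → 2 * Z * W ≤ X →
    (∀ n ∈ T, n ≠ 0 ∧ (n : ℝ) ≤ X ∧ (∀ p : ℕ, p.Prime → p ∣ n → Y < p) ∧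
      ∃ d : ℕ, d ∣ n ∧ Z < d ∧ (d : ℝ) ≤ W) →
    (T.card : ℝ) ≤ C * (X / log Y) * dec (log Z / log (W / Z)) := by
  obtain ⟨C₁, hC₁, hS⟩ := exists_sieve
  obtain ⟨C₂, hC₂, hD⟩ := exists_dyadic_count
  obtain ⟨K, hK⟩ : ∃ K : ℝ, K = 4 ^ (3 / 2 : ℝ) := ⟨_, rfl⟩
  have hK0 : 0 < K := by positivity
  refine ⟨C₁ * (100 * K) + C₂ * 2, by positivity, fun X Y Z W T hY hYZ hZW hWZ hX hT => ?_⟩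
  classical
  have l2 := log_two_gt_d9
  have hZ0 : 0 < Z := by linarith
  have hW0 : 0 < W := by linarith
  have hη : log 2 ≤ log (W / Z) := log_le_log (by norm_num) (by rwa [le_div_iff₀ hZ0])
  have hX0 : 0 < X := lt_of_lt_of_le (by positivity) hX
  have hlY : 0 < log Y := log_pos (by linarith)
  have hη0 : 0 < log (W / Z) := by linarith
  have hηZ : log (W / Z) ≤ log Z := by
    refine log_le_log (by positivity) ?_
    rw [div_le_iff₀ hZ0]; linarith
  set lam := log Z / log (W / Z) with hlamd
  have hlam1 : 1 ≤ lam := by rwa [hlamd, one_le_div hη0]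
  have hlam0 : 0 < lam := by linarith
  have hdec := dec_pos hlam1
  have hinv := inv_le_dec hlam1
  rw [← hK] at hinv
  have hlamZ : lam ≤ 2 * Z := by
    rw [hlamd, div_le_iff₀ hη0]
    have := log_le_sub_one_of_pos hZ0
    nlinarith
  have hmem : ∀ n ∈ T, ∀ u : ℝ, (n : ℝ) ≤ u → n ∈ Sv u Y := fun n hn u hu =>
    mem_Sv.mpr ⟨(hT n hn).1, hu, fun p hp hd => ((hT n hn).2.2.1 p hp hd).le⟩
  have hYX : ∀ u, X / lam ≤ u → Y ≤ u := by
    intro u hu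
    refine le_trans ?_ hu
    rw [le_div_iff₀ hlam0]
    nlinarith
  rcases le_or_gt lam 100 with h | h
  · have h1 : T.card ≤ (Sv X Y).card := card_le_card fun n hn => hmem n hn X (hT n hn).2.1
    have h2 : (T.card : ℝ) ≤ C₁ * (X / log Y) :=
      (by exact_mod_cast h1 : (T.card : ℝ) ≤ (Sv X Y).card).trans
        (hS X Y hY (hYX X (div_le_self hX0.le hlam1)))
    have h3 : 1 ≤ 100 * (K * dec lam) := by
      have : 1 / 100 ≤ 1 / lam := one_div_le_one_div_of_le hlam0 h
      linarith
    have h4 : C₁ * (X / log Y) * 1 ≤ C₁ * (X / log Y) * (100 * (K * dec lam)) :=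
      mul_le_mul_of_nonneg_left h3 (by positivity)
    have h5 : 0 ≤ C₂ * 2 * (X / log Y) * dec lam := by positivity
    linarith
  · obtain ⟨I, hI1, hI2⟩ := exists_nat_pow_near hlam1 (one_lt_two (α := ℝ))
    set D : ℕ → Finset ℕ := fun i => T.filter fun n => X / 2 ^ i / 2 < n ∧ (n : ℝ) ≤ X / 2 ^ i with hDd
    have hcov : T ⊆ Sv (X / 2 ^ I) Y ∪ (range I).biUnion D := by
      intro n hn
      rcases dyadic_location (hT n hn).2.1 I with h1 | ⟨i, hi, h1⟩
      · exact mem_union_left _ (hmem n hn _ h1)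
      · exact mem_union_right _ (mem_biUnion.mpr ⟨i, mem_range.mpr hi, mem_filter.mpr ⟨hn, h1⟩⟩)
    have h1 : (T.card : ℝ) ≤ (Sv (X / 2 ^ I) Y).card + ∑ i ∈ range I, ((D i).card : ℝ) := by
      have h2 : T.card ≤ (Sv (X / 2 ^ I) Y).card + ∑ i ∈ range I, (D i).card :=
        (card_le_card hcov).trans ((card_union_le _ _).trans (Nat.add_le_add_left card_biUnion_le _))
      exact_mod_cast h2
    have h2 : ((Sv (X / 2 ^ I) Y).card : ℝ) ≤ C₁ * (X / log Y) * (2 * (K * dec lam)) := by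
      refine (hS _ Y hY (hYX _ (div_le_div_of_nonneg_left hX0.le (by positivity) hI1))).trans ?_
      have h3 : 1 / 2 ^ I ≤ 2 * (1 / lam) := by
        rw [mul_one_div, div_le_div_iff₀ (by positivity) hlam0]
        rw [pow_succ] at hI2; linarith
      calc C₁ * (X / 2 ^ I / log Y) = C₁ * (X / log Y) * (1 / 2 ^ I) := by ring
        _ ≤ _ := mul_le_mul_of_nonneg_left (by linarith) (by positivity)
    have h3 : ∀ i ∈ range I, ((D i).card : ℝ) ≤ C₂ * (X / log Y) * dec lam * (1 / 2) ^ i := by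
      intro i hi
      have hi2 : (2 : ℝ) ^ i ≤ lam :=
        (pow_le_pow_right₀ (by norm_num) (mem_range.mp hi).le).trans hI1
      have h4 := hD X Y Z W (X / 2 ^ i) (D i) hY (by linarith) hZW h.le hX
        (div_le_div_of_nonneg_left hX0.le (by positivity) hi2) fun n hn => by
          obtain ⟨hnT, h5, h6⟩ := mem_filter.mp hn
          exact ⟨(hT n hnT).1, h5, h6, (hT n hnT).2.2⟩
      refine h4.trans (le_of_eq ?_)
      rw [← hlamd, div_pow, one_pow]; ring
    have h4 := sum_le_sum h3
    rw [← mul_sum] at h4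
    have h5 : C₂ * (X / log Y) * dec lam * ∑ i ∈ range I, ((1 : ℝ) / 2) ^ i ≤
        C₂ * (X / log Y) * dec lam * 2 :=
      mul_le_mul_of_nonneg_left (sum_half_pow_le I) (by positivity)
    have h6 : (C₁ * (100 * K) + C₂ * 2) * (X / log Y) * dec lam =
      98 * (C₁ * (X / log Y) * (K * dec lam)) + C₁ * (X / log Y) * (2 * (K * dec lam)) +
        C₂ * (X / log Y) * dec lam * 2 := by ring
    have h7 : 0 ≤ C₁ * (X / log Y) * (K * dec lam) := by positivity
    linarith

end FordDivisor

/-- There is an absolute constant `C > 0` such that uniformly for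
`2 ≤ Y ≤ Z ≤ W ≤ X/(2Z)` and `2Z ≤ W ≤ Z²`,
`H(X,Y;Z,W) ≤ C·(X/log Y)·λ^{−δ}·(1 + log λ)^{−3/2}`, where
`λ = log Z/log(W/Z)` and `δ = 1 − (1 + log log 2)/log 2`. -/
theorem Hcount_upper_bound :
    ∃ C : ℝ, 0 < C ∧ ∀ X Y Z W : ℝ,
      2 ≤ Y → Y ≤ Z → Z ≤ W → W ≤ X / (2 * Z) → 2 * Z ≤ W → W ≤ Z ^ 2 →
      (Hcount X Y Z W : ℝ) ≤
        C * (X / Real.log Y) *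
          (Real.log Z / Real.log (W / Z)) ^
            (-(1 - (1 + Real.log (Real.log 2)) / Real.log 2)) *
          (1 + Real.log (Real.log Z / Real.log (W / Z))) ^ (-(3 / 2) : ℝ) := by
  obtain ⟨C, hC, h⟩ := FordDivisor.exists_finset_count
  refine ⟨C, hC, fun X Y Z W hY hYZ _ hWX hZW hWZ => ?_⟩
  have hfin : {n : ℕ | 0 < n ∧ (n : ℝ) ≤ X ∧ (∀ p : ℕ, p.Prime → p ∣ n → Y < (p : ℝ)) ∧
      ∃ d : ℕ, d ∣ n ∧ Z < (d : ℝ) ∧ (d : ℝ) ≤ W}.Finite :=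
    (Set.finite_Iic ⌊X⌋₊).subset fun n hn => Nat.le_floor hn.2.1
  have h1 := h X Y Z W hfin.toFinset hY hYZ hZW hWZ
    (by rw [le_div_iff₀ (by linarith)] at hWX; linarith)
    (fun n hn => by
      obtain ⟨h0, h1, h2, h3⟩ := hfin.mem_toFinset.mp hn
      exact ⟨h0.ne', h1, h2, h3⟩)
  rw [← Set.ncard_eq_toFinset_card _ hfin] at h1
  unfold FordDivisor.dec FordDivisor.dlt at h1
  unfold Hcount
  rw [mul_assoc (C * (X / Real.log Y))]
  exact h1
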